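/- arXiv:1006.3013 — 7 statements merged into one kernel-verified Lean document; each statement's English description precedes it below -/
import Mathlib

section
/- For every n ≥ 1 there exists an involution ψ_n : Y_n → Y_n such that: (i) A_1 A_2 ... A_k is a fixed point of ψ_n if and only if |A_i| = 1 for all 1 ≤ i ≤ k (so k = n) and there are no indices p < q and integer j with A_p = {j+1} and A_q = {j}; (ii) if A_1 A_2 ... A_k is not a fixed point and ψ_n(A_1 ... A_k) = B_1 B_2 ... B_r, then r = k+1 or r = k-1; and (iii) ψ_n preserves the statistic d, i.e., d(ψ_n(A)) = d(A) for all A ∈ Y_n. -/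
/-- A Fishburn diagram with an arbitrary number of columns: a pair of a length `k` and
a sequence of sets indexed by `Fin k`. -/
def FDiagram := Σ k : ℕ, Fin k → Finset ℕ

/-- Membership in `Y_n`: a valid Fishburn diagram (each `A_i` a nonempty subset of
`{0, …, i-1}`, 0-based `A i ⊆ {0, …, i}`) with exactly `n` dots. -/
def memY (n : ℕ) (A : FDiagram) : Prop :=
  (∀ i : Fin A.1, A.2 i ≠ ∅ ∧ A.2 i ⊆ Finset.range (i.1 + 1)) ∧
    (∑ i, (A.2 i).card) = n

/-- The statistic `d`: the number of columns `i` (1-based) with `i - 1 ∈ A_i`,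
i.e. 0-based the number of `i` with `i ∈ A i`. -/
def dstat (A : FDiagram) : ℕ :=
  (Finset.univ.filter (fun i : Fin A.1 => i.1 ∈ A.2 i)).card

/-- The weighted number of words `x₁ x₂ …`, read from right to left, whose letter at the position
described by `(b, τ)` is smaller than `b`, which contain no letter of `B` and in which no letter
`j + 1` stands to the left of a letter `j`. The letter `b - 1` has weight `τ`. -/
def boundedCount {R : Type*} [CommRing R] : List (ℕ × R) → Finset ℕ → R
  | [], _ => 1
  | (b, τ) :: l, B => ∑ x ∈ Finset.range b,
      if x ∈ B then 0 else (if x + 1 = b then τ else 1) * boundedCount l (insert (x + 1) B)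

/-- The bounds of the words `x₁ … xₙ` with `xᵢ < i`, with weight `u` on `xᵢ = i - 1`. -/
def staircase {R : Type*} (u : R) : ℕ → List (ℕ × R)
  | 0 => []
  | n + 1 => (n + 1, u) :: staircase u n

lemma staircase_bound {R : Type*} (u : R) (n : ℕ) : ∀ b ∈ staircase u n, b.1 ≤ n := by
  induction n with
  | zero => simp [staircase]
  | succ n ih =>
    simp only [staircase, List.mem_cons, forall_eq_or_imp, le_refl, true_and]
    exact fun b hb => (ih b hb).trans n.le_succ

section BoundedCount

variable {R : Type*} [CommRing R]

/-- Excluding the letter `c` from a position whose letters are at most `c`. -/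
def cutBound (c : ℕ) (b : ℕ × R) : ℕ × R := if b.1 = c + 1 then (c, 1) else b

lemma boundedCount_insert (c : ℕ) (l : List (ℕ × R)) (hl : ∀ b ∈ l, b.1 ≤ c + 1) (B : Finset ℕ) :
    boundedCount l (insert c B) = boundedCount (l.map (cutBound c)) B := by
  induction l generalizing B with
  | nil => simp [boundedCount]
  | cons a l ih =>
    obtain ⟨b, τ⟩ := a
    have ih' := ih fun b hb => hl b (List.mem_cons_of_mem _ hb)
    have hb : b ≤ c + 1 := hl (b, τ) (by simp)
    simp only [List.map_cons, cutBound]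
    split_ifs with h
    · subst h
      simp only [boundedCount, Finset.sum_range_succ, Finset.mem_insert_self, if_true, add_zero]
      refine Finset.sum_congr rfl fun x hx => ?_
      have hx' := Finset.mem_range.1 hx
      rw [Finset.insert_comm, ih']
      simp only [Finset.mem_insert, hx'.ne, false_or]
      split_ifs <;> first | rfl | omega
    · simp only [boundedCount]
      refine Finset.sum_congr rfl fun x hx => ?_
      have hx' := Finset.mem_range.1 hx
      have : x ≠ c := by omega
      rw [Finset.insert_comm, ih']
      simp only [Finset.mem_insert, this, false_or]

lemma boundedCount_insert_of_le (c : ℕ) (l : List (ℕ × R)) (hl : ∀ b ∈ l, b.1 ≤ c)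
    (B : Finset ℕ) : boundedCount l (insert c B) = boundedCount l B := by
  rw [boundedCount_insert c l fun b hb => (hl b hb).trans c.le_succ]
  congr 1
  conv_rhs => rw [← List.map_id l]
  refine List.map_congr_left fun b hb => ?_
  have := hl b hb
  simp only [cutBound, id]
  rw [if_neg (by omega)]

lemma boundedCount_peel (β b : ℕ) (hβ : β ≤ b) (τ : R) (r : ℕ) (l : List (ℕ × R))
    (B : Finset ℕ) :
    boundedCount (List.replicate r (β, 1) ++ (b + 1, τ) :: l) B =
      boundedCount (List.replicate r (β, 1) ++ (b, 1) :: l) B +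
      if b ∈ B then 0 else
        τ * boundedCount (List.replicate r (if b = β then β - 1 else β, 1) ++ l)
          (insert (b + 1) B) := by
  induction r generalizing B with
  | zero =>
    simp only [List.replicate_zero, List.nil_append, boundedCount, Finset.sum_range_succ, if_true]
    congr 1
    refine Finset.sum_congr rfl fun x hx => ?_
    have hx' := Finset.mem_range.1 hx
    rw [if_neg (show ¬ x + 1 = b + 1 by omega)]
    simp
  | succ r ih =>
    simp only [List.replicate_succ, List.cons_append, boundedCount, ite_self, one_mul]
    simp only [ih]
    by_cases hbB : b ∈ B
    · simp [hbB]
    simp only [Finset.mem_insert, hbB, or_false, if_false]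
    by_cases hb : b = β
    · subst hb
      rcases b with _ | b
      · simp
      simp only [Finset.sum_range_succ, if_true, Nat.add_sub_cancel, add_zero]
      rw [Finset.mul_sum, add_right_comm (Finset.sum _ _), ← Finset.sum_add_distrib]
      congr 1
      · refine Finset.sum_congr rfl fun x hx => ?_
        have hx' := Finset.mem_range.1 hx
        rw [if_neg (show ¬ b + 1 = x + 1 by omega), Finset.insert_comm]
        simp only [show ¬ x = b + 1 + 1 by omega, false_or]
        split_ifs <;> simp
    · simp only [hb, if_false]
      rw [Finset.mul_sum, ← Finset.sum_add_distrib]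
      refine Finset.sum_congr rfl fun x hx => ?_
      have hx' := Finset.mem_range.1 hx
      rw [if_neg (show ¬ b = x + 1 by omega), Finset.insert_comm]
      simp only [show ¬ x = b + 1 by omega, false_or]
      split_ifs <;> simp

/-- Words bounded by a staircase of length `j`, followed by `p` letters smaller than `j` and
`r` letters smaller than `j - 2`. -/
def countTwo (u : R) (j p r : ℕ) : R :=
  boundedCount (List.replicate r (j - 2, 1) ++ (List.replicate p (j, 1) ++ staircase u j)) ∅

/-- Words bounded by a staircase of length `j`, followed by `r` letters smaller than `j - 1`. -/
def countOne (u : R) (j r : ℕ) : R :=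
  boundedCount (List.replicate r (j - 1, 1) ++ staircase u j) ∅

lemma countTwo_succ (u : R) (k p r : ℕ) : countTwo u (k + 2) (p + 1) r =
    countTwo u (k + 2) p (r + 1) + countTwo u (k + 1) (p + 1) r + countTwo u (k + 2) p r := by
  have hmap : List.map (cutBound (k + 1)) (List.replicate r (k - 1, (1 : R)) ++
      (List.replicate p (k + 2, 1) ++ staircase u (k + 2))) =
      List.replicate r (k - 1, 1) ++
        (List.replicate (p + 1) (k + 1, 1) ++ staircase u (k + 1)) := by
    rw [List.replicate_succ']
    simp only [List.map_append, List.map_replicate, staircase, List.map_cons, cutBound]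
    have : List.map (cutBound (k + 1)) (staircase u k) = staircase u k := by
      conv_rhs => rw [← List.map_id (staircase u k)]
      refine List.map_congr_left fun b hb => ?_
      have := staircase_bound u k b hb
      simp only [cutBound, id]
      rw [if_neg (by omega)]
    simp only [this, show ¬ k - 1 = k + 1 + 1 by omega, show ¬ k + 1 = k + 1 + 1 by omega, if_false,
      if_true, List.append_assoc, List.cons_append, List.nil_append]
  have h1 := boundedCount_peel k (k + 1) (by omega) (1 : R) r
    (List.replicate p (k + 2, 1) ++ staircase u (k + 2)) ∅
  have h2 := boundedCount_peel k k le_rfl (1 : R) r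
    (List.replicate p (k + 2, 1) ++ staircase u (k + 2)) ∅
  simp only [if_true] at h2
  rw [boundedCount_insert (k + 1), hmap] at h2
  · rw [boundedCount_insert_of_le] at h1
    · simp only [Finset.notMem_empty, if_false, one_mul, show ¬ k + 1 = k by omega] at h1 h2
      simp only [countTwo, List.replicate_succ (n := p), List.cons_append, Nat.add_sub_cancel,
        List.replicate_succ' (n := r), List.append_assoc, List.nil_append]
      rw [h1, h2]
      simp [List.replicate_succ]
    · rintro b hb
      simp only [List.mem_append, List.mem_replicate] at hb
      rcases hb with ⟨_, rfl⟩ | ⟨_, rfl⟩ | hb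
      · dsimp only; split_ifs <;> omega
      · simp
      · exact staircase_bound u _ b hb
  · rintro b hb
    simp only [List.mem_append, List.mem_replicate] at hb
    rcases hb with ⟨_, rfl⟩ | ⟨_, rfl⟩ | hb
    · simp; omega
    · simp
    · exact staircase_bound u _ b hb

lemma countTwo_zero (u : R) (k r : ℕ) : countTwo u (k + 2) 0 r =
    u * countOne u (k + 1) r + countTwo u (k + 1) 0 r + countOne u (k + 1) (r + 1) := by
  have h1 := boundedCount_peel k (k + 1) (by omega) u r (staircase u (k + 1)) ∅
  have h2 := boundedCount_peel k k le_rfl (1 : R) r (staircase u (k + 1)) ∅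
  rw [boundedCount_insert_of_le] at h1 h2
  · simp only [Finset.notMem_empty, if_false, one_mul, show ¬ k + 1 = k by omega, if_true] at h1 h2
    simp only [countTwo, countOne, List.replicate_zero, List.nil_append, Nat.add_sub_cancel,
      List.replicate_succ' (n := r), List.append_assoc, List.cons_append]
    rw [staircase, h1, h2]
    simp only [Nat.reduceSubDiff]
    ring
  · rintro b hb
    simp only [List.mem_append, List.mem_replicate] at hb
    rcases hb with ⟨_, rfl⟩ | hb
    · simp; omega
    · exact staircase_bound u _ b hb
  · rintro b hb
    simp only [List.mem_append, List.mem_replicate] at hb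
    rcases hb with ⟨_, rfl⟩ | hb
    · dsimp only; split_ifs <;> omega
    · exact (staircase_bound u _ b hb).trans (by omega)

lemma countOne_succ (u : R) (k r : ℕ) : countOne u (k + 1) r =
    u * countOne u k r + countTwo u k (r + 1) 0 := by
  have h1 := boundedCount_peel k k le_rfl u r (staircase u k) ∅
  rw [boundedCount_insert_of_le] at h1
  · simp only [Finset.notMem_empty, if_false, if_true] at h1
    simp only [countTwo, countOne, List.replicate_zero, List.nil_append, Nat.add_sub_cancel,
      List.replicate_succ' (n := r), List.append_assoc, List.cons_append]
    rw [staircase, h1, add_comm]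
  · rintro b hb
    simp only [List.mem_append, List.mem_replicate] at hb
    rcases hb with ⟨_, rfl⟩ | hb
    · simp; omega
    · exact (staircase_bound u _ b hb).trans (by omega)

lemma countTwo_one (u : R) (p r : ℕ) : countTwo u 1 p r = if r = 0 then u else 0 := by
  rcases r with _ | r
  · simp only [countTwo, List.replicate_zero, List.nil_append, if_true]
    suffices ∀ B : Finset ℕ, 0 ∉ B →
        boundedCount (List.replicate p (1, 1) ++ staircase u 1) B = u from this ∅ (by simp)
    induction p with
    | zero => intro B hB; simp [staircase, boundedCount, hB]
    | succ p ih =>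
      intro B hB
      simp only [List.replicate_succ, List.cons_append, boundedCount]
      simp [hB, ih]
  · simp [countTwo, List.replicate_succ, boundedCount]

lemma countOne_one (u : R) (r : ℕ) : countOne u 1 r = if r = 0 then u else 0 := by
  rcases r with _ | r
  · simp [countOne, staircase, boundedCount]
  · simp [countOne, List.replicate_succ, boundedCount]

end BoundedCount

section FunctionalEquation

open Polynomial

variable {K : Type*} [CommRing K]

/-- If `a` and `b = (1 - Z) a - 1` have the mixed moments `x p r = L (a ^ p * b ^ r)`, this
is `L`. -/
noncomputable def momentFunctional (x : ℕ → ℕ → K) : K[X] →ₗ[K] K :=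
  Polynomial.lsum fun p => LinearMap.mulRight K (x p 0)

lemma momentFunctional_C_mul_X_pow (x : ℕ → ℕ → K) (c : K) (p : ℕ) :
    momentFunctional x (C c * X ^ p) = c * x p 0 := by
  simp [momentFunctional, C_mul_X_pow_eq_monomial]

lemma momentFunctional_mixed {x : ℕ → ℕ → K} {Z : K}
    (hx : ∀ p r, x (p + 1) r = x p (r + 1) + Z * x (p + 1) r + x p r) (p r : ℕ) :
    momentFunctional x (X ^ p * (C (1 - Z) * X - 1) ^ r) = x p r := by
  induction r generalizing p with
  | zero => simpa using momentFunctional_C_mul_X_pow x 1 p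
  | succ r ih =>
    have : (X : K[X]) ^ p * (C (1 - Z) * X - 1) ^ (r + 1) =
        (1 - Z) • (X ^ (p + 1) * (C (1 - Z) * X - 1) ^ r) - X ^ p * (C (1 - Z) * X - 1) ^ r := by
      rw [smul_eq_C_mul]; ring
    rw [this, map_sub, map_smul, ih, ih, smul_eq_mul]
    linear_combination hx p r

lemma momentFunctional_comp {x : ℕ → ℕ → K} {y : ℕ → K} {Z u : K}
    (hx : ∀ p r, x (p + 1) r = x p (r + 1) + Z * x (p + 1) r + x p r)
    (hx0 : ∀ r, x 0 r = Z * (u * y r + x 0 r + y (r + 1)) + if r = 0 then u * Z else 0)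
    (hy : ∀ r, y r = Z * (u * y r + x (r + 1) 0) + if r = 0 then u * Z else 0) (f : K[X]) :
    (1 - u * Z) * (1 - Z) * momentFunctional x (f.comp (C (1 - Z) * X - 1)) =
      Z ^ 2 * momentFunctional x (X * (X + C u) * f) + u * Z * f.eval 0 := by
  induction f using Polynomial.induction_on' with
  | add f g hf hg =>
    simp only [add_comp, map_add, mul_add, eval_add, hf, hg]
    simp only [mul_add] at hf hg ⊢
    ring
  | monomial r c =>
    rw [← C_mul_X_pow_eq_monomial]
    have h1 : (C c * X ^ r : K[X]).comp (C (1 - Z) * X - 1) =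
        c • (X ^ 0 * (C (1 - Z) * X - 1) ^ r) := by
      simp [smul_eq_C_mul]
    have h2 : (X * (X + C u) * (C c * X ^ r) : K[X]) =
        C c * X ^ (r + 2) + C (c * u) * X ^ (r + 1) := by
      rw [C_mul]; ring
    rw [h1, h2, map_smul, momentFunctional_mixed hx, map_add, momentFunctional_C_mul_X_pow,
      momentFunctional_C_mul_X_pow, smul_eq_mul]
    have e1 := hx0 r
    have e2 := hy r
    have e3 := hy (r + 1)
    rcases r with _ | r
    · simp only [if_true, Nat.succ_ne_zero, if_false, pow_zero, mul_one, eval_C,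
        zero_add] at e1 e2 e3 ⊢
      linear_combination c * (1 - u * Z) * e1 + c * Z * u * e2 + c * Z * e3
    · simp only [Nat.succ_ne_zero, if_false] at e1 e2 e3 ⊢
      simp only [eval_mul, eval_C, eval_pow, eval_X, ne_eq, Nat.succ_ne_zero, not_false_eq_true,
        zero_pow, mul_zero, add_zero]
      linear_combination c * (1 - u * Z) * e1 + c * Z * u * e2 + c * Z * e3

/-- The polynomials `∏ᵢ aᵢ (aᵢ + u)`, where `a₀ = X` and `aᵢ₊₁ = q (aᵢ + 1)`. -/
noncomputable def orbitProd (q u : K) : ℕ → K[X]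
  | 0 => 1
  | N + 1 => X * (X + C u) * (orbitProd q u N).comp (C q * (X + 1))

/-- The partial sums of `x ∑ q ^ (N + 1) ∏ᵢ (q ^ i - 1) (q ^ i x - 1)`. -/
def doubleSum (q x : K) (M : ℕ) : K :=
  ∑ N ∈ Finset.range M, q ^ (N + 1) * x *
    ∏ i ∈ Finset.range N, (q ^ (i + 1) - 1) * (q ^ (i + 1) * x - 1)

lemma orbitProd_eval {q Z : K} (hq : (1 - Z) * q = 1) (u : K) (N m : ℕ) (e : K)
    (he : Z * e = q ^ (m + 1) - 1) : Z ^ (2 * N) * (orbitProd q u N).eval e =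
      ∏ i ∈ Finset.range N, (q ^ (m + i + 1) - 1) * (q ^ (m + i + 1) - (1 - u * Z)) := by
  induction N generalizing m e with
  | zero => simp [orbitProd]
  | succ N ih =>
    rw [Finset.prod_range_succ']
    have := ih (m + 1) (q * (e + 1)) (by linear_combination q * he - hq)
    simp only [orbitProd, eval_mul, eval_X, eval_add, eval_C, eval_comp, eval_one, add_zero]
    rw [show 2 * (N + 1) = 2 * N + 2 by ring, pow_add]
    have h2 : ∏ i ∈ Finset.range N,
        (q ^ (m + (i + 1) + 1) - 1) * (q ^ (m + (i + 1) + 1) - (1 - u * Z)) =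
      ∏ i ∈ Finset.range N, (q ^ (m + 1 + i + 1) - 1) * (q ^ (m + 1 + i + 1) - (1 - u * Z)) := by
      refine Finset.prod_congr rfl fun i _ => ?_
      rw [show m + (i + 1) + 1 = m + 1 + i + 1 by ring]
    rw [h2, ← this, ← he, show q ^ (m + 1) - (1 - u * Z) = Z * (e + u) by linear_combination -he]
    ring

lemma zeroth_moment_eq {x : ℕ → ℕ → K} {y : ℕ → K} {Z u q w : K}
    (hq : (1 - Z) * q = 1) (hw : (1 - u * Z) * w = 1)
    (hx : ∀ p r, x (p + 1) r = x p (r + 1) + Z * x (p + 1) r + x p r)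
    (hx0 : ∀ r, x 0 r = Z * (u * y r + x 0 r + y (r + 1)) + if r = 0 then u * Z else 0)
    (hy : ∀ r, y r = Z * (u * y r + x (r + 1) 0) + if r = 0 then u * Z else 0) (M : ℕ) :
    x 0 0 = u * Z * doubleSum q w M +
      (q * w) ^ M * Z ^ (2 * M) * momentFunctional x (orbitProd q u M) := by
  induction M with
  | zero =>
    have := momentFunctional_C_mul_X_pow x 1 0
    simp only [map_one, pow_zero, mul_one, one_mul] at this
    simp [doubleSum, orbitProd, this]
  | succ M ih =>
    have key := momentFunctional_comp hx hx0 hy ((orbitProd q u M).comp (C q * (X + 1)))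
    rw [comp_assoc] at key
    have hc : (C q * (X + 1) : K[X]).comp (C (1 - Z) * X - 1) = X := by
      have : C q * C (1 - Z) = (1 : K[X]) := by rw [← C_mul, mul_comm, hq, C_1]
      simp only [mul_comp, C_comp, add_comp, X_comp, one_comp]
      linear_combination X * this
    rw [hc, comp_X] at key
    have hev := orbitProd_eval hq u M 0 q (by linear_combination -hq)
    have he0 : ((orbitProd q u M).comp (C q * (X + 1))).eval 0 = (orbitProd q u M).eval q := by
      simp [eval_comp]
    rw [he0, show X * (X + C u) * (orbitProd q u M).comp (C q * (X + 1)) = orbitProd q u (M + 1)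
      from rfl] at key
    have hprod : w ^ M * ∏ i ∈ Finset.range M,
        (q ^ (0 + i + 1) - 1) * (q ^ (0 + i + 1) - (1 - u * Z)) =
        ∏ i ∈ Finset.range M, (q ^ (i + 1) - 1) * (q ^ (i + 1) * w - 1) := by
      rw [← Finset.card_range M, ← Finset.prod_const, Finset.card_range, ← Finset.prod_mul_distrib]
      refine Finset.prod_congr rfl fun i _ => ?_
      rw [zero_add]
      linear_combination -(q ^ (i + 1) - 1) * hw
    rw [doubleSum, Finset.sum_range_succ, ← doubleSum, ← hprod, ← hev, ih]
    have key2 : momentFunctional x (orbitProd q u M) = q * w * (Z ^ 2 *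
        momentFunctional x (orbitProd q u (M + 1)) + u * Z * (orbitProd q u M).eval q) := by
      rw [← key]
      linear_combination (-(1 - u * Z) * w * momentFunctional x (orbitProd q u M)) * hq
        - momentFunctional x (orbitProd q u M) * hw
    rw [key2]
    ring

lemma doubleSum_shift {Q q v w : K} (hq : Q * q = 1) (hw : v * w = 1) (M : ℕ) :
    doubleSum q w M = 1 - ∏ i ∈ Finset.range M, (q ^ (i + 1) - 1) * (q ^ (i + 1) * w - 1) +
      (1 - v * Q) * doubleSum q (q * w) M := by
  induction M with
  | zero => simp [doubleSum]
  | succ M ih =>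
    have hstep : ∀ x : K, doubleSum q x (M + 1) = doubleSum q x M + q ^ (M + 1) * x *
        ∏ i ∈ Finset.range M, (q ^ (i + 1) - 1) * (q ^ (i + 1) * x - 1) :=
      fun x => Finset.sum_range_succ _ _
    have hshift : (1 - q * w) *
        ∏ i ∈ Finset.range M, (q ^ (i + 1) - 1) * (q ^ (i + 1) * (q * w) - 1) =
        (∏ i ∈ Finset.range M, (q ^ (i + 1) - 1) * (q ^ (i + 1) * w - 1)) *
          (1 - q ^ (M + 1) * w) := by
      clear ih hstep
      induction M with
      | zero => simp
      | succ M ih =>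
        rw [Finset.prod_range_succ, Finset.prod_range_succ, ← mul_assoc, ih]
        ring
    rw [hstep, hstep, ih, Finset.prod_range_succ]
    have hfac : (1 - v * Q) * (q * w) = -(1 - q * w) := by
      linear_combination (-v * w) * hq - hw
    linear_combination q ^ (M + 1) * hshift - (q ^ (M + 1) *
      ∏ i ∈ Finset.range M, (q ^ (i + 1) - 1) * (q ^ (i + 1) * (q * w) - 1)) * hfac

lemma doubleSum_eq {Z q : K} (hq : (1 - Z) * q = 1) (M m : ℕ) (v w : K) (hw : v * w = 1)
    (hv : Z ∣ 1 - v) : Z ^ M ∣ (1 - v) * doubleSum q w M -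
      ∑ k ∈ Finset.range m, ∏ i ∈ Finset.range (k + 1), (1 - v * (1 - Z) ^ i) -
      (∏ i ∈ Finset.range (m + 1), (1 - v * (1 - Z) ^ i)) * doubleSum q (q ^ m * w) M := by
  induction m generalizing v w with
  | zero => simp
  | succ m ih =>
    have hdvd : Z ∣ 1 - v * (1 - Z) := by
      have := dvd_add hv (Dvd.intro_left v rfl : Z ∣ v * Z)
      exact this.trans (dvd_of_eq (by ring))
    have h1 := ih (v * (1 - Z)) (q * w) (by linear_combination v * w * hq + hw) hdvd
    have h2 : Z ^ M ∣ ∏ i ∈ Finset.range M, (q ^ (i + 1) - 1) * (q ^ (i + 1) * w - 1) := by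
      rw [← Finset.card_range M, ← Finset.prod_const, Finset.card_range]
      refine Finset.prod_dvd_prod_of_dvd _ _ fun i _ => Dvd.dvd.mul_right ?_ _
      have hq1 : q - 1 = Z * q := by linear_combination hq
      exact (Dvd.intro q hq1.symm).trans (sub_one_dvd_pow_sub_one q (i + 1))
    rw [doubleSum_shift hq hw M]
    have h3 := dvd_sub (Dvd.dvd.mul_left h1 (1 - v)) (Dvd.dvd.mul_left h2 (1 - v))
    refine h3.trans (dvd_of_eq ?_)
    have hp : ∀ k, ∏ i ∈ Finset.range (k + 1), (1 - v * (1 - Z) ^ i) =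
        (1 - v) * ∏ i ∈ Finset.range k, (1 - v * (1 - Z) * (1 - Z) ^ i) := by
      intro k
      rw [Finset.prod_range_succ', mul_comm]
      congr 1
      · simp
      · exact Finset.prod_congr rfl fun i _ => by ring
    rw [Finset.sum_range_succ']
    simp only [hp _, Finset.range_zero, Finset.prod_empty, ← Finset.mul_sum]
    rw [pow_succ]
    simp only [mul_assoc]
    ring

/-- The zeroth moment, modulo an arbitrary power of `Z`. -/
lemma dvd_zeroth_moment_sub {x : ℕ → ℕ → K} {y : ℕ → K} {Z u q w : K}
    (hq : (1 - Z) * q = 1) (hw : (1 - u * Z) * w = 1)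
    (hx : ∀ p r, x (p + 1) r = x p (r + 1) + Z * x (p + 1) r + x p r)
    (hx0 : ∀ r, x 0 r = Z * (u * y r + x 0 r + y (r + 1)) + if r = 0 then u * Z else 0)
    (hy : ∀ r, y r = Z * (u * y r + x (r + 1) 0) + if r = 0 then u * Z else 0) (M : ℕ) :
    Z ^ M ∣ x 0 0 - ∑ k ∈ Finset.range M,
      ∏ i ∈ Finset.range (k + 1), (1 - (1 - u * Z) * (1 - Z) ^ i) := by
  have h1 := doubleSum_eq hq M M (1 - u * Z) w hw ⟨u, by ring⟩
  have h2 : Z ^ M ∣ ∏ i ∈ Finset.range (M + 1), (1 - (1 - u * Z) * (1 - Z) ^ i) := by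
    rw [Finset.prod_range_succ]
    refine Dvd.dvd.mul_right ?_ _
    rw [← Finset.card_range M, ← Finset.prod_const, Finset.card_range]
    refine Finset.prod_dvd_prod_of_dvd _ _ fun i _ => ?_
    have h : Z ∣ 1 - (1 - Z) ^ i := by
      simpa using sub_dvd_pow_sub_pow 1 (1 - Z) i
    have := dvd_add h (Dvd.intro_left (u * (1 - Z) ^ i) rfl : Z ∣ u * (1 - Z) ^ i * Z)
    exact this.trans (dvd_of_eq (by ring))
  have h3 : Z ^ M ∣ Z ^ (2 * M) := pow_dvd_pow _ (by omega)
  rw [zeroth_moment_eq hq hw hx hx0 hy M]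
  have := dvd_add (dvd_add h1 (h2.mul_right (doubleSum q (q ^ M * w) M)))
    ((h3.mul_left ((q * w) ^ M)).mul_right (momentFunctional x (orbitProd q u M)))
  exact this.trans (dvd_of_eq (by ring))

end FunctionalEquation

section PowerSeriesIdentity

open PowerSeries

variable {R : Type*} [CommRing R]

/-- The generating series of `countTwo u j p r`, without constant term. -/
noncomputable def seriesTwo (u : R) (p r : ℕ) : R⟦X⟧ :=
  mk fun j => if j = 0 then 0 else countTwo u j p r

/-- The generating series of `countOne u j r`, without constant term. -/
noncomputable def seriesOne (u : R) (r : ℕ) : R⟦X⟧ :=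
  mk fun j => if j = 0 then 0 else countOne u j r

lemma seriesTwo_succ (u : R) (p r : ℕ) : seriesTwo u (p + 1) r =
    seriesTwo u p (r + 1) + X * seriesTwo u (p + 1) r + seriesTwo u p r := by
  ext j
  rcases j with _ | _ | k
  · simp [seriesTwo]
  · simp [seriesTwo, coeff_succ_X_mul, countTwo_one]
  · simp [seriesTwo, coeff_succ_X_mul, countTwo_succ]

lemma seriesTwo_zero (u : R) (r : ℕ) : seriesTwo u 0 r =
    X * (C u * seriesOne u r + seriesTwo u 0 r + seriesOne u (r + 1)) +
      if r = 0 then C u * X else 0 := by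
  ext j
  rcases j with _ | _ | k
  · simp [seriesTwo, seriesOne, apply_ite]
  · split_ifs with hr <;> simp [seriesTwo, seriesOne, coeff_succ_X_mul, countTwo_one, hr]
  · split_ifs with hr <;>
      simp [seriesTwo, seriesOne, coeff_succ_X_mul, countTwo_zero]

lemma seriesOne_eq (u : R) (r : ℕ) : seriesOne u r =
    X * (C u * seriesOne u r + seriesTwo u (r + 1) 0) + if r = 0 then C u * X else 0 := by
  ext j
  rcases j with _ | _ | k
  · simp [seriesTwo, seriesOne, apply_ite]
  · split_ifs with hr <;> simp [seriesTwo, seriesOne, coeff_succ_X_mul, countOne_one, hr]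
  · split_ifs with hr <;>
      simp [seriesTwo, seriesOne, coeff_succ_X_mul, countOne_succ]

lemma boundedCount_staircase (u : R) {n : ℕ} (hn : 1 ≤ n) : boundedCount (staircase u n) ∅ =
    coeff n (∑ k ∈ Finset.range (n + 1),
      ∏ i ∈ Finset.range (k + 1), (1 - (1 - C u * X) * (1 - X) ^ i) : R⟦X⟧) := by
  obtain ⟨q, hq⟩ := (isUnit_iff_constantCoeff (φ := (1 - X : R⟦X⟧))).2 (by simp) |>.exists_right_inv
  obtain ⟨w, hw⟩ := (isUnit_iff_constantCoeff (φ := (1 - C u * X : R⟦X⟧))).2 (by simp)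
    |>.exists_right_inv
  have h := dvd_zeroth_moment_sub hq hw (seriesTwo_succ u) (seriesTwo_zero u) (seriesOne_eq u)
    (n + 1)
  have h0 := X_pow_dvd_iff.1 h n n.lt_succ_self
  rw [map_sub, sub_eq_zero] at h0
  rw [← h0]
  simp [seriesTwo, show n ≠ 0 by omega, countTwo]

end PowerSeriesIdentity

/-- The columns in the list, whose indices start with `i` (0-based), are valid. -/
def ValidFrom : ℕ → List (Finset ℕ) → Prop
  | _, [] => True
  | i, A :: L => (A ≠ ∅ ∧ A ⊆ Finset.range (i + 1)) ∧ ValidFrom (i + 1) L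

/-- The number of dots. -/
def dots (L : List (Finset ℕ)) : ℕ := (L.map Finset.card).sum

/-- The number of dots on the diagonal, where the indices of the columns start with `i`. -/
def diagDots : ℕ → List (Finset ℕ) → ℕ
  | _, [] => 0
  | i, A :: L => (if i ∈ A then 1 else 0) + diagDots (i + 1) L

lemma dots_cons (A : Finset ℕ) (L : List (Finset ℕ)) : dots (A :: L) = A.card + dots L := by
  simp [dots]

lemma validFrom_append (i : ℕ) (L L' : List (Finset ℕ)) :
    ValidFrom i (L ++ L') ↔ ValidFrom i L ∧ ValidFrom (i + L.length) L' := by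
  induction L generalizing i with
  | nil => simp [ValidFrom]
  | cons A L ih =>
    simp only [List.cons_append, ValidFrom, ih, List.length_cons, and_assoc]
    rw [show i + 1 + L.length = i + (L.length + 1) by omega]

lemma diagDots_append (i : ℕ) (L L' : List (Finset ℕ)) :
    diagDots i (L ++ L') = diagDots i L + diagDots (i + L.length) L' := by
  induction L generalizing i with
  | nil => simp [diagDots]
  | cons A L ih =>
    simp only [List.cons_append, diagDots, ih, List.length_cons, add_assoc]
    rw [show i + (1 + L.length) = i + (L.length + 1) by omega]

lemma ValidFrom.length_le_dots {i : ℕ} {L : List (Finset ℕ)} (h : ValidFrom i L) :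
    L.length ≤ dots L := by
  induction L generalizing i with
  | nil => simp
  | cons A L ih =>
    have h1 := ih h.2
    have h2 := Finset.card_pos.2 (Finset.nonempty_iff_ne_empty.2 h.1.1)
    rw [dots_cons, List.length_cons]
    omega

/-- All lists of `k` columns, the first one being the column of index `i`. -/
def columnLists : ℕ → ℕ → Finset (List (Finset ℕ))
  | _, 0 => {[]}
  | i, k + 1 => ((Finset.range (i + 1)).powerset.erase ∅ ×ˢ columnLists (i + 1) k).image
      fun p => p.1 :: p.2

lemma mem_columnLists {i k : ℕ} {L : List (Finset ℕ)} :
    L ∈ columnLists i k ↔ L.length = k ∧ ValidFrom i L := by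
  induction k generalizing i L with
  | zero =>
    simp only [columnLists, Finset.mem_singleton, List.length_eq_zero_iff]
    exact ⟨fun h => ⟨h, h ▸ trivial⟩, And.left⟩
  | succ k ih =>
    rcases L with _ | ⟨A, L⟩
    · simp [columnLists]
    · simp [columnLists, ih, ValidFrom]
      tauto

section Weight

variable {K : Type*} [CommRing K]

/-- The signed weight of a list of columns: `Z` for each dot off the diagonal and `a` for each
dot on the diagonal. -/
def signedWeight (a Z : K) : ℕ → List (Finset ℕ) → K
  | _, [] => 1
  | i, A :: L => -(∏ x ∈ A, -(if x = i then a else Z)) * signedWeight a Z (i + 1) L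

lemma sum_signedWeight (a Z : K) (i k : ℕ) : ∑ L ∈ columnLists i k, signedWeight a Z i L =
    ∏ j ∈ Finset.range k, (1 - (1 - a) * (1 - Z) ^ (i + j)) := by
  induction k generalizing i with
  | zero => simp [columnLists, signedWeight]
  | succ k ih =>
    rw [columnLists, Finset.sum_image (by
      rintro ⟨A, L⟩ _ ⟨A', L'⟩ _ h
      simpa using h), Finset.sum_product]
    simp only [signedWeight, ← Finset.mul_sum, ih, ← Finset.sum_mul]
    rw [Finset.prod_range_succ', mul_comm]
    congr 1
    · exact Finset.prod_congr rfl fun j _ => by rw [show i + 1 + j = i + (j + 1) by omega]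
    · have h := Finset.prod_one_add (Finset.range (i + 1))
        (f := fun x => -(if x = i then a else Z))
      rw [← Finset.add_sum_erase _ _ (Finset.empty_mem_powerset _), Finset.prod_range_succ,
        Finset.prod_congr rfl (g := fun _ => 1 - Z)] at h
      · simp only [if_true, Finset.prod_const, Finset.card_range, Finset.prod_empty] at h
        rw [Finset.sum_neg_distrib, add_zero]
        linear_combination h
      · intro x hx
        rw [if_neg (Finset.mem_range.1 hx).ne]
        ring

lemma signedWeight_eq (u Z : K) (i : ℕ) (L : List (Finset ℕ)) : signedWeight (u * Z) Z i L =
    (-1) ^ (dots L + L.length) * u ^ diagDots i L * Z ^ dots L := by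
  induction L generalizing i with
  | nil => simp [signedWeight, dots, diagDots]
  | cons A L ih =>
    have h : ∏ x ∈ A, -(if x = i then u * Z else Z) =
        (-1) ^ A.card * Z ^ A.card * u ^ (if i ∈ A then 1 else 0) := by
      have : ∀ x ∈ A, -(if x = i then u * Z else Z) = (-1 * Z) * if x = i then u else 1 := by
        intro x _
        split_ifs <;> ring
      rw [Finset.prod_congr rfl this, Finset.prod_mul_distrib, Finset.prod_const, mul_pow,
        Finset.prod_ite_eq' A i]
      split_ifs <;> simp
    rw [signedWeight, ih, h, dots_cons, diagDots, List.length_cons]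
    ring

end Weight

/-- The Fishburn diagrams with `n` dots and at least one column, as lists of columns. -/
def diagrams (n : ℕ) : Finset (List (Finset ℕ)) :=
  ((Finset.range (n + 1)).biUnion fun k => columnLists 0 (k + 1)).filter fun L => dots L = n

lemma mem_diagrams {n : ℕ} (hn : 1 ≤ n) {L : List (Finset ℕ)} :
    L ∈ diagrams n ↔ ValidFrom 0 L ∧ dots L = n := by
  simp only [diagrams, Finset.mem_filter, Finset.mem_biUnion, Finset.mem_range, mem_columnLists]
  constructor
  · rintro ⟨⟨k, _, _, h⟩, h'⟩
    exact ⟨h, h'⟩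
  · rintro ⟨h, h'⟩
    have := h.length_le_dots
    rcases L with _ | ⟨A, L⟩
    · simp [dots] at h'
      omega
    · simp only [List.length_cons] at this
      exact ⟨⟨L.length, by omega, by simp, h⟩, h'⟩

open PowerSeries in
lemma sum_diagrams {R : Type*} [CommRing R] (u : R) (n : ℕ) :
    ∑ L ∈ diagrams n, (-1) ^ (n + L.length) * u ^ diagDots 0 L =
      coeff n (∑ k ∈ Finset.range (n + 1),
        ∏ i ∈ Finset.range (k + 1), (1 - (1 - C u * X) * (1 - X) ^ i) : R⟦X⟧) := by
  have h : ∀ k, ∏ i ∈ Finset.range (k + 1), (1 - (1 - C u * X) * (1 - X) ^ i : R⟦X⟧) =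
      ∑ L ∈ columnLists 0 (k + 1), signedWeight (C u * X) X 0 L := by
    intro k
    rw [sum_signedWeight]
    simp
  simp only [h, signedWeight_eq]
  rw [diagrams, Finset.sum_filter, Finset.sum_biUnion, map_sum]
  · refine Finset.sum_congr rfl fun k _ => ?_
    rw [map_sum]
    refine Finset.sum_congr rfl fun L _ => ?_
    have : ((-1) ^ (dots L + L.length) * C u ^ diagDots 0 L * X ^ dots L : R⟦X⟧) =
        C ((-1) ^ (dots L + L.length) * u ^ diagDots 0 L) * X ^ dots L := by simp
    rw [this, coeff_C_mul, coeff_X_pow]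
    by_cases hd : n = dots L
    · simp [hd]
    · simp [hd, Ne.symm hd]
  · intro k _ k' _ hk
    refine Finset.disjoint_left.2 fun L h1 h2 => hk ?_
    have h1 := (mem_columnLists.1 h1).1
    have h2 := (mem_columnLists.1 h2).1
    omega

/-- All columns are singletons, and no `{j + 1}` stands to the left of `{j}`. -/
def IsDescentFree (L : List (Finset ℕ)) : Prop :=
  (∀ A ∈ L, A.card = 1) ∧ L.Pairwise fun A B => ¬ ∃ j, A = {j + 1} ∧ B = {j}

/-- The lists in `IsDescentFree` of length `n` without the columns `{x}`, `x ∈ B`. -/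
def descentFree : ℕ → Finset ℕ → Finset (List (Finset ℕ))
  | 0, _ => {[]}
  | n + 1, B => (((Finset.range (n + 1)).filter fun x => x ∉ B).sigma
      fun x => descentFree n (insert (x + 1) B)).image fun p => p.2 ++ [{p.1}]

lemma mem_descentFree {n : ℕ} {B : Finset ℕ} {L : List (Finset ℕ)} : L ∈ descentFree n B ↔
    (L.length = n ∧ ValidFrom 0 L ∧ IsDescentFree L) ∧ ∀ x ∈ B, {x} ∉ L := by
  induction n generalizing B L with
  | zero =>
    simp only [descentFree, Finset.mem_singleton]
    constructor
    · rintro rfl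
      simp [ValidFrom, IsDescentFree]
    · rintro ⟨⟨h, _⟩, _⟩
      exact List.length_eq_zero_iff.1 h
  | succ n ih =>
    simp only [descentFree, Finset.mem_image, Finset.mem_sigma, Finset.mem_filter,
      Finset.mem_range, Sigma.exists, ih]
    constructor
    · rintro ⟨x, L, ⟨⟨hx, hxB⟩, ⟨hl, hv, hc, hp⟩, hB⟩, rfl⟩
      have hB' := hB (x + 1) (Finset.mem_insert_self _ _)
      refine ⟨⟨by simp [hl], ?_, ?_, ?_⟩, ?_⟩
      · simp [validFrom_append, hv, ValidFrom, hl]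
        omega
      · simpa [or_imp, forall_and] using hc
      · rw [List.pairwise_append]
        refine ⟨hp, by simp, ?_⟩
        rintro A hA _ hA' ⟨j, rfl, rfl⟩
        simp only [List.mem_singleton, Finset.singleton_inj] at hA'
        exact hB' (hA' ▸ hA)
      · intro y hy
        have : y ≠ x := fun h => hxB (h ▸ hy)
        simpa [this] using hB y (Finset.mem_insert_of_mem hy)
    · rintro ⟨⟨hl, hv, hc, hp⟩, hB⟩
      rcases List.eq_nil_or_concat L with rfl | ⟨L, A, rfl⟩
      · simp at hl
      obtain ⟨x, rfl⟩ := Finset.card_eq_one.1 (hc A (by simp))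
      simp only [List.concat_eq_append, List.length_append, List.length_singleton,
        Nat.add_right_cancel_iff] at hl
      simp only [List.concat_eq_append, validFrom_append, ValidFrom, hl, zero_add,
        Finset.singleton_subset_iff, Finset.mem_range] at hv
      rw [List.concat_eq_append, List.pairwise_append] at hp
      refine ⟨x, L, ⟨⟨hv.2.1.2, fun h => hB x h (by simp)⟩, ⟨hl, hv.1,
        fun A hA => hc A (by simp [hA]), hp.1⟩, ?_⟩, by simp⟩
      intro y hy hyL
      rcases Finset.mem_insert.1 hy with rfl | hy
      · exact hp.2.2 _ hyL {x} (by simp) ⟨x, rfl, rfl⟩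
      · exact hB y hy (by simp [hyL])

lemma sum_descentFree {R : Type*} [CommRing R] (u : R) (n : ℕ) (B : Finset ℕ) :
    ∑ L ∈ descentFree n B, u ^ diagDots 0 L = boundedCount (staircase u n) B := by
  induction n generalizing B with
  | zero => simp [descentFree, staircase, boundedCount, diagDots]
  | succ n ih =>
    rw [descentFree, Finset.sum_image (by
      rintro ⟨x, L⟩ _ ⟨x', L'⟩ _ h
      simp only at h
      obtain ⟨rfl, h⟩ := List.append_inj' h rfl
      simp at h
      rw [h]), Finset.sum_sigma, Finset.sum_filter]
    simp only [staircase, boundedCount]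
    refine Finset.sum_congr rfl fun x hx => ?_
    by_cases hxB : x ∈ B
    · simp [hxB]
    rw [if_pos hxB, if_neg hxB, ← ih, Finset.mul_sum]
    refine Finset.sum_congr rfl fun L hL => ?_
    have hl := (mem_descentFree.1 hL).1.1
    simp only [diagDots_append, hl, zero_add, diagDots, Finset.mem_singleton, add_zero]
    by_cases hxn : x = n
    · simp [hxn, pow_succ, mul_comm]
    · simp [hxn, Ne.symm hxn]

/-- Inserts an empty row `i + 1`. -/
def raiseRows (i : ℕ) (C : Finset ℕ) : Finset ℕ := C.image fun x => if x ≤ i then x else x + 1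

/-- Removes the row `i + 1` if it is empty. -/
def lowerRows (i : ℕ) (C : Finset ℕ) : Finset ℕ := C.image fun x => if x ≤ i then x else x - 1

lemma lowerRows_raiseRows (i : ℕ) (C : Finset ℕ) : lowerRows i (raiseRows i C) = C := by
  rw [lowerRows, raiseRows, Finset.image_image]
  conv_rhs => rw [← Finset.image_id (s := C)]
  refine Finset.image_congr fun x _ => ?_
  simp only [Function.comp, id]
  split_ifs <;> omega

lemma raiseRows_lowerRows {i : ℕ} {C : Finset ℕ} (h : i + 1 ∉ C) :
    raiseRows i (lowerRows i C) = C := by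
  rw [lowerRows, raiseRows, Finset.image_image]
  conv_rhs => rw [← Finset.image_id (s := C)]
  refine Finset.image_congr fun x hx => ?_
  have : x ≠ i + 1 := fun h' => h (h' ▸ hx)
  simp only [Function.comp, id]
  split_ifs <;> omega

lemma mem_raiseRows {i x : ℕ} {C : Finset ℕ} :
    x ∈ raiseRows i C ↔ x ≤ i ∧ x ∈ C ∨ i + 2 ≤ x ∧ x - 1 ∈ C := by
  simp only [raiseRows, Finset.mem_image]
  constructor
  · rintro ⟨y, hy, rfl⟩
    split_ifs with h
    · exact Or.inl ⟨h, hy⟩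
    · exact Or.inr ⟨by omega, by simpa using hy⟩
  · rintro (⟨h, hx⟩ | ⟨h, hx⟩)
    · exact ⟨x, hx, if_pos h⟩
    · exact ⟨x - 1, hx, by rw [if_neg (by omega)]; omega⟩

lemma card_raiseRows (i : ℕ) (C : Finset ℕ) : (raiseRows i C).card = C.card := by
  refine Finset.card_image_of_injective _ fun x y h => ?_
  split_ifs at h <;> omega

lemma raiseRows_subset {i k : ℕ} (hk : i < k) (C : Finset ℕ) :
    raiseRows i C ⊆ Finset.range (k + 2) ↔ C ⊆ Finset.range (k + 1) := by
  simp only [Finset.subset_iff, Finset.mem_range, raiseRows, Finset.forall_mem_image]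
  refine forall₂_congr fun x _ => ?_
  split_ifs <;> omega

lemma validFrom_map_raiseRows {i k : ℕ} (hk : i < k) (L : List (Finset ℕ)) :
    ValidFrom (k + 1) (L.map (raiseRows i)) ↔ ValidFrom k L := by
  induction L generalizing k with
  | nil => simp [ValidFrom]
  | cons C L ih =>
    simp only [List.map_cons, ValidFrom, raiseRows_subset hk, ih (hk.trans k.lt_succ_self)]
    rw [ne_eq, ne_eq, ← Finset.card_eq_zero, card_raiseRows, Finset.card_eq_zero]

lemma diagDots_map_raiseRows {i k : ℕ} (hk : i < k) (L : List (Finset ℕ)) :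
    diagDots (k + 1) (L.map (raiseRows i)) = diagDots k L := by
  induction L generalizing k with
  | nil => simp [diagDots]
  | cons C L ih =>
    have : k + 1 ∈ raiseRows i C ↔ k ∈ C := by
      rw [mem_raiseRows]
      simp only [Nat.add_sub_cancel]
      constructor
      · rintro (⟨h, _⟩ | ⟨_, h⟩)
        · omega
        · exact h
      · exact fun h => Or.inr ⟨by omega, h⟩
    simp only [List.map_cons, diagDots, ih (hk.trans k.lt_succ_self), this]

lemma dots_map_raiseRows (i : ℕ) (L : List (Finset ℕ)) :
    dots (L.map (raiseRows i)) = dots L := by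
  simp [dots, Function.comp_def, card_raiseRows]

/-- The column `A` of index `i` can be merged with its right neighbour, the first column of `L`. -/
def CanMerge (i : ℕ) (A : Finset ℕ) (L : List (Finset ℕ)) : Prop :=
  L ≠ [] ∧ (L.headD ∅).sup id < A.sup id ∧ ∀ C ∈ L, i + 1 ∉ C

open Classical in
/-- Splits off the largest dot of the first column with more than one dot, or merges two columns
if this is possible further to the left. -/
noncomputable def splitMerge : ℕ → List (Finset ℕ) → List (Finset ℕ)
  | _, [] => []
  | i, A :: L =>
    if 2 ≤ A.card then {A.sup id} :: A.erase (A.sup id) :: L.map (raiseRows i)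
    else if CanMerge i A L then (A ∪ L.headD ∅) :: L.tail.map (lowerRows i)
    else A :: splitMerge (i + 1) L

/-- `M` arises from `L` when `splitMerge` splits a column. -/
inductive Splits : ℕ → List (Finset ℕ) → List (Finset ℕ) → Prop
  | head (i : ℕ) (A : Finset ℕ) (L : List (Finset ℕ)) (hA : 2 ≤ A.card) :
      Splits i (A :: L) ({A.sup id} :: A.erase (A.sup id) :: L.map (raiseRows i))
  | cons (i : ℕ) (A : Finset ℕ) (L M : List (Finset ℕ)) (hA : A.card = 1)
      (hL : ¬ CanMerge i A L) (h : Splits (i + 1) L M) : Splits i (A :: L) (A :: M)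

lemma sup_id_mem {A : Finset ℕ} (hA : A ≠ ∅) : A.sup id ∈ A := by
  obtain ⟨x, hx, h⟩ := Finset.exists_mem_eq_sup A (Finset.nonempty_iff_ne_empty.2 hA) id
  rw [h]
  exact hx

lemma ne_empty_of_two_le_card {A : Finset ℕ} (hA : 2 ≤ A.card) : A ≠ ∅ := by
  rintro rfl
  simp at hA

lemma erase_sup_id_ne_empty {A : Finset ℕ} (hA : 2 ≤ A.card) : A.erase (A.sup id) ≠ ∅ := by
  intro h
  have := Finset.card_erase_of_mem (sup_id_mem (ne_empty_of_two_le_card hA))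
  rw [h, Finset.card_empty] at this
  omega

namespace Splits

variable {i : ℕ} {L M : List (Finset ℕ)}

lemma validFrom_iff (h : Splits i L M) : ValidFrom i L ↔ ValidFrom i M := by
  induction h with
  | head i A L hA =>
    have hne := ne_empty_of_two_le_card hA
    have hmem := sup_id_mem hne
    have hne' := erase_sup_id_ne_empty hA
    simp only [ValidFrom, validFrom_map_raiseRows (Nat.lt_succ_self i), ← and_assoc]
    refine and_congr_left' ?_
    simp only [hne, hne', ne_eq, not_false_eq_true, true_and, and_true,
      Finset.singleton_ne_empty, Finset.singleton_subset_iff]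
    constructor
    · exact fun h => ⟨h hmem, (Finset.erase_subset _ _).trans (h.trans (by simp))⟩
    · rintro ⟨h, -⟩ x hx
      exact Finset.mem_range.2 ((Finset.le_sup (f := id) hx).trans_lt (Finset.mem_range.1 h))
  | cons i A L M hA hL h ih => simp only [ValidFrom, ih]

lemma dots_eq (h : Splits i L M) : dots L = dots M := by
  induction h with
  | head i A L hA =>
    have hmem := sup_id_mem (ne_empty_of_two_le_card hA)
    simp only [dots_cons, dots_map_raiseRows, Finset.card_singleton,
      Finset.card_erase_of_mem hmem]
    omega
  | cons i A L M hA hL h ih => simp only [dots_cons, ih]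

lemma length_eq (h : Splits i L M) : M.length = L.length + 1 := by
  induction h with
  | head i A L hA => simp
  | cons i A L M hA hL h ih => simp [ih]

lemma diagDots_eq (h : Splits i L M) (hL : ValidFrom i L) : diagDots i L = diagDots i M := by
  induction h with
  | head i A L hA =>
    have hmem := sup_id_mem (ne_empty_of_two_le_card hA)
    simp only [diagDots, diagDots_map_raiseRows (Nat.lt_succ_self i)]
    have h1 : i + 1 ∉ A := fun h => by simpa using hL.1.2 h
    have h2 : i ∈ A ↔ i ∈ ({A.sup id} : Finset ℕ) := by
      rw [Finset.mem_singleton]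
      refine ⟨fun h => le_antisymm (Finset.le_sup (f := id) h) ?_, fun h => h ▸ hmem⟩
      exact Nat.lt_succ_iff.1 (Finset.mem_range.1 (hL.1.2 hmem))
    have h3 : i + 1 ∉ A.erase (A.sup id) := fun h => h1 (Finset.mem_of_mem_erase h)
    simp only [h2, h3, if_false, zero_add]
  | cons i A L M hA hL' h ih => simp only [diagDots, ih hL.2]

lemma sup_headD_eq (h : Splits i L M) : (L.headD ∅).sup id = (M.headD ∅).sup id := by
  cases h <;> simp

lemma row_iff (h : Splits i L M) {r : ℕ} (hr : r ≤ i) : (∀ C ∈ L, r ∉ C) ↔ ∀ C ∈ M, r ∉ C := by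
  induction h with
  | head i A L hA =>
    have hmem := sup_id_mem (ne_empty_of_two_le_card hA)
    have h1 : r ∉ A ↔ r ∉ ({A.sup id} : Finset ℕ) ∧ r ∉ A.erase (A.sup id) := by
      rw [← not_or, ← Finset.mem_union, ← Finset.insert_eq, Finset.insert_erase hmem]
    have h2 : ∀ C, r ∈ raiseRows i C ↔ r ∈ C := by
      intro C
      rw [mem_raiseRows]
      constructor
      · rintro (h | h)
        · exact h.2
        · omega
      · exact fun h => Or.inl ⟨hr, h⟩
    simp only [List.forall_mem_cons, List.forall_mem_map, h1, h2, and_assoc]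
  | cons i A L M hA hL h ih => simp only [List.forall_mem_cons, ih (hr.trans i.le_succ)]

lemma canMerge_iff (h : Splits (i + 1) L M) (A : Finset ℕ) :
    CanMerge i A L ↔ CanMerge i A M := by
  have h1 : L ≠ [] := by cases h <;> simp
  have h2 : M ≠ [] := by cases h <;> simp
  rw [CanMerge, CanMerge, h.sup_headD_eq, h.row_iff le_rfl]
  simp only [ne_eq, h1, h2]

lemma splitMerge_eq (h : Splits i L M) : splitMerge i L = M := by
  induction h with
  | head i A L hA => rw [splitMerge, if_pos hA]
  | cons i A L M hA hL h ih => rw [splitMerge, if_neg (by omega), if_neg hL, ih]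

lemma splitMerge_eq' (h : Splits i L M) (hL : ValidFrom i L) : splitMerge i M = L := by
  induction h with
  | head i A L hA =>
    have hmem := sup_id_mem (ne_empty_of_two_le_card hA)
    have hle : A.sup id ≤ i := Nat.lt_succ_iff.1 (Finset.mem_range.1 (hL.1.2 hmem))
    have h1 : i + 1 ∉ A := fun h => by simpa using hL.1.2 h
    have hne := erase_sup_id_ne_empty hA
    rw [splitMerge, if_neg (by simp), if_pos]
    · simp only [List.headD_cons, List.tail_cons, List.map_map]
      rw [← Finset.insert_eq, Finset.insert_erase hmem]
      congr 1
      conv_rhs => rw [← List.map_id L]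
      exact List.map_congr_left fun C _ => lowerRows_raiseRows i C
    · refine ⟨by simp, ?_, ?_⟩
      · have h2 := sup_id_mem hne
        simp only [List.headD_cons, Finset.sup_singleton, id]
        exact lt_of_le_of_ne (Finset.le_sup (f := id) (Finset.mem_of_mem_erase h2))
          (Finset.ne_of_mem_erase h2)
      · simp only [List.forall_mem_cons, List.forall_mem_map]
        refine ⟨fun h => h1 (Finset.mem_of_mem_erase h), fun C _ h => ?_⟩
        rw [mem_raiseRows] at h
        omega
  | cons i A L M hA hL' h ih =>
    rw [splitMerge, if_neg (by omega), if_neg (by rwa [← h.canMerge_iff]), ih hL.2]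

end Splits

lemma splits_splitMerge {i : ℕ} {L : List (Finset ℕ)} (hL : ValidFrom i L) :
    Splits i L (splitMerge i L) ∨ Splits i (splitMerge i L) L ∨
      (splitMerge i L = L ∧ ∀ A ∈ L, A.card = 1) := by
  induction L generalizing i with
  | nil => simp [splitMerge]
  | cons A L ih =>
    by_cases hA : 2 ≤ A.card
    · left
      rw [splitMerge, if_pos hA]
      exact Splits.head i A L hA
    have hA1 : A.card = 1 := by
      have := Finset.card_pos.2 (Finset.nonempty_iff_ne_empty.2 hL.1.1)
      omega
    by_cases hM : CanMerge i A L
    · right; left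
      rw [splitMerge, if_neg hA, if_pos hM]
      obtain ⟨m, rfl⟩ := Finset.card_eq_one.1 hA1
      rcases L with _ | ⟨B, L⟩
      · exact absurd rfl hM.1
      have hlt : ∀ b ∈ B, b < m := fun b hb => by
        simpa using (Finset.le_sup (f := id) hb).trans_lt hM.2.1
      have hmB : m ∉ B := fun h => (hlt m h).false
      have hsup : (insert m B).sup id = m := by
        rw [Finset.sup_insert]
        exact sup_eq_left.2 (Finset.sup_le fun b hb => (hlt b hb).le)
      have hmap : (L.map (lowerRows i)).map (raiseRows i) = L := by
        conv_rhs => rw [← List.map_id L]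
        rw [List.map_map]
        exact List.map_congr_left fun C hC =>
          raiseRows_lowerRows (hM.2.2 C (List.mem_cons_of_mem _ hC))
      have hB := Finset.card_pos.2 (Finset.nonempty_iff_ne_empty.2 hL.2.1.1)
      have := Splits.head i (insert m B) (L.map (lowerRows i))
        (by rw [Finset.card_insert_of_notMem hmB]; omega)
      rw [hsup, hmap, Finset.erase_insert hmB] at this
      exact this
    · rw [splitMerge, if_neg hA, if_neg hM]
      rcases ih hL.2 with h | h | ⟨h, h'⟩
      · exact Or.inl (Splits.cons i A _ _ hA1 hM h)
      · exact Or.inr (Or.inl (Splits.cons i A _ _ hA1 (by rwa [h.canMerge_iff]) h))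
      · exact Or.inr (Or.inr ⟨by rw [h], by simpa [hA1] using h'⟩)

lemma exists_perm_of_fiber_equiv {α β : Type*} [Finite α] (key : α → β) (p q : α → Prop)
    (h : ∀ b, Nonempty ({a // key a = b ∧ p a} ≃ {a // key a = b ∧ q a})) :
    ∃ σ : Equiv.Perm α, (∀ a, key (σ a) = key a) ∧ ∀ a, q (σ a) ↔ p a := by
  classical
  have hfib : ∀ b, ∃ τ : Equiv.Perm {a // key a = b}, ∀ a, q (τ a) ↔ p a := by
    intro b
    obtain ⟨e⟩ := h b
    let e' : {a : {a // key a = b} // p a} ≃ {a : {a // key a = b} // q a} :=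
      ((Equiv.subtypeSubtypeEquivSubtypeInter _ p).trans e).trans
        (Equiv.subtypeSubtypeEquivSubtypeInter _ q).symm
    refine ⟨e'.extendSubtype, fun a => ⟨fun hq => ?_, fun hp => e'.extendSubtype_mem a hp⟩⟩
    by_contra hp
    exact e'.extendSubtype_not_mem a hp hq
  choose τ hτ using hfib
  refine ⟨Equiv.ofFiberEquiv τ, fun a => Equiv.ofFiberEquiv_map τ a, fun a => ?_⟩
  exact hτ (key a) ⟨a, rfl⟩

section Diagrams

variable {n : ℕ} {L : List (Finset ℕ)}

lemma splitMerge_mem_diagrams (hn : 1 ≤ n) (hL : L ∈ diagrams n) :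
    splitMerge 0 L ∈ diagrams n := by
  have hL' := (mem_diagrams hn).1 hL
  rcases splits_splitMerge hL'.1 with h | h | h
  · exact (mem_diagrams hn).2 ⟨h.validFrom_iff.1 hL'.1, h.dots_eq.symm.trans hL'.2⟩
  · exact (mem_diagrams hn).2 ⟨h.validFrom_iff.2 hL'.1, h.dots_eq.trans hL'.2⟩
  · rwa [h.1]

lemma splitMerge_splitMerge (hn : 1 ≤ n) (hL : L ∈ diagrams n) :
    splitMerge 0 (splitMerge 0 L) = L := by
  have hL' := (mem_diagrams hn).1 hL
  rcases splits_splitMerge hL'.1 with h | h | h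
  · exact h.splitMerge_eq' hL'.1
  · exact h.splitMerge_eq
  · rw [h.1, h.1]

lemma diagDots_splitMerge (hn : 1 ≤ n) (hL : L ∈ diagrams n) :
    diagDots 0 (splitMerge 0 L) = diagDots 0 L := by
  have hL' := ((mem_diagrams hn).1 hL).1
  rcases splits_splitMerge hL' with h | h | h
  · exact (h.diagDots_eq hL').symm
  · exact h.diagDots_eq (h.validFrom_iff.2 hL')
  · rw [h.1]

lemma length_splitMerge (hn : 1 ≤ n) (hL : L ∈ diagrams n) (hne : splitMerge 0 L ≠ L) :
    (splitMerge 0 L).length = L.length + 1 ∨ (splitMerge 0 L).length + 1 = L.length := by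
  rcases splits_splitMerge ((mem_diagrams hn).1 hL).1 with h | h | h
  · exact Or.inl h.length_eq
  · exact Or.inr h.length_eq.symm
  · exact absurd h.1 hne

lemma dots_eq_length (hL : ∀ A ∈ L, A.card = 1) : dots L = L.length := by
  rw [dots, List.map_congr_left hL]
  simp

lemma length_of_splitMerge_eq (hn : 1 ≤ n) (hL : L ∈ diagrams n) (hfix : splitMerge 0 L = L) :
    L.length = n := by
  have hL' := (mem_diagrams hn).1 hL
  rcases splits_splitMerge hL'.1 with h | h | h
  · have := h.length_eq
    rw [hfix] at this
    omega
  · have := h.length_eq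
    rw [hfix] at this
    omega
  · rw [← dots_eq_length h.2, hL'.2]

lemma mem_descentFree_empty (hn : 1 ≤ n) :
    L ∈ descentFree n ∅ ↔ L ∈ diagrams n ∧ IsDescentFree L := by
  rw [mem_descentFree, mem_diagrams hn]
  constructor
  · rintro ⟨⟨hl, hv, hd⟩, -⟩
    exact ⟨⟨hv, (dots_eq_length hd.1).trans hl⟩, hd⟩
  · rintro ⟨⟨hv, hdots⟩, hd⟩
    exact ⟨⟨(dots_eq_length hd.1).symm.trans hdots, hv, hd⟩, by simp⟩

end Diagrams

open Classical in
lemma sum_fixed_splitMerge {R : Type*} [CommRing R] (u : R) {n : ℕ} (hn : 1 ≤ n) :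
    ∑ L ∈ diagrams n with splitMerge 0 L = L, u ^ diagDots 0 L =
      ∑ L ∈ descentFree n ∅, u ^ diagDots 0 L := by
  rw [sum_descentFree, boundedCount_staircase u hn, ← sum_diagrams,
    ← Finset.sum_filter_add_sum_filter_not (diagrams n) fun L => splitMerge 0 L = L]
  have hzero : ∑ L ∈ diagrams n with ¬ splitMerge 0 L = L,
      (-1) ^ (n + L.length) * u ^ diagDots 0 L = 0 := by
    refine Finset.sum_involution (fun L _ => splitMerge 0 L) ?_ ?_ ?_ ?_
    · intro L hL
      obtain ⟨hL, hne⟩ := Finset.mem_filter.1 hL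
      rw [diagDots_splitMerge hn hL]
      rcases length_splitMerge hn hL hne with h | h
      · rw [h]
        ring
      · rw [← h]
        ring
    · exact fun L hL _ => (Finset.mem_filter.1 hL).2
    · intro L hL
      obtain ⟨hL, hne⟩ := Finset.mem_filter.1 hL
      refine Finset.mem_filter.2 ⟨splitMerge_mem_diagrams hn hL, ?_⟩
      rw [splitMerge_splitMerge hn hL]
      exact Ne.symm hne
    · exact fun L hL => splitMerge_splitMerge hn (Finset.mem_filter.1 hL).1
  rw [hzero, add_zero]
  refine Finset.sum_congr rfl fun L hL => ?_
  obtain ⟨hL, hfix⟩ := Finset.mem_filter.1 hL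
  rw [length_of_splitMerge_eq hn hL hfix, ← two_mul, pow_mul]
  simp

open Classical in
lemma card_fixed_splitMerge {n : ℕ} (hn : 1 ≤ n) (d : ℕ) :
    {L ∈ diagrams n | splitMerge 0 L = L ∧ diagDots 0 L = d}.card =
      {L ∈ diagrams n | IsDescentFree L ∧ diagDots 0 L = d}.card := by
  have hfree : {L ∈ diagrams n | IsDescentFree L} = descentFree n ∅ := by
    ext L
    rw [Finset.mem_filter, mem_descentFree_empty hn]
  have h := congrArg (Polynomial.coeff · d) (sum_fixed_splitMerge (Polynomial.X : Polynomial ℤ) hn)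
  simp only [Polynomial.finsetSum_coeff, Polynomial.coeff_X_pow, Finset.sum_boole,
    Nat.cast_inj] at h
  simp only [← Finset.filter_filter, hfree, eq_comm (b := d)]
  exact h

lemma exists_list_involution {n : ℕ} (hn : 1 ≤ n) :
    ∃ φ : List (Finset ℕ) → List (Finset ℕ), ∀ L ∈ diagrams n, φ L ∈ diagrams n ∧ φ (φ L) = L ∧
      (φ L = L ↔ IsDescentFree L) ∧
      (φ L ≠ L → (φ L).length = L.length + 1 ∨ (φ L).length + 1 = L.length) ∧
      diagDots 0 (φ L) = diagDots 0 L := by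
  classical
  obtain ⟨σ, hkey, hσ⟩ := exists_perm_of_fiber_equiv
    (fun L : {L // L ∈ diagrams n} => (L.1.length, diagDots 0 L.1))
    (fun L => splitMerge 0 L.1 = L.1) (fun L => IsDescentFree L.1) (by
      rintro ⟨k, d⟩
      have hcard : {L ∈ diagrams n | (L.length, diagDots 0 L) = (k, d) ∧ splitMerge 0 L = L}.card =
          {L ∈ diagrams n | (L.length, diagDots 0 L) = (k, d) ∧ IsDescentFree L}.card := by
        by_cases hk : k = n
        · subst hk
          convert card_fixed_splitMerge hn d using 2
          · refine Finset.filter_congr fun L hL => ?_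
            simp only [Prod.mk.injEq]
            exact ⟨fun h => ⟨h.2, h.1.2⟩, fun h => ⟨⟨length_of_splitMerge_eq hn hL h.1, h.2⟩, h.1⟩⟩
          · refine Finset.filter_congr fun L hL => ?_
            simp only [Prod.mk.injEq]
            exact ⟨fun h => ⟨h.2, h.1.2⟩, fun h => ⟨⟨(dots_eq_length h.1.1).symm.trans
              ((mem_diagrams hn).1 hL).2, h.2⟩, h.1⟩⟩
        · rw [Finset.filter_false_of_mem, Finset.filter_false_of_mem]
          · rintro L hL ⟨h, hd⟩
            rw [Prod.mk.injEq, ← dots_eq_length hd.1, ((mem_diagrams hn).1 hL).2] at h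
            exact hk h.1.symm
          · rintro L hL ⟨h, hfix⟩
            rw [Prod.mk.injEq, length_of_splitMerge_eq hn hL hfix] at h
            exact hk h.1.symm
      have hequiv : ∀ P : List (Finset ℕ) → Prop,
          Nonempty ({L : {L // L ∈ diagrams n} // P L.1} ≃ {L ∈ diagrams n | P L}) := fun P =>
        ⟨(Equiv.subtypeSubtypeEquivSubtypeInter (· ∈ diagrams n) P).trans
          (Equiv.subtypeEquivRight fun L => Finset.mem_filter.symm)⟩
      obtain ⟨e⟩ := hequiv fun L => (L.length, diagDots 0 L) = (k, d) ∧ splitMerge 0 L = L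
      obtain ⟨e'⟩ := hequiv fun L => (L.length, diagDots 0 L) = (k, d) ∧ IsDescentFree L
      exact ⟨(e.trans (Finset.equivOfCardEq (by convert hcard))).trans e'.symm⟩)
  simp only [Prod.mk.injEq] at hkey
  let θ : {L // L ∈ diagrams n} → {L // L ∈ diagrams n} :=
    fun L => ⟨splitMerge 0 L.1, splitMerge_mem_diagrams hn L.2⟩
  have hθ : ∀ L, θ (θ L) = L := fun L => Subtype.ext (splitMerge_splitMerge hn L.2)
  have hsymm : ∀ L, L.1.length = (σ.symm L).1.length ∧ diagDots 0 L.1 = diagDots 0 (σ.symm L).1 :=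
    fun L => by simpa using hkey (σ.symm L)
  refine ⟨fun L => if h : L ∈ diagrams n then (σ (θ (σ.symm ⟨L, h⟩))).1 else L, fun L hL => ?_⟩
  obtain ⟨M, hM⟩ : ∃ M, σ.symm ⟨L, hL⟩ = M := ⟨_, rfl⟩
  have hLM : (⟨L, hL⟩ : {L // L ∈ diagrams n}) = σ M := by rw [← hM, Equiv.apply_symm_apply]
  have hfix : (σ (θ M)).1 = L ↔ splitMerge 0 M.1 = M.1 := by
    rw [show L = (σ M).1 from congrArg Subtype.val hLM, Subtype.val_inj, σ.injective.eq_iff,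
      Subtype.ext_iff]
  have hlen := hsymm ⟨L, hL⟩
  simp only [dif_pos hL, hM, dif_pos (σ (θ M)).2, Subtype.coe_eta, Equiv.symm_apply_apply,
    hθ, ne_eq, hfix] at hlen ⊢
  refine ⟨(σ (θ M)).2, congrArg Subtype.val hLM.symm, ?_, ?_, ?_⟩
  · rw [← hσ M, ← hLM]
  · intro hne
    rw [(hkey (θ M)).1, hlen.1]
    exact length_splitMerge hn M.2 hne
  · rw [(hkey (θ M)).2, hlen.2]
    exact diagDots_splitMerge hn M.2

lemma validFrom_ofFn {k : ℕ} (f : Fin k → Finset ℕ) (i : ℕ) : ValidFrom i (List.ofFn f) ↔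
    ∀ j : Fin k, f j ≠ ∅ ∧ f j ⊆ Finset.range (i + j + 1) := by
  induction k generalizing i with
  | zero => simp [ValidFrom]
  | succ k ih =>
    simp [List.ofFn_succ, ValidFrom, ih, Fin.forall_fin_succ, add_assoc, add_comm, add_left_comm]

lemma diagDots_ofFn {k : ℕ} (f : Fin k → Finset ℕ) (i : ℕ) : diagDots i (List.ofFn f) =
    (Finset.univ.filter fun j : Fin k => i + j ∈ f j).card := by
  rw [Finset.card_filter]
  induction k generalizing i with
  | zero => simp [diagDots]
  | succ k ih =>
    rw [List.ofFn_succ, diagDots, ih, Fin.sum_univ_succ]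
    simp only [Fin.val_zero, add_zero, Fin.val_succ, add_assoc, add_comm 1]

lemma mem_diagrams_ofFn {n : ℕ} (hn : 1 ≤ n) (A : FDiagram) :
    List.ofFn A.2 ∈ diagrams n ↔ memY n A := by
  simp only [mem_diagrams hn, validFrom_ofFn, memY, zero_add, dots, List.map_ofFn, List.sum_ofFn,
    Function.comp]

lemma isDescentFree_ofFn (A : FDiagram) : IsDescentFree (List.ofFn A.2) ↔
    (∀ i : Fin A.1, (A.2 i).card = 1) ∧
      ¬ ∃ p q : Fin A.1, ∃ j : ℕ, p < q ∧ A.2 p = {j + 1} ∧ A.2 q = {j} := by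
  rw [IsDescentFree, List.forall_mem_ofFn_iff, List.pairwise_ofFn]
  refine and_congr_right' ⟨?_, ?_⟩
  · rintro h ⟨p, q, j, hpq, hj⟩
    exact h hpq ⟨j, hj⟩
  · rintro h p q hpq ⟨j, hj⟩
    exact h ⟨p, q, j, hpq, hj⟩

/-- For every `n ≥ 1` there is an involution `ψ_n` on `Y_n` whose fixed points are
exactly the diagrams with all columns singletons and no `p < q` with `A_p = {j+1}`,
`A_q = {j}`; which changes the number of columns by exactly one on non-fixed points;
and which preserves the statistic `d`. -/
theorem exists_fishburn_involution (n : ℕ) (hn : 1 ≤ n) :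
    ∃ ψ : FDiagram → FDiagram,
      (∀ A, memY n A → memY n (ψ A)) ∧
      (∀ A, memY n A → ψ (ψ A) = A) ∧
      (∀ A, memY n A →
        (ψ A = A ↔ ((∀ i : Fin A.1, (A.2 i).card = 1) ∧
          ¬ ∃ p q : Fin A.1, ∃ j : ℕ, p < q ∧ A.2 p = {j + 1} ∧ A.2 q = {j}))) ∧
      (∀ A, memY n A → ψ A ≠ A → ((ψ A).1 = A.1 + 1 ∨ (ψ A).1 + 1 = A.1)) ∧
      (∀ A, memY n A → dstat (ψ A) = dstat A) := by
  obtain ⟨φ, hφ⟩ := exists_list_involution hn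
  let e : FDiagram ≃ List (Finset ℕ) := List.equivSigmaTuple.symm
  have hmem : ∀ A, memY n A → e A ∈ diagrams n := fun A => (mem_diagrams_ofFn hn A).2
  have hmem' : ∀ L ∈ diagrams n, memY n (e.symm L) := fun L hL => by
    refine (mem_diagrams_ofFn hn _).1 ?_
    change e (e.symm L) ∈ diagrams n
    rwa [e.apply_symm_apply]
  have hlen : ∀ A, (e A).length = A.1 := fun A => List.length_ofFn
  have hdiag : ∀ A, diagDots 0 (e A) = dstat A := fun A => by
    refine (diagDots_ofFn A.2 0).trans ?_
    simp only [zero_add, dstat]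
  have hfix : ∀ A, e.symm (φ (e A)) = A ↔ φ (e A) = e A := fun A => e.symm_apply_eq
  refine ⟨fun A => e.symm (φ (e A)), fun A hA => hmem' _ (hφ _ (hmem A hA)).1, fun A hA => ?_,
    fun A hA => ?_, fun A hA hne => ?_, fun A hA => ?_⟩
  · dsimp only
    rw [e.apply_symm_apply, (hφ _ (hmem A hA)).2.1, e.symm_apply_apply]
  · exact (hfix A).trans ((hφ _ (hmem A hA)).2.2.1.trans (isDescentFree_ofFn A))
  · have := (hφ _ (hmem A hA)).2.2.2.1 (mt (hfix A).2 hne)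
    rwa [hlen A, ← e.apply_symm_apply (φ (e A)), hlen] at this
  · rw [← hdiag, e.apply_symm_apply, (hφ _ (hmem A hA)).2.2.2.2, hdiag]
end

section
/- For all n ≥ 1 and 1 ≤ d ≤ n, the cardinality of T_{n,d} equals the coefficient of z^d t^n in the integer polynomial 1 + Σ_{m=1}^{n} ∏_{i=1}^{m} (1 - (1-t)^{i-1}(1-zt)). -/
/-- The variable `z` in `ℤ[z, t]` (as a bivariate polynomial ring). -/
noncomputable def zVar : MvPolynomial (Fin 2) ℤ := MvPolynomial.X 0

/-- The variable `t` in `ℤ[z, t]`. -/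
noncomputable def tVar : MvPolynomial (Fin 2) ℤ := MvPolynomial.X 1

/-- The truncated refined Fishburn polynomial
`1 + Σ_{m=1}^{n} ∏_{i=1}^{m} (1 - (1-t)^{i-1}(1 - zt))`.  Each product is divisible
by `t^m`, so truncating at `m = n` does not affect the coefficient of `z^d t^n`. -/
noncomputable def refinedPoly (n : ℕ) : MvPolynomial (Fin 2) ℤ :=
  1 + ∑ m ∈ Finset.Icc 1 n,
        ∏ i ∈ Finset.Icc 1 m, (1 - (1 - tVar) ^ (i - 1) * (1 - zVar * tVar))

namespace Fishburn

open Finset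

section Series

variable {R : Type*} [CommRing R]

/-- `p + p² + ⋯ + pⁱ`. -/
def geom (p : R) : ℕ → R
  | 0 => 0
  | i + 1 => p * (1 + geom p i)

/-- The `i`-th term `b pⁱ (p; p)ᵢ (b; p)ᵢ` of the dual `q`-series. -/
def qTerm (p b : R) (i : ℕ) : R :=
  b * p ^ i * (∏ k ∈ range i, (1 - p ^ (k + 1))) * ∏ k ∈ range i, (1 - b * p ^ k)

/-- The closed form of the generating function of completions of a partial inversion table. -/
def completion (p q w a : R) (M x y : ℕ) : R :=
  ∑ i ∈ range M, qTerm p a i *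
    (geom p i ^ x * geom p (i + 1) ^ y * (1 - w * q ^ i) + w * q ^ i * geom p i ^ (x + y))

lemma one_add_geom {p q : R} (hpq : p * q = 1) (i : ℕ) : 1 + geom p i = q * geom p (i + 1) := by
  simp only [geom]
  linear_combination (-(1 + geom p i)) * hpq

lemma pow_mul_one_add_geom {p q : R} (hpq : p * q = 1) (i : ℕ) :
    q ^ i * (1 + (1 - q) * geom p i) = 1 := by
  induction i with
  | zero => simp [geom]
  | succ i ih =>
    simp only [geom, pow_succ]
    linear_combination ih + (q ^ i * (1 - q) * (1 + geom p i)) * hpq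

lemma qTerm_zero (p b : R) : qTerm p b 0 = b := by simp [qTerm]

lemma qTerm_succ {p q w a : R} (hpq : p * q = 1) (hwa : w * a = 1) (i : ℕ) :
    (1 - q) * (qTerm p a i * (1 - w * q ^ i) * geom p (i + 1)) =
      w * q ^ (i + 1) * qTerm p a (i + 1) := by
  have h1 : q ^ i * p ^ i = 1 := by rw [← mul_pow, mul_comm q, hpq, one_pow]
  have h2 := pow_mul_one_add_geom hpq (i + 1)
  have h3 : q ^ (i + 1) * p ^ (i + 1) = 1 := by rw [← mul_pow, mul_comm q, hpq, one_pow]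
  have h4 : (1 - q) * geom p (i + 1) = p ^ (i + 1) - 1 := by
    linear_combination p ^ (i + 1) * h2 - (1 + (1 - q) * geom p (i + 1)) * h3
  have h5 : w * (q ^ i * (1 - a * p ^ i)) = -(1 - w * q ^ i) := by
    linear_combination (-(w * a)) * h1 - hwa
  have h6 : q ^ (i + 1) * p ^ (i + 1) = q ^ i * p ^ i := by rw [h1, h3]
  have h7 : qTerm p a (i + 1) =
      qTerm p a i * (p * (1 - p ^ (i + 1)) * (1 - a * p ^ i)) := by
    simp only [qTerm, prod_range_succ]; ring
  rw [h7]
  linear_combination (qTerm p a i * (1 - w * q ^ i)) * h4 -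
    (qTerm p a i * (1 - p ^ (i + 1)) * p * q) * h5 +
    (qTerm p a i * (1 - p ^ (i + 1)) * (1 - w * q ^ i)) * hpq

lemma completion_diag {p q w a : R} (hpq : p * q = 1) (hwa : w * a = 1) (M y : ℕ) :
    (1 - q) * completion p q w a M 0 (y + 1) =
      w * (∑ i ∈ range M, qTerm p a i * geom p i ^ y) - 0 ^ y +
        w * q ^ M * qTerm p a M * geom p M ^ y := by
  induction M with
  | zero => simp [completion, qTerm_zero, geom, hwa]
  | succ M ih =>
    have h := qTerm_succ hpq hwa M
    have h2 := pow_mul_one_add_geom hpq M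
    simp only [completion] at ih ⊢
    rw [sum_range_succ, mul_add, ih, sum_range_succ]
    simp only [pow_succ, zero_add, pow_zero, one_mul] at h ⊢
    linear_combination geom p (M + 1) ^ y * h + (w * qTerm p a M * geom p M ^ y) * h2

lemma completion_zero_right {p q w a : R} (hpq : p * q = 1) (hwa : w * a = 1) (M x : ℕ) :
    w * completion p q w a M x 0 + w * q ^ M * qTerm p a M * geom p M ^ x =
      0 ^ x + (1 - q) * completion p q w a M 0 (x + 1) := by
  rw [completion_diag hpq hwa]
  have : completion p q w a M x 0 = ∑ i ∈ range M, qTerm p a i * geom p i ^ x := by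
    refine sum_congr rfl fun i _ => ?_
    rw [pow_zero, add_zero]; ring
  rw [this]; ring

lemma completion_succ_right {p q w a : R} (hpq : p * q = 1) (hwa : w * a = 1) (M x y : ℕ) :
    completion p q w a M x (y + 1) =
      completion p q w a M (x + 1) y + completion p q w a M x y - 0 ^ (x + y)
        - (1 - q) * completion p q w a M 0 (x + y + 1) + (1 - q) * completion p q w a M x (y + 1)
        + w * q ^ M * qTerm p a M * geom p M ^ (x + y) := by
  have h : q * completion p q w a M x (y + 1) = completion p q w a M (x + 1) y +
      completion p q w a M x y - w * ∑ i ∈ range M, qTerm p a i * geom p i ^ (x + y) := by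
    simp only [completion, mul_sum]
    rw [← sum_add_distrib, ← sum_sub_distrib]
    refine sum_congr rfl fun i _ => ?_
    have h1 := one_add_geom hpq i
    have h2 := pow_mul_one_add_geom hpq i
    rw [pow_add, pow_add, pow_add, pow_add]
    simp only [pow_succ, pow_zero, one_mul]
    linear_combination (-(qTerm p a i * geom p i ^ x * geom p (i + 1) ^ y * (1 - w * q ^ i))) * h1 -
      (w * qTerm p a i * geom p i ^ x * geom p i ^ y) * h2
  rw [completion_diag hpq hwa]
  linear_combination h

/-- The partial sums of the dual `q`-series satisfy the recurrence of `∑ₘ ∏ᵢ (1 - qⁱ w)`. -/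
lemma sum_qTerm_shift {p b c : R} (hcb : c * b = 1) (M : ℕ) :
    ∑ i ∈ range M, qTerm p b i =
      1 - (∏ k ∈ range M, (1 - p ^ (k + 1))) * (∏ k ∈ range M, (1 - b * p ^ k)) +
        (1 - c) * ∑ i ∈ range M, qTerm p (b * p) i := by
  induction M with
  | zero => simp
  | succ M ih =>
    have h : (∏ k ∈ range M, (1 - b * p * p ^ k)) * (1 - b) =
        (∏ k ∈ range M, (1 - b * p ^ k)) * (1 - b * p ^ M) := by
      rw [← prod_range_succ, prod_range_succ']
      simp [pow_succ', mul_assoc]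
    rw [sum_range_succ, ih, sum_range_succ, prod_range_succ, prod_range_succ]
    simp only [qTerm]
    linear_combination (p ^ M * p * (∏ k ∈ range M, (1 - p ^ (k + 1)))) * h +
      (p ^ M * p * (∏ k ∈ range M, (1 - p ^ (k + 1))) *
        (∏ k ∈ range M, (1 - b * p * p ^ k))) * hcb

lemma sum_qTerm_iterate {p q w a : R} (hpq : p * q = 1) (hwa : w * a = 1) (M K : ℕ) :
    ∑ i ∈ range M, qTerm p a i =
      (∑ m ∈ range K, (∏ i ∈ range m, (1 - q ^ i * w)) *
        (1 - (∏ k ∈ range M, (1 - p ^ (k + 1))) * ∏ k ∈ range M, (1 - a * p ^ m * p ^ k))) +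
      (∏ i ∈ range K, (1 - q ^ i * w)) * ∑ i ∈ range M, qTerm p (a * p ^ K) i := by
  induction K with
  | zero => simp
  | succ K ih =>
    have hc : (q ^ K * w) * (a * p ^ K) = 1 := by
      have : p ^ K * q ^ K = 1 := by rw [← mul_pow, hpq, one_pow]
      linear_combination p ^ K * q ^ K * hwa + this
    rw [ih, sum_qTerm_shift hc, sum_range_succ, prod_range_succ, pow_succ, ← mul_assoc]
    ring

end Series

section Subsets

variable {ι R : Type*} [LinearOrder ι] [CommRing R]

lemma sum_powerset_of_recurrence (z : R) (f g : ℕ → ℕ → R)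
    (h0 : ∀ x, g x 0 = f 0 (x + 1) + z * f x 0)
    (hs : ∀ x y, g x (y + 1) = g (x + 1) y + g x y - f 0 (x + y + 1) + f x (y + 1))
    (κ : ι) (A : Finset ι) (hA : ∀ i ∈ A, κ < i) (x : ℕ) :
    ∑ P ∈ (insert κ A).powerset, (if P = ∅ then f 0 (x + #A + 1) else
      (if κ ∈ P then z else 1) * f (x + #{i ∈ insert κ A | i ∉ P ∧ ∃ j ∈ P, j < i})
        #{i ∈ insert κ A | ∀ j ∈ P, i < j}) = g x #A := by
  induction A using Finset.induction_on_max generalizing x with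
  | empty =>
    rw [sum_powerset_insert (notMem_empty _)]
    have e1 : {i ∈ ({κ} : Finset ι) | ¬i = κ ∧ κ < i} = ∅ :=
      filter_eq_empty_iff.2 fun i hi h => h.1 (mem_singleton.1 hi)
    have e2 : {i ∈ ({κ} : Finset ι) | i < κ} = ∅ :=
      filter_eq_empty_iff.2 fun i hi h => h.ne (mem_singleton.1 hi)
    simp [h0, e1, e2]
  | insert m A hm ih =>
    have hA' : ∀ i ∈ A, κ < i := fun i hi => hA i (mem_insert_of_mem hi)
    have hκm : κ < m := hA m (mem_insert_self _ _)
    have hmA : m ∉ A := fun h => lt_irrefl _ (hm m h)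
    have hlt : ∀ i ∈ insert κ A, i < m := by
      intro i hi
      rcases mem_insert.1 hi with rfl | hi
      exacts [hκm, hm i hi]
    have hmB : m ∉ insert κ A := fun h => lt_irrefl _ (hlt m h)
    have hκA : κ ∉ A := fun h => lt_irrefl _ (hA' κ h)
    have hB : #(insert κ A) = #A + 1 := card_insert_of_notMem hκA
    rw [insert_comm, sum_powerset_insert hmB, card_insert_of_notMem hmA, hs,
      ← ih hA' (x + 1), ← ih hA' x]
    have key : ∑ P ∈ (insert κ A).powerset, (if insert m P = ∅ then f 0 (x + (#A + 1) + 1) else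
        (if κ ∈ insert m P then z else 1) *
          f (x + #{i ∈ insert m (insert κ A) | i ∉ insert m P ∧ ∃ j ∈ insert m P, j < i})
          #{i ∈ insert m (insert κ A) | ∀ j ∈ insert m P, i < j}) =
        ∑ P ∈ (insert κ A).powerset, ((if P = ∅ then f 0 (x + #A + 1) else
      (if κ ∈ P then z else 1) * f (x + #{i ∈ insert κ A | i ∉ P ∧ ∃ j ∈ P, j < i})
        #{i ∈ insert κ A | ∀ j ∈ P, i < j}) +
        (if P = ∅ then f x (#A + 1) - f 0 (x + #A + 1) else 0)) := by
      refine sum_congr rfl fun P hP => ?_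
      have hPs := mem_powerset.1 hP
      rw [if_neg (insert_ne_empty _ _)]
      have e1 : {i ∈ insert m (insert κ A) | i ∉ insert m P ∧ ∃ j ∈ insert m P, j < i} =
          {i ∈ insert κ A | i ∉ P ∧ ∃ j ∈ P, j < i} := by
        ext i
        have := hlt i
        simp only [mem_filter, mem_insert] at this ⊢
        grind
      have e2 : {i ∈ insert m (insert κ A) | ∀ j ∈ insert m P, i < j} =
          {i ∈ insert κ A | ∀ j ∈ P, i < j} := by
        ext i
        have := hlt i
        simp only [mem_filter, mem_insert] at this ⊢
        grind
      rw [e1, e2]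
      by_cases hPe : P = ∅
      · subst hPe
        simp [hκm.ne, hB]
      · simp [hPe, hκm.ne]
    rw [key, sum_add_distrib, sum_ite_eq' _ _ (fun _ => f x (#A + 1) - f 0 (x + #A + 1)),
      if_pos (empty_mem_powerset _)]
    have key2 : ∑ P ∈ (insert κ A).powerset, (if P = ∅ then f 0 (x + (#A + 1) + 1) else
        (if κ ∈ P then z else 1) *
          f (x + #{i ∈ insert m (insert κ A) | i ∉ P ∧ ∃ j ∈ P, j < i})
          #{i ∈ insert m (insert κ A) | ∀ j ∈ P, i < j}) =
        ∑ P ∈ (insert κ A).powerset, (if P = ∅ then f 0 (x + 1 + #A + 1) else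
      (if κ ∈ P then z else 1) * f (x + 1 + #{i ∈ insert κ A | i ∉ P ∧ ∃ j ∈ P, j < i})
        #{i ∈ insert κ A | ∀ j ∈ P, i < j}) := by
      refine sum_congr rfl fun P hP => ?_
      have hPs := mem_powerset.1 hP
      have hmP : m ∉ P := fun h => hmB (hPs h)
      split_ifs with hPe hκ
      · congr 1; omega
      all_goals
        obtain ⟨j, hj⟩ := nonempty_iff_ne_empty.2 hPe
        have hjm := hlt j (hPs hj)
        have e1 : {i ∈ insert m (insert κ A) | i ∉ P ∧ ∃ j ∈ P, j < i} =
            insert m {i ∈ insert κ A | i ∉ P ∧ ∃ j ∈ P, j < i} := by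
          ext i
          simp only [mem_filter, mem_insert]
          grind
        have e2 : {i ∈ insert m (insert κ A) | ∀ j ∈ P, i < j} =
            {i ∈ insert κ A | ∀ j ∈ P, i < j} := by
          ext i
          simp only [mem_filter, mem_insert]
          grind
        rw [e1, e2, card_insert_of_notMem (fun h => hmB (mem_filter.1 h).1), add_assoc x 1,
          add_comm 1]
    rw [key2]
    ring

end Subsets

section Words

variable {n : ℕ}

/-- The words counted by the theorem which agree with `g` outside `V` and whose entries in `V`
are smaller than `k`. -/
def extensions (V : Finset (Fin n)) (g : Fin n → ℕ) (k : ℕ) : Finset (Fin n → ℕ) :=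
  {a ∈ Fintype.piFinset fun i : Fin n => range (i.1 + 1) |
    (¬ ∃ p q : Fin n, p < q ∧ a p = a q + 1) ∧ (∀ i ∉ V, a i = g i) ∧ ∀ i ∈ V, a i < k}

lemma mem_extensions {V : Finset (Fin n)} {g : Fin n → ℕ} {k : ℕ} {a : Fin n → ℕ} :
    a ∈ extensions V g k ↔ (∀ i, a i ≤ i.1) ∧ (¬ ∃ p q : Fin n, p < q ∧ a p = a q + 1) ∧
      (∀ i ∉ V, a i = g i) ∧ ∀ i ∈ V, a i < k := by
  simp [extensions, Fintype.mem_piFinset]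

lemma sum_extensions_succ {R : Type*} [AddCommMonoid R] (V : Finset (Fin n)) (g : Fin n → ℕ)
    (k : ℕ) (F : (Fin n → ℕ) → R) :
    ∑ a ∈ extensions V g (k + 1), F a =
      ∑ P ∈ V.powerset, ∑ a ∈ extensions (V \ P) (fun i => if i ∈ P then k else g i) k, F a := by
  rw [← sum_fiberwise_of_maps_to (t := V.powerset) (g := fun a => {i ∈ V | a i = k})
    (fun a _ => mem_powerset.2 (filter_subset _ _))]
  refine sum_congr rfl fun P hP => sum_congr ?_ fun _ _ => rfl
  have hPV := mem_powerset.1 hP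
  ext a
  simp only [mem_filter, mem_extensions, mem_sdiff, Finset.ext_iff]
  constructor
  · rintro ⟨⟨h1, h2, h3, h4⟩, h5⟩
    refine ⟨h1, h2, fun i hi => ?_, fun i hi => ?_⟩
    · have := h3 i; have := h5 i
      grind
    · have := h4 i hi.1; have := h5 i
      grind
  · rintro ⟨h1, h2, h3, h4⟩
    refine ⟨⟨h1, h2, fun i hi => ?_, fun i hi => ?_⟩, fun i => ?_⟩
    · have := h3 i; have := @hPV i
      grind
    · have := h3 i; have := h4 i
      grind
    · have := h3 i; have := h4 i; have := @hPV i
      grind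

lemma sum_extensions {R : Type*} [CommRing R] (z : R) (c : ℕ → ℕ → ℕ → R)
    (hc : ∀ x y, c 0 x y = 0 ^ (x + y))
    (h0 : ∀ k < n, ∀ x, c (k + 1) x 0 = c k 0 (x + 1) + z * c k x 0)
    (hs : ∀ k < n, ∀ x y, c (k + 1) x (y + 1) =
      c (k + 1) (x + 1) y + c (k + 1) x y - c k 0 (x + y + 1) + c k x (y + 1))
    (k : ℕ) (hk : k ≤ n) (V : Finset (Fin n)) (g : Fin n → ℕ)
    (hg : ∀ i ∉ V, k ≤ g i ∧ g i ≤ i.1)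
    (hav : ∀ p ∉ V, ∀ q ∉ V, p < q → g p ≠ g q + 1) :
    ∑ a ∈ extensions V g k, z ^ #{i : Fin n | a i = i.1} =
      z ^ #{i : Fin n | i ∉ V ∧ g i = i.1} *
        c k #{i ∈ V | k ≤ i.1 ∧ ∃ j, j ∉ V ∧ g j = k ∧ j < i}
          #{i ∈ V | k ≤ i.1 ∧ ∀ j, j ∉ V → g j = k → i < j} := by
  induction k generalizing V g with
  | zero =>
    rw [hc]
    rcases V.eq_empty_or_nonempty with rfl | ⟨v, hv⟩
    · have : extensions ∅ g 0 = {g} := by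
        ext a
        simp only [mem_extensions, mem_singleton]
        refine ⟨fun h => funext fun i => h.2.2.1 i (notMem_empty i), ?_⟩
        rintro rfl
        refine ⟨fun i => (hg i (notMem_empty i)).2, ?_, by simp, by simp⟩
        rintro ⟨p, q, h, h'⟩
        exact hav p (notMem_empty p) q (notMem_empty q) h h'
      simp [this]
    · have : extensions V g 0 = ∅ := by
        ext a
        simp only [mem_extensions, notMem_empty, iff_false]
        exact fun h => absurd (h.2.2.2 v hv) (Nat.not_lt_zero _)
      rw [this, sum_empty, zero_pow, mul_zero]
      intro h
      rw [Nat.add_eq_zero_iff, card_eq_zero, card_eq_zero, filter_eq_empty_iff,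
        filter_eq_empty_iff] at h
      have h1 := h.1 hv
      have h2 := h.2 hv
      simp only [zero_le, true_and] at h1 h2
      push Not at h1 h2
      obtain ⟨j, hj, hgj, hjv⟩ := h2
      rcases hjv.lt_or_eq with h | rfl
      exacts [absurd (h1 j hj hgj) (not_le.2 h), hj hv]
  | succ k ih =>
    have hkn : k < n := hk
    set κ : Fin n := ⟨k, hk⟩ with hκ
    have hκV : κ ∈ V := by
      by_contra h
      have := hg κ h
      simp only [hκ] at this
      omega
    set A : Finset (Fin n) := {i ∈ V | k + 1 ≤ i.1 ∧ ∀ j, j ∉ V → g j = k + 1 → i < j} with hA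
    set B : Finset (Fin n) := {i ∈ V | k + 1 ≤ i.1 ∧ ∃ j, j ∉ V ∧ g j = k + 1 ∧ j < i} with hB
    have hAκ : ∀ i ∈ A, κ < i := fun i hi => by
      have := (mem_filter.1 hi).2.1
      exact Fin.lt_def.2 this
    have hval : ∀ i : Fin n, i = κ ↔ i.1 = k := fun i => by rw [Fin.ext_iff]
    have hAV : insert κ A ⊆ V := insert_subset hκV (filter_subset _ _)
    have hltA : ∀ i ∈ insert κ A, ∀ j, j ∉ V → g j = k + 1 → i < j := by
      intro i hi j hj hgj
      rcases mem_insert.1 hi with rfl | hi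
      · have := (hg j hj).2
        exact Fin.lt_def.2 (by simp only [hκ]; omega)
      · exact (mem_filter.1 hi).2.2 j hj hgj
    rw [sum_extensions_succ, ← sum_powerset_of_recurrence z (c k) (c (k + 1)) (h0 k hkn)
      (hs k hkn) κ A hAκ, ← sum_subset (powerset_mono.2 hAV), mul_sum]
    · refine sum_congr rfl fun P hP => ?_
      have hPA := mem_powerset.1 hP
      have hPV := hPA.trans hAV
      have hPk : ∀ i ∈ P, k ≤ i.1 := by
        intro i hi
        rcases mem_insert.1 (hPA hi) with rfl | hi
        exacts [le_rfl, (Fin.le_def.1 (hAκ i hi).le)]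
      rw [ih hkn.le (V \ P)]
      · have hz : z ^ #{i : Fin n | i ∉ V \ P ∧ (if i ∈ P then k else g i) = i.1} =
            z ^ #{i : Fin n | i ∉ V ∧ g i = i.1} * (if κ ∈ P then z else 1) := by
          split_ifs with hκP
          · rw [← pow_succ, ← card_insert_of_notMem (a := κ) (by simp [hκV])]
            congr 2
            ext i
            have := hval i
            have := @hPV i
            simp only [mem_filter, mem_univ, true_and, mem_insert, mem_sdiff]
            grind
          · rw [mul_one]
            congr 2
            ext i
            have := hval i
            have := @hPV i
            simp only [mem_filter, mem_univ, true_and, mem_sdiff]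
            grind
        have hnew : ∀ j, (j ∉ V \ P ∧ (if j ∈ P then k else g j) = k) ↔ j ∈ P := by
          intro j
          have := hg j
          have := @hPV j
          simp only [mem_sdiff]
          grind
        have hy : {i ∈ V \ P | k ≤ i.1 ∧ ∀ j, j ∉ V \ P → (if j ∈ P then k else g j) = k → i < j} =
            {i ∈ V \ P | k ≤ i.1 ∧ ∀ j ∈ P, i < j} := by
          refine filter_congr fun i _ => and_congr_right fun _ => forall_congr' fun j => ?_
          exact and_imp.symm.trans (imp_congr_left (hnew j))
        have hx : {i ∈ V \ P | k ≤ i.1 ∧ ∃ j, j ∉ V \ P ∧ (if j ∈ P then k else g j) = k ∧ j < i} =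
            {i ∈ V \ P | k ≤ i.1 ∧ ∃ j ∈ P, j < i} := by
          refine filter_congr fun i _ => and_congr_right fun _ => exists_congr fun j => ?_
          exact and_assoc.symm.trans (and_congr_left' (hnew j))
        have hcover : ∀ i ∈ V, k ≤ i.1 → i ∈ insert κ A ∨ i ∈ B := by
          intro i hi hki
          by_cases hik : i = κ
          · exact Or.inl (mem_insert.2 (Or.inl hik))
          · have : k + 1 ≤ i.1 := by
              have := hval i
              omega
            by_cases hj : ∃ j, j ∉ V ∧ g j = k + 1 ∧ j < i
            · exact Or.inr (mem_filter.2 ⟨hi, this, hj⟩)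
            · refine Or.inl (mem_insert_of_mem (mem_filter.2 ⟨hi, this, fun j hj1 hj2 => ?_⟩))
              push Not at hj
              refine lt_of_le_of_ne (hj j hj1 hj2) ?_
              rintro rfl
              exact hj1 hi
        have hBlt : ∀ i ∈ B, ∀ j ∈ insert κ A, j < i := by
          intro i hi j hj
          obtain ⟨-, -, l, hl, hgl, hli⟩ := mem_filter.1 hi
          exact (hltA j hj l hl hgl).trans hli
        have hdisj : Disjoint B (insert κ A) := by
          rw [disjoint_left]
          exact fun i hi hi' => lt_irrefl _ (hBlt i hi i hi')
        have hBV : ∀ i ∈ B, i ∈ V ∧ k ≤ i.1 := fun i hi => by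
          have := mem_filter.1 hi
          exact ⟨this.1, by omega⟩
        have hAk : ∀ i ∈ insert κ A, i ∈ V ∧ k ≤ i.1 := fun i hi => by
          refine ⟨hAV hi, ?_⟩
          rcases mem_insert.1 hi with rfl | hi
          exacts [le_rfl, (Fin.le_def.1 (hAκ i hi).le)]
        rw [hz, hx, hy, mul_assoc]
        congr 1
        rcases P.eq_empty_or_nonempty with rfl | ⟨j, hj⟩
        · have e : {i ∈ V | k ≤ i.1} = B ∪ insert κ A := by
            ext i
            simp only [mem_filter, mem_union]
            have := hcover i
            have := hBV i
            have := hAk i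
            grind
          have hκA : κ ∉ A := fun h => lt_irrefl _ (hAκ κ h)
          have e' : #B + #A + 1 = #(B ∪ insert κ A) := by
            rw [card_union_of_disjoint hdisj, card_insert_of_notMem hκA, add_assoc]
          rw [if_pos rfl, e', ← e]
          simp
        · rw [if_neg (ne_empty_of_mem hj)]
          have e1 : {i ∈ V \ P | k ≤ i.1 ∧ ∃ j ∈ P, j < i} =
              B ∪ {i ∈ insert κ A | i ∉ P ∧ ∃ j ∈ P, j < i} := by
            ext i
            rw [mem_union, mem_filter, mem_filter (s := insert κ A), mem_sdiff]
            constructor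
            · rintro ⟨⟨h1, h2⟩, h3, h4⟩
              rcases hcover i h1 h3 with h | h
              exacts [Or.inr ⟨h, h2, h4⟩, Or.inl h]
            · rintro (h | ⟨h1, h2, h3⟩)
              · exact ⟨⟨(hBV i h).1, fun h' => lt_irrefl _ (hBlt i h i (hPA h'))⟩, (hBV i h).2,
                  j, hj, hBlt i h j (hPA hj)⟩
              · exact ⟨⟨(hAk i h1).1, h2⟩, (hAk i h1).2, h3⟩
          have e2 : {i ∈ V \ P | k ≤ i.1 ∧ ∀ j ∈ P, i < j} =
              {i ∈ insert κ A | ∀ j ∈ P, i < j} := by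
            ext i
            rw [mem_filter, mem_filter, mem_sdiff]
            constructor
            · rintro ⟨⟨h1, h2⟩, h3, h4⟩
              refine ⟨(hcover i h1 h3).resolve_right fun h => ?_, h4⟩
              exact lt_asymm (h4 j hj) (hBlt i h j (hPA hj))
            · rintro ⟨h1, h2⟩
              exact ⟨⟨(hAk i h1).1, fun h => lt_irrefl _ (h2 i h)⟩, (hAk i h1).2, h2⟩
          rw [e1, e2, card_union_of_disjoint (hdisj.mono_right (filter_subset _ _))]
          congr!
      · intro i hi
        have := hg i
        have := hPk i
        simp only [mem_sdiff] at hi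
        grind
      · intro p hp q hq hpq
        have h1 : ∀ i ∉ V \ P, i ∉ P → i ∉ V := fun i hi hi' h => hi (mem_sdiff.2 ⟨h, hi'⟩)
        by_cases hpP : p ∈ P <;> by_cases hqP : q ∈ P <;> simp only [hpP, hqP, if_true, if_false]
        · omega
        · have := hg q (h1 q hq hqP)
          omega
        · intro h
          exact lt_asymm hpq (hltA q (hPA hqP) p (h1 p hp hpP) h)
        · exact hav p (h1 p hp hpP) q (h1 q hq hqP) hpq
    · intro P hP hPA
      rw [mem_powerset] at hP hPA
      obtain ⟨i, hiP, hiA⟩ := not_subset.1 hPA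
      refine sum_eq_zero fun a ha => absurd ha fun ha => hiA ?_
      obtain ⟨h1, h2, h3, -⟩ := mem_extensions.1 ha
      have hai : a i = k := by simpa [hiP] using h3 i (by simp [hiP])
      have hki := h1 i
      by_cases hik : i = κ
      · exact mem_insert.2 (Or.inl hik)
      · refine mem_insert_of_mem (mem_filter.2 ⟨hP hiP, ?_, fun j hj hgj => ?_⟩)
        · have := hval i
          omega
        · have hjP : j ∉ P := fun h => hj (hP h)
          have haj : a j = k + 1 := by
            rw [h3 j (by simp [hj])]
            simp [hjP, hgj]
          refine lt_of_le_of_ne (not_lt.1 fun h => h2 ⟨j, i, h, by rw [haj, hai]⟩) ?_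
          rintro rfl
          exact hj (hP hiP)

end Words

section PowerSeries

open PowerSeries in
lemma X_pow_dvd_prod {R : Type*} [CommRing R] {p : R⟦X⟧} (hp : p * (1 - X) = 1) (M : ℕ) :
    (X : R⟦X⟧) ^ M ∣ ∏ k ∈ range M, (1 - p ^ (k + 1)) := by
  have h : ∀ k ∈ range M, (X : R⟦X⟧) ∣ 1 - p ^ (k + 1) := fun k _ => by
    have h1 : (X : R⟦X⟧) ∣ 1 - p := ⟨-p, by linear_combination -hp⟩
    have h2 := sub_dvd_pow_sub_pow (1 : R⟦X⟧) p (k + 1)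
    rw [one_pow] at h2
    exact h1.trans h2
  simpa using prod_dvd_prod_of_dvd (fun _ => (X : R⟦X⟧)) _ h

open PowerSeries in
lemma coeff_sum_qTerm {R : Type*} [CommRing R] {p w a : R⟦X⟧} (hp : p * (1 - X) = 1)
    (hwa : w * a = 1) (hw : X ∣ 1 - w) (n : ℕ) :
    coeff n (∑ i ∈ range (n + 1), qTerm p a i) =
      coeff n (∑ m ∈ range (n + 1), ∏ i ∈ range m, (1 - (1 - X) ^ i * w)) := by
  rw [← sub_eq_zero, ← map_sub, sum_qTerm_iterate hp hwa (n + 1) (n + 1)]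
  have h : ∀ i ∈ range (n + 1), (X : R⟦X⟧) ∣ 1 - (1 - X) ^ i * w := fun i _ => by
    have h2 := sub_dvd_pow_sub_pow (1 : R⟦X⟧) (1 - X) i
    rw [one_pow, sub_sub_cancel] at h2
    have e : 1 - (1 - X) ^ i * w = (1 - (1 - X) ^ i) * w + (1 - w) := by ring
    rw [e]
    exact dvd_add (h2.mul_right _) hw
  have h1 : (X : R⟦X⟧) ^ (n + 1) ∣ ∏ i ∈ range (n + 1), (1 - (1 - X) ^ i * w) := by
    simpa using prod_dvd_prod_of_dvd (fun _ => (X : R⟦X⟧)) _ h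
  refine X_pow_dvd_iff.1 ?_ n (Nat.lt_succ_self n)
  rw [add_sub_right_comm, ← sum_sub_distrib]
  refine dvd_add (dvd_sum fun m _ => ?_) (h1.mul_right _)
  rw [mul_sub, mul_one, sub_sub_cancel_left, dvd_neg]
  exact ((X_pow_dvd_prod hp (n + 1)).mul_right _).mul_left _

open PowerSeries in
lemma sum_extensions_univ (n : ℕ) :
    ∑ a ∈ extensions (univ : Finset (Fin n)) 0 n,
        (Polynomial.X : Polynomial ℤ) ^ #{i : Fin n | a i = i.1} =
      coeff n (∑ m ∈ range (n + 1), ∏ i ∈ range m,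
        (1 - (1 - X) ^ i * (1 - C (Polynomial.X : Polynomial ℤ) * X))) := by
  set w : (Polynomial ℤ)⟦X⟧ := 1 - C (Polynomial.X : Polynomial ℤ) * X with hw
  obtain ⟨a, hwa⟩ : ∃ a, w * a = 1 :=
    isUnit_iff_exists_inv.1 (isUnit_iff_constantCoeff.2 (by simp [hw]))
  obtain ⟨p, hp⟩ : ∃ p, p * (1 - X : (Polynomial ℤ)⟦X⟧) = 1 :=
    isUnit_iff_exists_inv'.1 (isUnit_iff_constantCoeff.2 (by simp))
  set c := completion p (1 - X) w a (n + 1) with hcdef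
  have herr : ∀ k ≤ n, ∀ y, coeff k
      (w * (1 - X) ^ (n + 1) * qTerm p a (n + 1) * geom p (n + 1) ^ y) = 0 := by
    intro k hk y
    refine X_pow_dvd_iff.1 ?_ k (Nat.lt_succ_of_le hk)
    have : X ^ (n + 1) ∣ qTerm p a (n + 1) :=
      ((X_pow_dvd_prod hp (n + 1)).mul_left _).mul_right _
    exact (this.mul_left _).mul_right _
  have hcoeff : ∀ k j, coeff (k + 1) ((0 : (Polynomial ℤ)⟦X⟧) ^ j) = 0 := by
    rintro k (_ | j)
    · rw [pow_zero, coeff_one, if_neg (Nat.succ_ne_zero k)]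
    · simp
  have key := sum_extensions (n := n) (Polynomial.X : Polynomial ℤ)
    (fun k x y => coeff k (c x y)) ?_ ?_ ?_ n le_rfl univ 0 (by simp) (by simp)
  · rw [key, ← coeff_sum_qTerm hp hwa ⟨C Polynomial.X, by rw [hw]; ring⟩]
    have : ∀ i : Fin n, ¬ n ≤ i.1 := fun i => not_le.2 i.2
    simp only [mem_univ, not_true_eq_false, false_and, filter_false, card_empty, pow_zero, one_mul,
      this, hcdef]
    refine congrArg (coeff n) (sum_congr rfl fun i _ => ?_)
    rw [add_zero, pow_zero, pow_zero, mul_one, one_mul, mul_one, sub_add_cancel, mul_one]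
  · intro x y
    have hw1 : constantCoeff w = 1 := by simp [hw]
    have ha1 : constantCoeff a = 1 := by
      simpa [hw1] using congrArg constantCoeff hwa
    have hz : ∀ i ∈ range (n + 1), i ≠ 0 → constantCoeff (qTerm p a i *
      (geom p i ^ x * geom p (i + 1) ^ y * (1 - w * (1 - X) ^ i) +
        w * (1 - X) ^ i * geom p i ^ (x + y))) = 0 := by
      intro i _ hi
      obtain ⟨j, rfl⟩ := Nat.exists_eq_succ_of_ne_zero hi
      simp [qTerm, prod_range_succ' (fun k => 1 - a * p ^ k), ha1]
    rw [coeff_zero_eq_constantCoeff_apply, hcdef, completion, map_sum,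
      sum_eq_single_of_mem 0 (by simp) hz]
    simp [qTerm, geom, hw1, ha1]
  · intro k hk x
    have h := congrArg (coeff (k + 1)) (completion_zero_right hp hwa (n + 1) x)
    rw [map_add, herr (k + 1) hk, map_add, hcoeff, sub_sub_cancel, coeff_succ_X_mul, hw, sub_mul,
      one_mul, map_sub, mul_assoc, coeff_C_mul, coeff_succ_X_mul] at h
    linear_combination h
  · intro k hk x y
    have h := congrArg (coeff (k + 1)) (completion_succ_right hp hwa (n + 1) x y)
    rw [map_add, herr (k + 1) hk, map_add, map_sub, map_sub, map_add, hcoeff, sub_sub_cancel,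
      coeff_succ_X_mul, coeff_succ_X_mul] at h
    linear_combination h

open PowerSeries in
lemma coeff_coeff_aeval (P : MvPolynomial (Fin 2) ℤ) (d n : ℕ) :
    (coeff n (MvPolynomial.aeval ![C (Polynomial.X : Polynomial ℤ), X] P)).coeff d =
      P.coeff (Finsupp.single 0 d + Finsupp.single 1 n) := by
  induction P using MvPolynomial.induction_on' with
  | monomial s r =>
    have hs : s = Finsupp.single 0 (s 0) + Finsupp.single 1 (s 1) := by
      ext i; fin_cases i <;> simp
    have h : s = Finsupp.single 0 d + Finsupp.single 1 n ↔ d = s 0 ∧ n = s 1 := by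
      constructor
      · intro h; rw [h]; simp
      · rintro ⟨rfl, rfl⟩; exact hs
    rw [MvPolynomial.aeval_monomial, MvPolynomial.coeff_monomial,
      Finsupp.prod_fintype _ _ (fun _ => pow_zero _), Fin.prod_univ_two]
    have e : algebraMap ℤ (Polynomial ℤ)⟦X⟧ r = C (Polynomial.C r) := by simp
    rw [e]
    simp only [Matrix.cons_val_zero, Matrix.cons_val_one, ← mul_assoc, ← map_pow, ← map_mul,
      coeff_C_mul, coeff_X_pow, h]
    by_cases hn : n = s 1 <;> by_cases hd : d = s 0 <;> simp [hn, hd, Polynomial.coeff_X_pow]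
  | add P Q hP hQ => simp [hP, hQ]

end PowerSeries

end Fishburn

/-- For `n ≥ 1` and `1 ≤ d ≤ n`, `|T_{n,d}|` equals the coefficient of `z^d t^n` in
`1 + Σ_{m=1}^{n} ∏_{i=1}^{m} (1 - (1-t)^{i-1}(1 - zt))`.  Here `T_{n,d}` is the set of
inversion tables of length `n` (0-based: `a i ≤ i`) with no decreasing subsequence of
consecutive integers, with `a_i = i - 1` (0-based: `a i = i`) for exactly `d` values
of `i`. -/
theorem Tnd_card_eq_refined_coeff (n d : ℕ) (hn : 1 ≤ n) (hd : 1 ≤ d) (hdn : d ≤ n) :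
    ({a : Fin n → ℕ | (∀ i, a i ≤ i.1) ∧
        (¬ ∃ p q : Fin n, p < q ∧ a p = a q + 1) ∧
        (Finset.univ.filter (fun i : Fin n => a i = i.1)).card = d}.ncard : ℤ) =
      (refinedPoly n).coeff (Finsupp.single 0 d + Finsupp.single 1 n) := by
  have hset : {a : Fin n → ℕ | (∀ i, a i ≤ i.1) ∧
        (¬ ∃ p q : Fin n, p < q ∧ a p = a q + 1) ∧
        (Finset.univ.filter (fun i : Fin n => a i = i.1)).card = d} =
      ((Fishburn.extensions Finset.univ 0 n).filter fun a =>
        d = (Finset.univ.filter (fun i : Fin n => a i = i.1)).card : Set (Fin n → ℕ)) := by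
    ext a
    simp only [Set.mem_ofPred_eq, Finset.coe_filter, Fishburn.mem_extensions, Finset.mem_univ,
      not_true_eq_false, false_imp_iff, implies_true, true_and, true_imp_iff]
    exact ⟨fun h => ⟨⟨h.1, h.2.1, fun i => (h.1 i).trans_lt i.2⟩, h.2.2.symm⟩,
      fun h => ⟨h.1.1, h.1.2.1, h.2.symm⟩⟩
  have hpoly : MvPolynomial.aeval ![PowerSeries.C (Polynomial.X : Polynomial ℤ), PowerSeries.X]
      (refinedPoly n) = ∑ m ∈ Finset.range (n + 1), ∏ i ∈ Finset.range m,
        (1 - (1 - PowerSeries.X) ^ i *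
          (1 - PowerSeries.C (Polynomial.X : Polynomial ℤ) * PowerSeries.X)) := by
    have h : ∀ m (f : ℕ → PowerSeries (Polynomial ℤ)),
        ∏ i ∈ Finset.Icc 1 m, f (i - 1) = ∏ i ∈ Finset.range m, f i := fun m f => by
      rw [Finset.range_eq_Ico, Finset.prod_Ico_eq_prod_range, ← Finset.Ico_add_one_right_eq_Icc,
        Finset.prod_Ico_eq_prod_range]
      simp
    have h' : ∀ f : ℕ → PowerSeries (Polynomial ℤ),
        ∑ m ∈ Finset.range (n + 1), f m = f 0 + ∑ m ∈ Finset.Icc 1 n, f m := fun f => by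
      rw [Finset.sum_range_succ', add_comm, ← Finset.Ico_add_one_right_eq_Icc,
        Finset.sum_Ico_eq_sum_range]
      simp [add_comm]
    rw [h', Finset.prod_range_zero]
    simp only [refinedPoly, zVar, tVar, map_add, map_sub, map_sum, map_prod, map_mul, map_pow,
      map_one, MvPolynomial.aeval_X, Matrix.cons_val_zero, Matrix.cons_val_one, ← h]
  rw [hset, Set.ncard_coe_finset, ← Fishburn.coeff_coeff_aeval, hpoly,
    ← Fishburn.sum_extensions_univ, Polynomial.finsetSum_coeff, Finset.card_filter]
  simp [Polynomial.coeff_X_pow]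
end

section
/- For all n ≥ 1 and 1 ≤ d ≤ n, the cardinality of T_{n,d} equals the coefficient of z^d t^n in the integer polynomial 1 + Σ_{m=1}^{n} [ (zt) · (Σ_{j=0}^{n} C(m-1+j, j) (zt)^j) · ∏_{i=1}^{m-1} (1 - (1-t)^i) ], where the inner sum is the expansion of 1/(1-zt)^m truncated at degree n. -/
/-- The truncated second refined Fishburn polynomial
`1 + Σ_{m=1}^{n} [ zt · (Σ_{j=0}^{n} C(m-1+j, j) (zt)^j) · ∏_{i=1}^{m-1} (1 - (1-t)^i) ]`,
where the inner sum is the expansion of `1/(1-zt)^m` truncated at degree `n`.  Each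
summand has `t`-order at least `m`, so truncating at `m = n`, and truncating the
geometric expansion at degree `n`, does not affect the coefficient of `z^d t^n`. -/
noncomputable def refinedPoly' (n : ℕ) : MvPolynomial (Fin 2) ℤ :=
  1 + ∑ m ∈ Finset.Icc 1 n,
        (zVar * tVar *
          (∑ j ∈ Finset.range (n + 1),
            (((m - 1 + j).choose j : ℤ) : MvPolynomial (Fin 2) ℤ) * (zVar * tVar) ^ j) *
          ∏ i ∈ Finset.Icc 1 (m - 1), (1 - (1 - tVar) ^ i))


open Finset in
/-- The transfer operator on functions of the state of a partially filled inversion table: a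
state `(a, b)` has `a + 1` open positions which admit the next value and `b` which do not. The
next value is put on no position, or on a subset of the admissible ones leaving `k` open positions
before its first element; `z` marks the use of the first open position. -/
def fishburnTransfer {R : Type*} [CommRing R] (z : R) : Module.End R (ℕ → ℕ → R) where
  toFun φ a b := φ (a + b + 1) 0 + ∑ k ∈ range (a + 1), (if k = 0 then z else 1) *
    ∑ j ∈ range (a - k + 1), ((a - k).choose j : R) * φ k (b + (a - k - j))
  map_add' φ ψ := by
    funext a b
    simp only [Pi.add_apply, mul_add, sum_add_distrib]
    ring
  map_smul' c φ := by
    funext a b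
    simp only [Pi.smul_apply, smul_eq_mul, RingHom.id_apply, mul_add, mul_sum]
    congr 1
    refine sum_congr rfl fun k _ => sum_congr rfl fun j _ => by ring

/-- The state weight `x ^ a * y ^ b`. -/
def stateWeight {R : Type*} [CommRing R] (x y : R) : ℕ → ℕ → R := fun a b => x ^ a * y ^ b

section Algebra
open Finset

variable {R : Type*} [CommRing R] (z t : R) (N : ℕ)

lemma fishburnTransfer_stateWeight_apply (x y : R) (a b : ℕ) :
    fishburnTransfer z (stateWeight x y) a b = x ^ (a + b + 1) +
      y ^ b * (z * (1 + y) ^ a + x * ∑ k ∈ range a, x ^ k * (1 + y) ^ (a - 1 - k)) := by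
  have key (m : ℕ) : ∑ j ∈ range (m + 1), ((m.choose j : R)) * y ^ (m - j) = (1 + y) ^ m := by
    rw [add_pow]
    exact sum_congr rfl fun j _ => by ring
  have h (k : ℕ) : ∑ j ∈ range (a - k + 1), ((a - k).choose j : R) * (x ^ k * y ^ (b + (a - k - j)))
      = x ^ k * y ^ b * (1 + y) ^ (a - k) := by
    rw [← key, mul_sum]
    exact sum_congr rfl fun j _ => by ring
  simp only [fishburnTransfer, stateWeight, LinearMap.coe_mk, AddHom.coe_mk, h]
  rw [sum_range_succ']
  simp only [Nat.add_eq_zero_iff, one_ne_zero, and_false, if_false, if_true, mul_add, mul_sum]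
  have h2 : ∀ k ∈ range a, (1 : R) * (x ^ (k + 1) * y ^ b * (1 + y) ^ (a - (k + 1)))
      = y ^ b * (x * (x ^ k * (1 + y) ^ (a - 1 - k))) := fun k _ => by
    rw [show a - 1 - k = a - (k + 1) by omega]; ring
  rw [sum_congr rfl h2]
  simp
  ring

lemma smul_fishburnTransfer_stateWeight {x y : R} (h : x - (1 + y) = t * x) :
    t • fishburnTransfer z (stateWeight x y) = (z * t - 1) • stateWeight (1 + y) y +
      stateWeight x y + (t * x) • stateWeight x x := by
  funext a b
  have g := geom_sum₂_mul x (1 + y) a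
  rw [h] at g
  simp only [Pi.smul_apply, Pi.add_apply, smul_eq_mul, fishburnTransfer_stateWeight_apply,
    stateWeight]
  linear_combination y ^ b * g

lemma fishburnTransfer_stateWeight_diag (x : R) :
    fishburnTransfer z (stateWeight x x) = (z + x) • stateWeight (1 + x) x := by
  funext a b
  have g := geom_sum₂_mul x (1 + x) a
  simp only [Pi.smul_apply, smul_eq_mul, fishburnTransfer_stateWeight_apply, stateWeight]
  linear_combination (-x ^ b * x) * g

/-- The truncated generating function of the iterates of the transfer operator. -/
def transferGen : (ℕ → ℕ → R) →ₗ[R] R where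
  toFun φ := ∑ k ∈ range N, t ^ k * ((fishburnTransfer z ^ k) φ) 0 0
  map_add' φ ψ := by simp [mul_add, sum_add_distrib]
  map_smul' c φ := by
    simp only [map_smul, Pi.smul_apply, smul_eq_mul, RingHom.id_apply, mul_sum]
    exact sum_congr rfl fun j _ => by ring

variable {t N}

lemma transferGen_eq (ht : t ^ N = 0) (φ : ℕ → ℕ → R) :
    transferGen z t N φ = φ 0 0 + transferGen z t N (t • fishburnTransfer z φ) := by
  have h := sum_range_succ (fun k => t ^ k * ((fishburnTransfer z ^ k) φ) 0 0) N
  rw [sum_range_succ', ht, zero_mul, add_zero] at h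
  rw [map_smul]
  simp only [transferGen, LinearMap.coe_mk, AddHom.coe_mk, ← h, smul_eq_mul, mul_sum]
  rw [add_comm]
  simp only [pow_zero, one_mul, Module.End.one_apply, pow_succ, Module.End.mul_apply]
  congr 1
  exact sum_congr rfl fun j _ => by ring

lemma transferGen_stateWeight (ht : t ^ N = 0) {x y : R} (h : x - (1 + y) = t * x) :
    (1 - z * t) * transferGen z t N (stateWeight (1 + y) y) =
      1 + t * x * (1 + t * (z + x) * transferGen z t N (stateWeight (1 + x) x)) := by
  have h1 := transferGen_eq z ht (stateWeight x y)
  have h2 := transferGen_eq z ht (stateWeight x x)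
  rw [smul_fishburnTransfer_stateWeight z t h] at h1
  rw [fishburnTransfer_stateWeight_diag] at h2
  simp only [map_add, map_smul, smul_eq_mul] at h1 h2
  simp only [stateWeight, pow_zero, mul_one] at h1 h2 ⊢
  linear_combination h1 + t * x * h2

/-- The sum `∑ v ^ (n + 1) * (Q - p) * (Q - p ^ 2) * ⋯ * (Q - p ^ n)` over `n < N`, a truncated
Rogers–Fine series. -/
def fineSum (v p : R) (N : ℕ) (Q : R) : R :=
  ∑ n ∈ range N, v ^ (n + 1) * ∏ i ∈ range n, (Q - p ^ (i + 1))

lemma fineSum_step {p q v w Q : R} (hpq : q * p = 1) (hvw : v * w = 1)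
    (h0 : ∏ i ∈ range N, (Q - p ^ (i + 1)) = 0) :
    w * fineSum v p N Q =
      q * Q + (q * Q - 1) * (q * Q - w) * fineSum v p N (q * Q) := by
  have hqp (n : ℕ) : q ^ n * p ^ n = 1 := by rw [← mul_pow, hpq, one_pow]
  set A : ℕ → R := fun n => ∏ i ∈ range n, (Q - p ^ (i + 1)) with hA
  have hs (n : ℕ) : q ^ (n + 1) * A (n + 1) = A n * (q ^ (n + 1) * Q - 1) := by
    simp only [hA, prod_range_succ]
    linear_combination (-∏ i ∈ range n, (Q - p ^ (i + 1))) * hqp (n + 1)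
  have hB (n : ℕ) : (q * Q - 1) * ∏ i ∈ range n, (q * Q - p ^ (i + 1)) = q ^ (n + 1) * A (n + 1) := by
    induction n with
    | zero => simp [hA]; linear_combination hpq
    | succ n ih =>
      rw [prod_range_succ, ← mul_assoc, ih]
      simp only [hA, prod_range_succ _ (n + 1)]
      linear_combination (q ^ (n + 1) * (∏ i ∈ range (n + 1), (Q - p ^ (i + 1)))) * p ^ (n + 1) * hpq
  have key (M : ℕ) : w * ∑ n ∈ range M, v ^ (n + 1) * A n + v ^ M * q ^ (M + 1) * A (M + 1)
      + v ^ M * A M = q * Q +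
      (q * Q - w) * ∑ n ∈ range M, v ^ (n + 1) * (q ^ (n + 1) * A (n + 1)) := by
    induction M with
    | zero => simp [hA]; linear_combination -hpq
    | succ M ih =>
      rw [sum_range_succ, sum_range_succ]
      have := hs (M + 1)
      linear_combination ih + v ^ (M + 1) * this + v ^ M * (A M + q ^ (M + 1) * A (M + 1)) * hvw
  have hN : A N = 0 := h0
  have hN1 : A (N + 1) = 0 := by simp only [hA, prod_range_succ]; rw [h0, zero_mul]
  have k := key N
  rw [hN, hN1] at k
  simp only [← hB] at k
  simp only [fineSum]
  rw [mul_comm (q * Q - 1), mul_assoc, mul_sum (range N) _ (q * Q - 1)]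
  simp only [mul_left_comm (q * Q - 1)]
  linear_combination k

lemma sum_choose_mul_pow_mul (s : R) (hs : s ^ N = 0) (m : ℕ) :
    (1 - s) ^ (m + 1) * ∑ j ∈ range N, ((m + j).choose j : R) * s ^ j = 1 := by
  simp only [fun j => (Nat.choose_symm_add (a := m) (b := j)).symm]
  induction m with
  | zero => simpa [hs] using mul_neg_geom_sum s N
  | succ m ih =>
    have key (M : ℕ) : (1 - s) * ∑ j ∈ range M, ((m + 1 + j).choose (m + 1) : R) * s ^ j =
        ∑ j ∈ range M, ((m + j).choose m : R) * s ^ j - ((m + M).choose (m + 1) : R) * s ^ M := by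
      induction M with
      | zero => simp
      | succ M ih =>
        rw [sum_range_succ, sum_range_succ, mul_add, ih, show m + 1 + M = m + M + 1 by ring,
          Nat.choose_succ_succ, ← add_assoc, Nat.choose_succ_succ]
        push_cast
        ring
    rw [pow_succ, mul_assoc, key, hs, mul_zero, sub_zero, ih]

/-- The orbit of `0` under `x ↦ q * (1 + x)`. -/
def kernelOrbit (q : R) : ℕ → R
  | 0 => 0
  | k + 1 => q * (1 + kernelOrbit q k)

lemma one_add_mul_kernelOrbit {q : R} (hq : q * (1 - t) = 1) (k : ℕ) :
    1 + t * kernelOrbit q k = q ^ k := by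
  induction k with
  | zero => simp [kernelOrbit]
  | succ k ih =>
    rw [kernelOrbit]
    linear_combination q * ih - hq

lemma transferGen_eq_fineSum {q v : R} (ht : t ^ N = 0) (hq : q * (1 - t) = 1)
    (hv : v * (1 - z * t) = 1) :
    transferGen z t N (stateWeight 1 0) = fineSum v (1 - t) N 1 := by
  have hx := one_add_mul_kernelOrbit hq
  have hp : ∀ i : ℕ, t ∣ 1 - (1 - t) ^ (i + 1) := fun i => by
    simpa using sub_dvd_pow_sub_pow 1 (1 - t) (i + 1)
  have hprod (k : ℕ) : ∏ i ∈ range N, (q ^ k - (1 - t) ^ (i + 1)) = 0 := by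
    have : ∏ _i ∈ range N, t ∣ ∏ i ∈ range N, (q ^ k - (1 - t) ^ (i + 1)) := by
      refine prod_dvd_prod_of_dvd _ _ fun i _ => ?_
      rw [← hx k, add_sub_right_comm]
      exact dvd_add (hp i) (dvd_mul_right _ _)
    rwa [prod_const, card_range, ht, zero_dvd_iff] at this
  set e : ℕ → R := fun k =>
    transferGen z t N (stateWeight (1 + kernelOrbit q k) (kernelOrbit q k)) with he
  have hdiff (k : ℕ) : e k - fineSum v (1 - t) N (q ^ k) =
      v * (t * kernelOrbit q (k + 1) * (z + kernelOrbit q (k + 1))) * t *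
        (e (k + 1) - fineSum v (1 - t) N (q ^ (k + 1))) := by
    have h1 := transferGen_stateWeight z ht
      (x := kernelOrbit q (k + 1)) (y := kernelOrbit q k) (by
        rw [kernelOrbit]; linear_combination (1 + kernelOrbit q k) * hq)
    have h2 := fineSum_step hq hv (hprod k)
    have h3 := hx (k + 1)
    rw [← pow_succ', ← h3] at h2
    rw [← h3]
    change _ * e k = _ + _ * (1 + _ * e (k + 1)) at h1
    linear_combination v * h1 - v * h2 - (e k - fineSum v (1 - t) N (q ^ k)) * hv
  have hdvd (j k : ℕ) : t ^ j ∣ e k - fineSum v (1 - t) N (q ^ k) := by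
    induction j generalizing k with
    | zero => simp
    | succ j ih =>
      rw [hdiff, pow_succ', mul_assoc]
      exact Dvd.dvd.mul_left (mul_dvd_mul_left _ (ih _)) _
  have h0 := hdvd N 0
  rw [ht, zero_dvd_iff, sub_eq_zero] at h0
  simpa [he, kernelOrbit] using h0

lemma transferGen_eq_sum (ht : t ^ N = 0) :
    transferGen z t N (stateWeight 1 0) =
      ∑ m ∈ range N, (∑ j ∈ range N, ((m + j).choose j : R) * (z * t) ^ j) *
        ∏ i ∈ range m, (1 - (1 - t) ^ (i + 1)) := by
  have hs : (z * t) ^ N = 0 := by rw [mul_pow, ht, mul_zero]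
  have hq : (∑ i ∈ range N, t ^ i) * (1 - t) = 1 := by
    rw [geom_sum_mul_neg, ht, sub_zero]
  have hv : (∑ i ∈ range N, (z * t) ^ i) * (1 - z * t) = 1 := by
    rw [geom_sum_mul_neg, hs, sub_zero]
  rw [transferGen_eq_fineSum z ht hq hv, fineSum]
  refine sum_congr rfl fun m _ => ?_
  congr 1
  have h := sum_choose_mul_pow_mul (z * t) hs m
  set v := ∑ i ∈ range N, (z * t) ^ i
  have h2 : v ^ (m + 1) * (1 - z * t) ^ (m + 1) = 1 := by rw [← mul_pow, hv, one_pow]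
  exact left_inv_eq_right_inv h2 h
end Algebra

section Tables
open Finset

/-- Inversion tables of length `n` (0-based) with no decreasing subsequence of consecutive
integers. -/
def fishburnTables (n : ℕ) : Finset (Fin n → ℕ) :=
  (Fintype.piFinset fun i : Fin n => range (i + 1)).filter
    fun f => ∀ p q, p < q → f p ≠ f q + 1

lemma mem_fishburnTables {n : ℕ} {f : Fin n → ℕ} :
    f ∈ fishburnTables n ↔ (∀ i, f i ≤ i) ∧ ∀ p q, p < q → f p ≠ f q + 1 := by
  simp [fishburnTables]

/-- Replace every value of `f` that is at most `v` by `0`. -/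
def eraseLow {n : ℕ} (v : ℕ) (f : Fin n → ℕ) : Fin n → ℕ := fun i => if v < f i then f i else 0

/-- The positions at least `v` to which the partial table `g` assigns no value. -/
def openPositions {n : ℕ} (v : ℕ) (g : Fin n → ℕ) : Finset (Fin n) :=
  univ.filter fun i => v ≤ i ∧ g i = 0

/-- The open positions which may receive the value `v`. -/
def admissiblePositions {n : ℕ} (v : ℕ) (g : Fin n → ℕ) : Finset (Fin n) :=
  (openPositions v g).filter fun i => ∀ q, g q = v + 1 → i < q

lemma sum_powerset_nonempty_eq {R : Type*} [CommRing R] {n : ℕ} (A : Finset (Fin n))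
    (F : ℕ → ℕ → R) :
    ∑ S ∈ A.powerset, (if S = ∅ then 0 else
        F (#{i ∈ A | ∀ q ∈ S, i < q}) (#A - #S - #{i ∈ A | ∀ q ∈ S, i < q})) =
      ∑ k ∈ range #A, ∑ j ∈ range (#A - 1 - k + 1),
        ((#A - 1 - k).choose j : R) * F k (#A - 1 - k - j) := by
  induction A using Finset.induction_on_min generalizing F with
  | empty => simp
  | insert a s has ih =>
    have ha : a ∉ s := fun h => lt_irrefl _ (has a h)
    rw [sum_powerset_insert ha, card_insert_of_notMem ha, sum_range_succ']
    congr 1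
    · have h1 := ih fun k => F (k + 1)
      have h2 : ∀ k ∈ range #s, ∑ j ∈ range (#s + 1 - 1 - (k + 1) + 1),
          ((#s + 1 - 1 - (k + 1)).choose j : R) * F (k + 1) (#s + 1 - 1 - (k + 1) - j) =
          ∑ j ∈ range (#s - 1 - k + 1),
          ((#s - 1 - k).choose j : R) * F (k + 1) (#s - 1 - k - j) := fun k _ => by
        rw [show #s + 1 - 1 - (k + 1) = #s - 1 - k by omega]
      rw [sum_congr rfl h2, ← h1]
      refine sum_congr rfl fun S hS => ?_
      have hS := mem_powerset.1 hS
      split_ifs with h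
      · rfl
      · have : #{i ∈ insert a s | ∀ q ∈ S, i < q} = #{i ∈ s | ∀ q ∈ S, i < q} + 1 := by
          rw [filter_insert, if_pos fun q hq => has q (hS hq), card_insert_of_notMem (by simp [ha])]
        rw [this]
        congr 1
        omega
    · have h2 : ∀ S ∈ s.powerset, (if insert a S = ∅ then 0 else
          F (#{i ∈ insert a s | ∀ q ∈ insert a S, i < q})
            (#s + 1 - #(insert a S) - #{i ∈ insert a s | ∀ q ∈ insert a S, i < q})) =
          F 0 (#s - #S) := fun S hS => by
        have hS := mem_powerset.1 hS
        have h0 : #{i ∈ insert a s | ∀ q ∈ insert a S, i < q} = 0 := by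
          rw [card_eq_zero, filter_eq_empty_iff]
          intro i hi h
          have h3 := h a (mem_insert_self _ _)
          rcases mem_insert.1 hi with rfl | hi
          · exact lt_irrefl _ h3
          · exact lt_asymm h3 (has i hi)
        rw [if_neg (insert_ne_empty _ _), h0, card_insert_of_notMem fun h => ha (hS h)]
        congr 1
        omega
      rw [sum_congr rfl h2, sum_powerset_apply_card (fun j => F 0 (#s - j))]
      simp

/-- The table `g` with the value `v` assigned on `S`. -/
def assignValue {n : ℕ} (v : ℕ) (S : Finset (Fin n)) (g : Fin n → ℕ) : Fin n → ℕ :=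
  fun i => if i ∈ S then v else g i

/-- A partial table, with `0` meaning unassigned, whose values exceed `v` and contain no decreasing
subsequence of consecutive integers. -/
structure IsPartialTable {n : ℕ} (v : ℕ) (g : Fin n → ℕ) : Prop where
  le (i) : g i ≤ i
  lt_of_ne_zero (i) : g i ≠ 0 → v < g i
  ne_succ (p q) : p < q → g q ≠ 0 → g p ≠ g q + 1

variable {n v : ℕ} {g f : Fin n → ℕ} {S : Finset (Fin n)}

lemma mem_openPositions {i : Fin n} : i ∈ openPositions v g ↔ v ≤ i ∧ g i = 0 := by
  simp [openPositions]

lemma mem_admissiblePositions {i : Fin n} : i ∈ admissiblePositions v g ↔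
    (v ≤ i ∧ g i = 0) ∧ ∀ q, g q = v + 1 → i < q := by
  simp [admissiblePositions, mem_openPositions]

lemma admissiblePositions_subset : admissiblePositions v g ⊆ openPositions v g :=
  filter_subset _ _

lemma IsPartialTable.assignValue (hg : IsPartialTable (v + 1) g)
    (hS : S ⊆ admissiblePositions (v + 1) g) : IsPartialTable v (assignValue (v + 1) S g) where
  le i := by
    unfold _root_.assignValue
    split_ifs with h
    · exact (mem_admissiblePositions.1 (hS h)).1.1
    · exact hg.le i
  lt_of_ne_zero i := by
    unfold _root_.assignValue
    split_ifs with h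
    · omega
    · intro h
      have := hg.lt_of_ne_zero i h
      omega
  ne_succ p q hpq := by
    unfold _root_.assignValue
    have h1 := hg.lt_of_ne_zero p
    have h2 := hg.lt_of_ne_zero q
    split_ifs with hq hp hp
    · omega
    · intro _ h
      exact lt_asymm hpq ((mem_admissiblePositions.1 (hS hq)).2 p h)
    · omega
    · exact hg.ne_succ p q hpq

lemma eraseLow_eq_assignValue (hg : IsPartialTable (v + 1) g)
    (hS : S ⊆ admissiblePositions (v + 1) g) :
    (eraseLow (v + 1) f = g ∧ univ.filter (fun i => f i = v + 1) = S) ↔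
      eraseLow v f = assignValue (v + 1) S g := by
  have hS0 (i) (hi : i ∈ S) : g i = 0 := (mem_admissiblePositions.1 (hS hi)).1.2
  constructor
  · rintro ⟨rfl, rfl⟩
    funext i
    simp only [eraseLow, assignValue, mem_filter, mem_univ, true_and]
    split_ifs <;> omega
  · intro h
    have h1 (i) := congrFun h i
    simp only [eraseLow, assignValue] at h1
    have h2 := hg.lt_of_ne_zero
    refine ⟨funext fun i => ?_, ext fun i => ?_⟩
    · have := h1 i
      have := h2 i
      have := hS0 i
      simp only [eraseLow]
      split_ifs at * <;> grind
    · have := h1 i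
      have := h2 i
      have := hS0 i
      simp only [mem_filter, mem_univ, true_and]
      split_ifs at * <;> grind

lemma valuePositions_subset_admissiblePositions (hf : f ∈ fishburnTables n)
    (h : eraseLow v f = g) : univ.filter (fun i => f i = v) ⊆ admissiblePositions v g := by
  subst h
  obtain ⟨h1, h2⟩ := mem_fishburnTables.1 hf
  intro i hi
  have hi : f i = v := by simpa using hi
  refine mem_admissiblePositions.2 ⟨⟨hi ▸ h1 i, by simp [eraseLow, hi]⟩, fun q hq => ?_⟩
  have hq : f q = v + 1 := by
    unfold eraseLow at hq
    split_ifs at hq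
    · exact hq
  by_contra hlt
  rcases (not_lt.1 hlt).lt_or_eq with h | h
  · exact h2 q i h (by omega)
  · subst h; omega

lemma openPositions_assignValue (hv : v + 1 < n) (hg : IsPartialTable (v + 1) g)
    (hS : S ⊆ admissiblePositions (v + 1) g) :
    openPositions v (assignValue (v + 1) S g) =
      insert ⟨v, by omega⟩ (openPositions (v + 1) g \ S) := by
  ext i
  simp only [mem_openPositions, mem_insert, mem_sdiff, assignValue]
  have h1 := hg.le i
  have h2 := hg.lt_of_ne_zero i
  have h3 : i ∈ S → v + 1 ≤ i := fun h => (mem_admissiblePositions.1 (hS h)).1.1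
  have h4 : i = ⟨v, by omega⟩ ↔ (i : ℕ) = v := Fin.ext_iff
  rw [h4]
  clear h4
  split_ifs with h <;> grind

lemma card_openPositions_assignValue (hv : v + 1 < n) (hg : IsPartialTable (v + 1) g)
    (hS : S ⊆ admissiblePositions (v + 1) g) :
    #(openPositions v (assignValue (v + 1) S g)) = #(openPositions (v + 1) g) - #S + 1 := by
  rw [openPositions_assignValue hv hg hS, card_insert_of_notMem (by simp [mem_openPositions]),
    card_sdiff_of_subset (hS.trans admissiblePositions_subset)]

lemma assignValue_eq_iff (hg : IsPartialTable (v + 1) g) (q : Fin n) :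
    assignValue (v + 1) S g q = v + 1 ↔ q ∈ S := by
  unfold assignValue
  have := hg.lt_of_ne_zero q
  split_ifs with h
  · simp [h]
  · simp only [h, iff_false]
    omega

lemma card_admissiblePositions_assignValue (hv : v + 1 < n) (hg : IsPartialTable (v + 1) g)
    (hS : S ⊆ admissiblePositions (v + 1) g) :
    #(admissiblePositions v (assignValue (v + 1) S g)) =
      #{i ∈ openPositions (v + 1) g | ∀ q ∈ S, i < q} + 1 := by
  have h1 : ∀ q ∈ S, (⟨v, by omega⟩ : Fin n) < q := fun q hq => by
    have := (mem_admissiblePositions.1 (hS hq)).1.1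
    exact Fin.lt_def.2 (by simpa using this)
  rw [admissiblePositions, openPositions_assignValue hv hg hS]
  simp only [assignValue_eq_iff hg]
  rw [filter_insert, if_pos h1, card_insert_of_notMem (by simp [mem_openPositions])]
  congr 2
  ext i
  simp only [mem_filter, mem_sdiff]
  exact ⟨fun h => ⟨h.1.1, h.2⟩, fun h => ⟨⟨h.1, fun hi => lt_irrefl _ (h.2 i hi)⟩, h.2⟩⟩

lemma filter_openPositions_eq (hS : S ⊆ admissiblePositions v g) (hne : S.Nonempty) :
    {i ∈ openPositions v g | ∀ q ∈ S, i < q} =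
      {i ∈ admissiblePositions v g | ∀ q ∈ S, i < q} := by
  obtain ⟨s, hs⟩ := hne
  ext i
  simp only [mem_filter, mem_admissiblePositions, mem_openPositions]
  exact ⟨fun h => ⟨⟨h.1, fun q hq => (h.2 s hs).trans ((mem_admissiblePositions.1 (hS hs)).2 q hq)⟩,
    h.2⟩, fun h => ⟨h.1.1, h.2⟩⟩

lemma mem_admissiblePositions_self (hv : v < n) (hg : IsPartialTable v g) :
    (⟨v, hv⟩ : Fin n) ∈ admissiblePositions v g := by
  refine mem_admissiblePositions.2 ⟨⟨le_rfl, ?_⟩, fun q hq => ?_⟩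
  · by_contra h
    exact absurd (hg.lt_of_ne_zero _ h) (not_lt.2 (hg.le _))
  · have := hg.le q
    exact Fin.lt_def.2 (by simp only; omega)

lemma card_filter_lt_eq_zero_iff (hv : v < n) (hg : IsPartialTable v g)
    (hS : S ⊆ admissiblePositions v g) :
    #{i ∈ admissiblePositions v g | ∀ q ∈ S, i < q} = 0 ↔ ⟨v, hv⟩ ∈ S := by
  have hle (i) (hi : i ∈ admissiblePositions v g) : ⟨v, hv⟩ ≤ i :=
    Fin.le_def.2 (mem_admissiblePositions.1 hi).1.1
  rw [card_eq_zero, filter_eq_empty_iff]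
  constructor
  · intro h
    by_contra hn
    refine h (mem_admissiblePositions_self hv hg) fun q hq => (hle q (hS hq)).lt_of_ne ?_
    rintro rfl
    exact hn hq
  · intro h i hi hlt
    exact absurd (hlt _ h) (not_lt.2 (hle i hi))

lemma card_fixed_assignValue (hv : v + 1 < n)
    (hS : S ⊆ admissiblePositions (v + 1) g) :
    #{i : Fin n | 0 < (i : ℕ) ∧ assignValue (v + 1) S g i = i} =
      #{i : Fin n | 0 < (i : ℕ) ∧ g i = i} + if ⟨v + 1, hv⟩ ∈ S then 1 else 0 := by
  have hS0 (i) (hi : i ∈ S) : g i = 0 := (mem_admissiblePositions.1 (hS hi)).1.2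
  have hext (i : Fin n) : (0 < (i : ℕ) ∧ assignValue (v + 1) S g i = i) ↔
      (i = ⟨v + 1, hv⟩ ∧ i ∈ S) ∨ (0 < (i : ℕ) ∧ g i = i) := by
    have := hS0 i
    rw [Fin.ext_iff]
    unfold assignValue
    split_ifs with h <;> simp only [h, true_implies, and_true, and_false, false_or] at * 
    omega
  simp only [hext]
  split_ifs with h
  · have : univ.filter (fun i : Fin n => (i = ⟨v + 1, hv⟩ ∧ i ∈ S) ∨ (0 < (i : ℕ) ∧ g i = i)) =
        insert ⟨v + 1, hv⟩ (univ.filter fun i : Fin n => 0 < (i : ℕ) ∧ g i = i) := by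
      ext i
      simp only [mem_filter, mem_univ, true_and, mem_insert]
      grind
    rw [this, card_insert_of_notMem]
    have := hS0 _ h
    simp [this]
  · rw [add_zero]
    congr 1
    ext i
    simp only [mem_filter, mem_univ, true_and]
    grind

lemma filter_eraseLow_zero (hg : IsPartialTable 0 g) :
    (fishburnTables n).filter (fun f => eraseLow 0 f = g) =
      if openPositions 0 g ⊆ admissiblePositions 0 g then {g} else ∅ := by
  have h0 (f : Fin n → ℕ) : eraseLow 0 f = f := funext fun i => by
    unfold eraseLow; split_ifs <;> omega
  simp only [h0]
  have hiff : g ∈ fishburnTables n ↔ openPositions 0 g ⊆ admissiblePositions 0 g := by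
    rw [mem_fishburnTables]
    constructor
    · intro h i hi
      have hi := mem_openPositions.1 hi
      refine mem_admissiblePositions.2 ⟨hi, fun q hq => ?_⟩
      by_contra hlt
      rcases (not_lt.1 hlt).lt_or_eq with h' | h'
      · exact h.2 q i h' (by omega)
      · subst h'; omega
    · refine fun h => ⟨hg.le, fun p q hpq => ?_⟩
      by_cases hq : g q = 0
      · intro hp
        have := (mem_admissiblePositions.1 (h (mem_openPositions.2 ⟨Nat.zero_le _, hq⟩))).2 p
          (by omega)
        exact lt_asymm hpq this
      · exact hg.ne_succ p q hpq hq
  simp only [← hiff]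
  ext f
  split_ifs with h <;> simp only [mem_filter, mem_singleton, notMem_empty, iff_false] <;> grind

/-- The tables extending a given assignment of the values larger than `v` are counted by the
`v`-th iterate of the transfer operator. -/
theorem sum_filter_eraseLow {R : Type*} [CommRing R] (z : R) (hv : v < n)
    (hg : IsPartialTable v g) :
    ∑ f ∈ (fishburnTables n).filter (fun f => eraseLow v f = g), z ^ #{i : Fin n | f i = i} =
      z ^ #{i : Fin n | 0 < (i : ℕ) ∧ g i = i} *
        ((fishburnTransfer z ^ v) (z • stateWeight 1 0)) (#(admissiblePositions v g) - 1)
          (#(openPositions v g) - #(admissiblePositions v g)) := by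
  induction v generalizing g with
  | zero =>
    have hsub := admissiblePositions_subset (v := 0) (g := g)
    have hle := card_le_card hsub
    rw [filter_eraseLow_zero hg]
    simp only [pow_zero, Module.End.one_apply, Pi.smul_apply, smul_eq_mul, stateWeight, one_pow,
      one_mul]
    split_ifs with h
    · rw [hsub.antisymm h, Nat.sub_self, pow_zero, mul_one, sum_singleton, ← pow_succ]
      congr 1
      have h0 : g ⟨0, hv⟩ = 0 := Nat.le_zero.1 (hg.le _)
      have : univ.filter (fun i : Fin n => g i = i) =
          insert ⟨0, hv⟩ (univ.filter fun i : Fin n => 0 < (i : ℕ) ∧ g i = i) := by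
        ext i
        simp only [mem_filter, mem_univ, true_and, mem_insert]
        have h4 : i = ⟨0, hv⟩ ↔ (i : ℕ) = 0 := Fin.ext_iff
        by_cases hi : i = ⟨0, hv⟩
        · subst hi; simp [h0]
        · have := mt h4.2 hi
          simp only [hi, false_or]
          omega
      rw [this, card_insert_of_notMem (by simp)]
    · have : #(openPositions 0 g) - #(admissiblePositions 0 g) ≠ 0 := fun h' =>
        h (eq_of_subset_of_card_le hsub (by omega)).ge
      simp [this]
  | succ v ih =>
    set A := admissiblePositions (v + 1) g with hA
    set H := openPositions (v + 1) g with hH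
    set ψ := (fishburnTransfer z ^ v) (z • stateWeight 1 0) with hψ
    have hAH : #A ≤ #H := card_le_card admissiblePositions_subset
    have hApos : 0 < #A := card_pos.2 ⟨_, mem_admissiblePositions_self hv hg⟩
    rw [← sum_fiberwise_of_maps_to (t := A.powerset)
      (g := fun f => univ.filter fun i => f i = v + 1) fun f hf => by
        rw [mem_filter] at hf
        exact mem_powerset.2 (valuePositions_subset_admissiblePositions hf.1 hf.2)]
    have hterm : ∀ S ∈ A.powerset,
        (∑ f ∈ ((fishburnTables n).filter fun f => eraseLow (v + 1) f = g) with
            univ.filter (fun i => f i = v + 1) = S, z ^ #{i : Fin n | f i = i}) =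
          z ^ #{i : Fin n | 0 < (i : ℕ) ∧ g i = i} * ((if S = ∅ then ψ #H 0 else 0) +
            if S = ∅ then 0 else
              (fun k r => (if k = 0 then z else 1) * ψ k (#H - #A + r))
                (#{i ∈ A | ∀ q ∈ S, i < q}) (#A - #S - #{i ∈ A | ∀ q ∈ S, i < q})) := by
      intro S hS
      have hS := mem_powerset.1 hS
      rw [filter_filter]
      simp only [eraseLow_eq_assignValue hg hS]
      rw [ih (by omega) (hg.assignValue hS), card_fixed_assignValue hv hS,
        card_openPositions_assignValue hv hg hS, card_admissiblePositions_assignValue hv hg hS,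
        pow_add, mul_assoc]
      congr 1
      rcases S.eq_empty_or_nonempty with rfl | hne
      · simp [hH, hψ]
      · have hz := card_filter_lt_eq_zero_iff hv hg hS
        rw [filter_openPositions_eq hS hne, if_neg hne.ne_empty, if_neg hne.ne_empty, zero_add]
        simp only [← hA, ← hH] at hz ⊢
        have hSA := card_le_card hS
        have hdisj : #{i ∈ A | ∀ q ∈ S, i < q} + #S ≤ #A := by
          rw [← card_union_of_disjoint]
          · exact card_le_card (union_subset (filter_subset _ _) hS)
          · rw [disjoint_left]
            intro i hi hiS
            exact lt_irrefl _ ((mem_filter.1 hi).2 i hiS)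
        simp only [hz]
        congr 1
        · split_ifs <;> simp
        · congr 1; omega
    rw [sum_congr rfl hterm, ← mul_sum, sum_add_distrib, sum_powerset_nonempty_eq A
        (fun k r => (if k = 0 then z else 1) * ψ k (#H - #A + r)), pow_succ',
      Module.End.mul_apply]
    congr 1
    simp only [fishburnTransfer, LinearMap.coe_mk, AddHom.coe_mk]
    rw [sum_ite_eq' , if_pos (empty_mem_powerset A), show #A - 1 + 1 = #A by omega,
      show #A - 1 + (#H - #A) + 1 = #H by omega]
    congr 1
    refine sum_congr rfl fun k _ => ?_
    rw [mul_sum]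
    exact sum_congr rfl fun j _ => mul_left_comm _ _ _

theorem sum_fishburnTables_succ {R : Type*} [CommRing R] (z : R) (n : ℕ) :
    ∑ f ∈ fishburnTables (n + 1), z ^ #{i : Fin (n + 1) | f i = i} =
      z * ((fishburnTransfer z ^ n) (stateWeight 1 0)) 0 0 := by
  have hg : IsPartialTable n (0 : Fin (n + 1) → ℕ) := ⟨by simp, by simp, by simp⟩
  have h := sum_filter_eraseLow z (Nat.lt_succ_self n) hg
  have hO : openPositions n (0 : Fin (n + 1) → ℕ) = {Fin.last n} := by
    ext i
    simp only [mem_openPositions, mem_singleton, Fin.ext_iff, Fin.val_last, Pi.zero_apply, and_true]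
    have := i.2
    omega
  have hA : admissiblePositions n (0 : Fin (n + 1) → ℕ) = {Fin.last n} := by
    rw [admissiblePositions, hO, filter_true_of_mem (by simp)]
  have hT : (fishburnTables (n + 1)).filter (fun f => eraseLow n f = 0) = fishburnTables (n + 1) :=
    filter_true_of_mem fun f hf => funext fun i => by
      have := (mem_fishburnTables.1 hf).1 i
      have := i.2
      simp only [eraseLow, Pi.zero_apply]
      split_ifs <;> omega
  have hF : univ.filter (fun i : Fin (n + 1) => 0 < (i : ℕ) ∧ (0 : Fin (n + 1) → ℕ) i = i) = ∅ :=
    filter_eq_empty_iff.2 fun i _ => by simp only [Pi.zero_apply]; omega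
  rw [hT, hO, hA, hF] at h
  simpa using h

end Tables

section Coefficient
open Finset

lemma sum_fishburnTables_eq {R : Type*} [CommRing R] (z t : R) {N : ℕ} (ht : t ^ N = 0) :
    ∑ k ∈ range N, t ^ (k + 1) * ∑ f ∈ fishburnTables (k + 1), z ^ #{i : Fin (k + 1) | f i = i} =
      ∑ m ∈ range N, z * t * (∑ j ∈ range N, ((m + j).choose j : R) * (z * t) ^ j) *
        ∏ i ∈ range m, (1 - (1 - t) ^ (i + 1)) := by
  have h := transferGen_eq_sum z ht
  simp only [sum_fishburnTables_succ, mul_assoc (z * t), ← mul_sum, ← h, transferGen,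
    LinearMap.coe_mk, AddHom.coe_mk]
  rw [mul_sum]
  exact sum_congr rfl fun k _ => by ring

lemma refinedPoly'_eq (n : ℕ) : refinedPoly' n = 1 + ∑ m ∈ range n, zVar * tVar *
    (∑ j ∈ range (n + 1), ((m + j).choose j : MvPolynomial (Fin 2) ℤ) * (zVar * tVar) ^ j) *
      ∏ i ∈ range m, (1 - (1 - tVar) ^ (i + 1)) := by
  have hIcc (m : ℕ) : Icc 1 m = (range m).map (addRightEmbedding 1) := by
    rw [range_eq_Ico, map_add_right_Ico, zero_add]
    ext; simp only [mem_Icc, mem_Ico]; omega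
  rw [refinedPoly', hIcc n, sum_map]
  simp [hIcc]

lemma tVar_pow_dvd (n : ℕ) : tVar ^ (n + 1) ∣ refinedPoly' n -
    (1 + ∑ k ∈ range (n + 1), tVar ^ (k + 1) *
      ∑ f ∈ fishburnTables (k + 1), zVar ^ #{i : Fin (k + 1) | f i = i}) := by
  rw [← Ideal.mem_span_singleton, ← Ideal.Quotient.mk_eq_mk_iff_sub_mem, refinedPoly'_eq]
  set π := Ideal.Quotient.mk (Ideal.span {tVar ^ (n + 1)})
  have ht : π tVar ^ (n + 1) = 0 := by
    rw [← map_pow]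
    exact Ideal.Quotient.eq_zero_iff_mem.2 (Ideal.mem_span_singleton_self _)
  have h := sum_fishburnTables_eq (π zVar) (π tVar) ht
  have hlast : π zVar * π tVar * (∑ j ∈ range (n + 1),
      ((n + j).choose j : _ ⧸ Ideal.span {tVar ^ (n + 1)}) * (π zVar * π tVar) ^ j) *
        ∏ i ∈ range n, (1 - (1 - π tVar) ^ (i + 1)) = 0 := by
    have hd : ∏ _i ∈ range n, π tVar ∣ ∏ i ∈ range n, (1 - (1 - π tVar) ^ (i + 1)) :=
      prod_dvd_prod_of_dvd _ _ fun i _ => by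
        simpa using sub_dvd_pow_sub_pow 1 (1 - π tVar) (i + 1)
    rw [prod_const, card_range] at hd
    obtain ⟨c, hc⟩ := hd
    rw [hc]
    linear_combination (π zVar * (∑ j ∈ range (n + 1),
      ((n + j).choose j : _ ⧸ Ideal.span {tVar ^ (n + 1)}) * (π zVar * π tVar) ^ j) * c) * ht
  rw [sum_range_succ (fun m => π zVar * π tVar * _ * _), hlast, add_zero] at h
  simp only [map_add, map_one, map_sum, map_mul, map_pow, map_prod, map_sub, map_natCast, h]

lemma coeff_tVar_pow_mul_zVar_pow (k e d n : ℕ) :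
    (tVar ^ k * zVar ^ e).coeff (Finsupp.single 0 d + Finsupp.single 1 n) =
      if k = n ∧ e = d then 1 else 0 := by
  rw [tVar, zVar, MvPolynomial.X_pow_eq_monomial, MvPolynomial.X_pow_eq_monomial,
    MvPolynomial.monomial_mul, MvPolynomial.coeff_monomial, one_mul]
  congr 1
  rw [Finsupp.ext_iff]
  simp [Fin.forall_fin_two, and_comm]

end Coefficient

/-- For `n ≥ 1` and `1 ≤ d ≤ n`, `|T_{n,d}|` equals the coefficient of `z^d t^n` in
`1 + Σ_{m=1}^{n} [ zt · (Σ_{j=0}^{n} C(m-1+j,j)(zt)^j) · ∏_{i=1}^{m-1} (1 - (1-t)^i) ]`.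
Here `T_{n,d}` is the set of inversion tables of length `n` (0-based: `a i ≤ i`) with
no decreasing subsequence of consecutive integers, with `a_i = i - 1` (0-based:
`a i = i`) for exactly `d` values of `i`. -/
theorem Tnd_card_eq_refined_coeff' (n d : ℕ) (hn : 1 ≤ n) (hd : 1 ≤ d) (hdn : d ≤ n) :
    ({a : Fin n → ℕ | (∀ i, a i ≤ i.1) ∧
        (¬ ∃ p q : Fin n, p < q ∧ a p = a q + 1) ∧
        (Finset.univ.filter (fun i : Fin n => a i = i.1)).card = d}.ncard : ℤ) =
      (refinedPoly' n).coeff (Finsupp.single 0 d + Finsupp.single 1 n) := by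
  have hset : {a : Fin n → ℕ | (∀ i, a i ≤ i.1) ∧
      (¬ ∃ p q : Fin n, p < q ∧ a p = a q + 1) ∧
      (Finset.univ.filter (fun i : Fin n => a i = i.1)).card = d} =
      ((fishburnTables n).filter fun f =>
        (Finset.univ.filter (fun i : Fin n => f i = i.1)).card = d : Finset (Fin n → ℕ)) := by
    ext f
    simp [mem_fishburnTables, and_assoc]
  rw [hset, Set.ncard_coe_finset]
  obtain ⟨c, hc⟩ := tVar_pow_dvd n
  rw [sub_eq_iff_eq_add] at hc
  have hc0 : (tVar ^ (n + 1) * c).coeff (Finsupp.single 0 d + Finsupp.single 1 n) = 0 := by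
    rw [tVar, MvPolynomial.X_pow_eq_monomial, MvPolynomial.coeff_monomial_mul', if_neg]
    intro h
    simpa using h 1
  have h1 : (1 : MvPolynomial (Fin 2) ℤ).coeff (Finsupp.single 0 d + Finsupp.single 1 n) = 0 := by
    have := coeff_tVar_pow_mul_zVar_pow 0 0 d n
    rwa [pow_zero, pow_zero, one_mul, if_neg (by omega)] at this
  rw [hc, MvPolynomial.coeff_add, MvPolynomial.coeff_add, hc0, h1, zero_add, zero_add,
    MvPolynomial.coeff_sum]
  simp only [Finset.mul_sum, MvPolynomial.coeff_sum, coeff_tVar_pow_mul_zVar_pow]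
  obtain ⟨n, rfl⟩ := Nat.exists_eq_succ_of_ne_zero (Nat.one_le_iff_ne_zero.1 hn)
  rw [Finset.sum_eq_single_of_mem n (Finset.mem_range.2 (by omega)) fun k _ hk =>
    Finset.sum_eq_zero fun f _ => if_neg fun h => hk (by omega)]
  simp [Finset.sum_boole]
end

section
/- For all n, d ≥ 1, the coefficient of z^d t^n in the integer polynomial 1 + Σ_{m=1}^{n} ∏_{i=1}^{m} (1 - (1-t)^{i-1}(1-zt)) equals the coefficient of z^d t^n in the integer polynomial 1 + Σ_{m=1}^{n} [ (zt) · (Σ_{j=0}^{n} C(m-1+j, j) (zt)^j) · ∏_{i=1}^{m-1} (1 - (1-t)^i) ]. (This is the conjectured equality of Remmel and Kitaev's two refinements of the Fishburn generating function.) -/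
theorem dvd_one_sub_one_sub_pow {R : Type*} [CommRing R] (t : R) (i : ℕ) :
    t ∣ 1 - (1 - t) ^ i := by
  simpa using sub_dvd_pow_sub_pow (1 : R) (1 - t) i

open Finset in
/-- The functional equation of `F(x) = ∑ (x; q)_m`, truncated. -/
theorem sum_qPochhammer_eq {R : Type*} [CommRing R] {N : ℕ} {x q : R}
    (h : ∏ i ∈ range N, (1 - x * q ^ i) = 0) :
    ∑ m ∈ range N, ∏ i ∈ range m, (1 - x * q ^ i) =
      1 + (1 - x) * ∑ m ∈ range N, ∏ i ∈ range m, (1 - x * q * q ^ i) := by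
  have hs := sum_range_succ (fun m ↦ ∏ i ∈ range m, (1 - x * q ^ i)) N
  rw [h, add_zero] at hs
  rw [← hs, sum_range_succ', mul_sum, add_comm, prod_range_zero]
  congr 1
  refine sum_congr rfl fun m _ ↦ ?_
  rw [prod_range_succ', mul_comm]
  simp only [pow_zero, mul_one, pow_succ']
  simp only [mul_assoc]

open Finset in
/-- The functional equation of `H(x) = ∑ (q; q)_m / x ^ (m + 1)`, truncated; here `u = 1 / x`
and `p = 1 / q`. -/
theorem sum_inv_pow_mul_qFactorial_eq {R : Type*} [CommRing R] {N : ℕ} {x u q p : R}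
    (hxu : x * u = 1) (hqp : q * p = 1)
    (h : ∏ i ∈ range N, (1 - q ^ (i + 1)) = 0) :
    ∑ m ∈ range N, u ^ (m + 1) * ∏ i ∈ range m, (1 - q ^ (i + 1)) =
      1 + (1 - x * q) *
        ∑ m ∈ range N, (u * p) ^ (m + 1) * ∏ i ∈ range m, (1 - q ^ (i + 1)) := by
  have hs := sum_range_succ (fun m ↦ (u * p) ^ m * ∏ i ∈ range m, (1 - q ^ (i + 1))) N
  rw [h, mul_zero, add_zero, sum_range_succ', prod_range_zero, pow_zero, mul_one] at hs
  have hy : x * q * ∑ m ∈ range N, (u * p) ^ (m + 1) * ∏ i ∈ range m, (1 - q ^ (i + 1)) =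
      ∑ m ∈ range N, (u * p) ^ m * ∏ i ∈ range m, (1 - q ^ (i + 1)) := by
    rw [mul_sum]
    refine sum_congr rfl fun m _ ↦ ?_
    have : x * q * (u * p) = 1 := by linear_combination (q * p) * hxu + hqp
    rw [pow_succ]
    linear_combination ((u * p) ^ m * ∏ i ∈ range m, (1 - q ^ (i + 1))) * this
  have hd : ∑ m ∈ range N, u ^ (m + 1) * ∏ i ∈ range m, (1 - q ^ (i + 1)) =
      ∑ m ∈ range N, (u * p) ^ (m + 1) * ∏ i ∈ range m, (1 - q ^ (i + 1)) -
      ∑ m ∈ range N, (u * p) ^ (m + 1) * ∏ i ∈ range (m + 1), (1 - q ^ (i + 1)) := by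
    rw [← sum_sub_distrib]
    refine sum_congr rfl fun m _ ↦ ?_
    have : (u * p) ^ (m + 1) * q ^ (m + 1) = u ^ (m + 1) := by
      rw [← mul_pow, mul_assoc, mul_comm p, hqp, mul_one]
    rw [prod_range_succ]
    linear_combination -(∏ i ∈ range m, (1 - q ^ (i + 1))) * this
  rw [hd, sub_mul, one_mul, hy, ← hs]
  ring

open Finset in
theorem prod_range_eq_zero_of_dvd {R : Type*} [CommRing R] {N : ℕ} {t : R} (ht : t ^ N = 0)
    {f : ℕ → R} (hf : ∀ i, t ∣ f i) : ∏ i ∈ range N, f i = 0 := by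
  have := prod_dvd_prod_of_dvd (s := range N) (fun _ ↦ t) f fun i _ ↦ hf i
  rwa [prod_const, card_range, ht, zero_dvd_iff] at this

open Finset in
theorem sum_qPochhammer_eq_sum_inv_pow {R : Type*} [CommRing R] {N : ℕ} {t p x u : R}
    (ht : t ^ N = 0) (hqp : (1 - t) * p = 1) (hxu : x * u = 1) (hx : t ∣ 1 - x) :
    ∑ m ∈ range N, ∏ i ∈ range m, (1 - x * (1 - t) ^ i) =
      1 + (1 - x) * ∑ m ∈ range N, u ^ (m + 1) * ∏ i ∈ range m, (1 - (1 - t) ^ (i + 1)) := by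
  suffices H : ∀ (k : ℕ) (x u : R), x * u = 1 → t ∣ 1 - x →
      t ^ k ∣ ∑ m ∈ range N, ∏ i ∈ range m, (1 - x * (1 - t) ^ i) -
        (1 + (1 - x) *
          ∑ m ∈ range N, u ^ (m + 1) * ∏ i ∈ range m, (1 - (1 - t) ^ (i + 1))) by
    have := H N x u hxu hx
    rwa [ht, zero_dvd_iff, sub_eq_zero] at this
  intro k
  induction k with
  | zero => simp
  | succ k ih =>
    intro x u hxu hx
    have hxq : x * (1 - t) * (u * p) = 1 := by
      linear_combination ((1 - t) * p) * hxu + hqp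
    have hdvd (i : ℕ) : t ∣ 1 - x * (1 - t) ^ i := by
      have := dvd_add hx ((dvd_one_sub_one_sub_pow t i).mul_left x)
      convert this using 1
      ring
    rw [sum_qPochhammer_eq (prod_range_eq_zero_of_dvd ht hdvd),
      sum_inv_pow_mul_qFactorial_eq hxu hqp
        (prod_range_eq_zero_of_dvd ht fun i ↦ dvd_one_sub_one_sub_pow t (i + 1)),
      add_sub_add_left_eq_sub, ← mul_sub, pow_succ']
    exact mul_dvd_mul hx (ih _ _ hxq (by simpa using hdvd 1))

open Finset in
theorem one_sub_mul_sum_choose_mul_pow {R : Type*} [CommRing R] (s : R) (m N : ℕ) :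
    (1 - s) * ∑ j ∈ range N, ((m + 1 + j).choose (m + 1) : R) * s ^ j =
      ∑ j ∈ range N, ((m + j).choose m : R) * s ^ j - ((m + N).choose (m + 1) : R) * s ^ N := by
  induction N with
  | zero => simp
  | succ N ih =>
    have h : ((m + (N + 1)).choose (m + 1) : R) =
        (m + N).choose m + (m + N).choose (m + 1) := by
      rw [← add_assoc, Nat.choose_succ_succ, Nat.cast_add]
    rw [sum_range_succ, sum_range_succ, mul_add, ih, show m + 1 + N = m + (N + 1) by ring, h]
    ring

open Finset in
theorem sum_choose_mul_pow_eq_inv_pow {R : Type*} [CommRing R] {N : ℕ} {s u : R}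
    (hs : s ^ N = 0) (hu : (1 - s) * u = 1) (m : ℕ) :
    ∑ j ∈ range N, ((m + j).choose m : R) * s ^ j = u ^ (m + 1) := by
  induction m with
  | zero =>
    have h := mul_neg_geom_sum s N
    rw [hs, sub_zero] at h
    simp only [Nat.choose_zero_right, Nat.cast_one, one_mul, zero_add, pow_one]
    linear_combination u * h - (∑ i ∈ range N, s ^ i) * hu
  | succ m ih =>
    have h := one_sub_mul_sum_choose_mul_pow s m N
    rw [hs, mul_zero, sub_zero, ih] at h
    rw [pow_succ]
    linear_combination
      u * h - (∑ j ∈ range N, ((m + 1 + j).choose (m + 1) : R) * s ^ j) * hu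

open Finset in
/-- The two truncated refinements agree in any commutative ring where `t ^ (n + 1) = 0`. -/
theorem refinements_eq_of_pow_eq_zero {R : Type*} [CommRing R] {n : ℕ} {z t : R}
    (ht : t ^ (n + 1) = 0) :
    1 + ∑ m ∈ Icc 1 n, ∏ i ∈ Icc 1 m, (1 - (1 - t) ^ (i - 1) * (1 - z * t)) =
      1 + ∑ m ∈ Icc 1 n, (z * t * (∑ j ∈ range (n + 1),
        (((m - 1 + j).choose j : ℤ) : R) * (z * t) ^ j) *
          ∏ i ∈ Icc 1 (m - 1), (1 - (1 - t) ^ i)) := by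
  have hzt : (z * t) ^ (n + 1) = 0 := by rw [mul_pow, ht, mul_zero]
  obtain ⟨p, hp⟩ := (IsNilpotent.isUnit_one_sub ⟨_, ht⟩).exists_right_inv
  obtain ⟨u, hu⟩ := (IsNilpotent.isUnit_one_sub ⟨_, hzt⟩).exists_right_inv
  have key := sum_qPochhammer_eq_sum_inv_pow ht hp hu
    (by rw [sub_sub_cancel]; exact dvd_mul_left t z)
  have hIcc (f : ℕ → R) (k : ℕ) : ∑ m ∈ Icc 1 k, f m = ∑ m ∈ range k, f (m + 1) := by
    rw [range_eq_Ico, sum_Ico_add' f 0 k 1]; rfl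
  have hIcc' (f : ℕ → R) (k : ℕ) : ∏ m ∈ Icc 1 k, f m = ∏ m ∈ range k, f (m + 1) := by
    rw [range_eq_Ico, prod_Ico_add' f 0 k 1]; rfl
  have hlast : z * t * (u ^ (n + 1) * ∏ i ∈ range n, (1 - (1 - t) ^ (i + 1))) = 0 := by
    have h := prod_dvd_prod_of_dvd (s := range n) (fun _ ↦ t) (fun i ↦ 1 - (1 - t) ^ (i + 1))
      fun i _ ↦ dvd_one_sub_one_sub_pow t (i + 1)
    rw [prod_const, card_range] at h
    obtain ⟨c, hc⟩ := h
    rw [hc]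
    linear_combination (z * u ^ (n + 1) * c) * ht
  rw [sum_range_succ', sum_range_succ _ n, mul_add, sub_sub_cancel, hlast, add_zero,
    prod_range_zero, add_comm] at key
  simp only [hIcc, hIcc', Nat.add_sub_cancel]
  convert key using 2
  · simp only [mul_comm]
  · rw [mul_sum]
    refine sum_congr rfl fun m _ ↦ ?_
    rw [← sum_choose_mul_pow_eq_inv_pow hzt hu m, mul_assoc]
    congr 2
    refine sum_congr rfl fun j _ ↦ ?_
    rw [Int.cast_natCast, Nat.choose_symm_add]

theorem MvPolynomial.coeff_eq_zero_of_X_pow_dvd {σ R : Type*} [CommSemiring R]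
    {i : σ} {k : ℕ} {f : MvPolynomial σ R} (hf : X i ^ k ∣ f) {m : σ →₀ ℕ} (hm : m i < k) :
    f.coeff m = 0 := by
  obtain ⟨g, rfl⟩ := hf
  rw [X_pow_eq_monomial, coeff_monomial_mul', if_neg]
  exact fun h ↦ absurd (h i) (by simpa using hm)


/-- For all `n, d ≥ 1`, the two refinements of the Fishburn generating function by
Remmel and Kitaev agree: the coefficient of `z^d t^n` in
`1 + Σ_{m=1}^{n} ∏_{i=1}^{m} (1 - (1-t)^{i-1}(1-zt))` equals the coefficient of
`z^d t^n` in
`1 + Σ_{m=1}^{n} [ zt · (Σ_{j=0}^{n} C(m-1+j,j)(zt)^j) · ∏_{i=1}^{m-1} (1-(1-t)^i) ]`. -/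
theorem remmel_kitaev_refinements_agree (n d : ℕ) (hn : 1 ≤ n) (hd : 1 ≤ d) :
    (refinedPoly n).coeff (Finsupp.single 0 d + Finsupp.single 1 n) =
      (refinedPoly' n).coeff (Finsupp.single 0 d + Finsupp.single 1 n) := by
  rw [← sub_eq_zero, ← MvPolynomial.coeff_sub]
  refine MvPolynomial.coeff_eq_zero_of_X_pow_dvd (i := 1) (k := n + 1) ?_ (by simp)
  rw [← Ideal.mem_span_singleton, ← Ideal.Quotient.eq]
  set π := Ideal.Quotient.mk (Ideal.span {(MvPolynomial.X 1 : MvPolynomial (Fin 2) ℤ) ^ (n + 1)})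
    with hπ
  have ht : π tVar ^ (n + 1) = 0 := by
    rw [← map_pow, hπ, Ideal.Quotient.eq_zero_iff_mem]
    exact Ideal.mem_span_singleton_self _
  simpa [refinedPoly, refinedPoly'] using refinements_eq_of_pow_eq_zero (z := π zVar) ht
end

section
/- For every m ≥ 1 and all n, d ≥ 1, the number of pairs (λ, A), where λ = (λ_1, ..., λ_m) is a sequence of nonnegative integers with λ_1 > 0 and λ_1 + ... + λ_m = d, and A is a Fishburn diagram with exactly m-1 columns and n-d dots, equals (-1)^{n-d+m-1} times the coefficient of z^d t^n in the integer polynomial (zt) · (Σ_{j=0}^{n} C(m-1+j, j) (zt)^j) · ∏_{i=1}^{m-1} (1 - (1-t)^i). -/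
/-- The Fishburn diagrams with `M` columns. -/
def fishburnDiagrams (M : ℕ) : Finset (Fin M → Finset ℕ) :=
  Fintype.piFinset fun i => (Finset.range (i.1 + 1)).powerset.erase ∅

theorem mem_fishburnDiagrams {M : ℕ} {A : Fin M → Finset ℕ} :
    A ∈ fishburnDiagrams M ↔ ∀ i : Fin M, A i ≠ ∅ ∧ A i ⊆ Finset.range (i.1 + 1) := by
  simp [fishburnDiagrams, Fintype.mem_piFinset]

theorem Finset.sum_powerset_erase_empty_pow_card {R : Type*} [CommRing R] {α : Type*}
    [DecidableEq α] (s : Finset α) (x : R) :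
    ∑ A ∈ s.powerset.erase ∅, x ^ A.card = (x + 1) ^ s.card - 1 := by
  rw [Finset.sum_erase_eq_sub (Finset.empty_mem_powerset s)]
  simpa using Finset.sum_pow_mul_eq_add_pow x 1 s

theorem prod_one_sub_pow_eq_sum_fishburnDiagrams {R : Type*} [CommRing R] (M : ℕ) (x : R) :
    ∏ i ∈ Finset.Icc 1 M, (1 - (1 - x) ^ i) =
      ∑ A ∈ fishburnDiagrams M, (-1) ^ (M + ∑ i, (A i).card) * x ^ ∑ i, (A i).card := by
  have hcol (i : Fin M) : 1 - (1 - x) ^ (i.1 + 1) =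
      ∑ A ∈ (Finset.range (i.1 + 1)).powerset.erase ∅, -(-x) ^ A.card := by
    rw [Finset.sum_neg_distrib, Finset.sum_powerset_erase_empty_pow_card, Finset.card_range]
    ring
  rw [← Finset.Ico_add_one_right_eq_Icc, Finset.prod_Ico_eq_prod_range, Nat.add_sub_cancel,
    Finset.prod_range]
  simp_rw [add_comm 1, hcol]
  rw [Finset.prod_univ_sum]
  refine Finset.sum_congr rfl fun A _ => ?_
  rw [Finset.prod_neg, Finset.prod_pow_eq_pow_sum, neg_pow x, Finset.card_univ, Fintype.card_fin,
    pow_add, mul_assoc]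

theorem coeff_prod_one_sub_pow (M k : ℕ) :
    (∏ i ∈ Finset.Icc 1 M, (1 - (1 - Polynomial.X (R := ℤ)) ^ i)).coeff k =
      (-1) ^ (k + M) * ({A ∈ fishburnDiagrams M | ∑ i, (A i).card = k}.card : ℤ) := by
  rw [prod_one_sub_pow_eq_sum_fishburnDiagrams, Polynomial.finsetSum_coeff,
    Finset.card_filter, Nat.cast_sum, Finset.mul_sum]
  refine Finset.sum_congr rfl fun A _ => ?_
  have h : ((-1 : Polynomial ℤ) ^ (M + ∑ i, (A i).card)) =
      Polynomial.C ((-1) ^ (M + ∑ i, (A i).card)) := by simp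
  rw [h, Polynomial.coeff_C_mul_X_pow]
  by_cases hA : ∑ i, (A i).card = k
  · simp [hA, add_comm]
  · simp [hA, Ne.symm hA]

theorem coeff_zVar_pow_mul_aeval_tVar (P : Polynomial ℤ) (a d n : ℕ) :
    (zVar ^ a * Polynomial.aeval tVar P).coeff (Finsupp.single 0 d + Finsupp.single 1 n) =
      if a = d then P.coeff n else 0 := by
  induction P using Polynomial.induction_on' with
  | add p q hp hq =>
    rw [map_add, mul_add, MvPolynomial.coeff_add, hp, hq, Polynomial.coeff_add]
    split_ifs <;> simp
  | monomial k c =>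
    have h : zVar ^ a * Polynomial.aeval tVar (Polynomial.monomial k c) =
        MvPolynomial.monomial (Finsupp.single 0 a + Finsupp.single 1 k) c := by
      rw [Polynomial.aeval_monomial, zVar, tVar, MvPolynomial.X_pow_eq_monomial,
        MvPolynomial.X_pow_eq_monomial, MvPolynomial.algebraMap_eq, MvPolynomial.C_mul_monomial,
        MvPolynomial.monomial_mul]
      simp
    have hexp : (Finsupp.single 0 a + Finsupp.single 1 k : Fin 2 →₀ ℕ) =
        Finsupp.single 0 d + Finsupp.single 1 n ↔ a = d ∧ k = n := by
      simp [Finsupp.ext_iff, Fin.forall_fin_two]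
    rw [h, MvPolynomial.coeff_monomial, Polynomial.coeff_monomial]
    simp only [hexp, ite_and]

theorem coeff_zVar_mul_tVar_mul_sum_mul_aeval (c : ℕ → ℤ) (N : ℕ) (P : Polynomial ℤ)
    {n d : ℕ} (hd : 1 ≤ d) (hN : n ≤ N) :
    (zVar * tVar * (∑ j ∈ Finset.range N, (c j : MvPolynomial (Fin 2) ℤ) * (zVar * tVar) ^ j) *
        Polynomial.aeval tVar P).coeff (Finsupp.single 0 d + Finsupp.single 1 n) =
      if d ≤ n then c (d - 1) * P.coeff (n - d) else 0 := by
  have hterm (j : ℕ) : zVar * tVar * ((c j : MvPolynomial (Fin 2) ℤ) * (zVar * tVar) ^ j) *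
      Polynomial.aeval tVar P =
      zVar ^ (j + 1) *
        Polynomial.aeval tVar (Polynomial.C (c j) * (P * Polynomial.X ^ (j + 1))) := by
    simp only [map_mul, map_pow, Polynomial.aeval_X, eq_intCast, map_intCast]
    ring
  rw [Finset.mul_sum, Finset.sum_mul, MvPolynomial.coeff_sum]
  simp_rw [hterm, coeff_zVar_pow_mul_aeval_tVar, Polynomial.coeff_C_mul,
    Polynomial.coeff_mul_X_pow']
  obtain ⟨e, rfl⟩ := Nat.exists_eq_add_of_le' hd
  simp only [add_left_inj, Finset.sum_ite_eq', Finset.mem_range, Nat.add_sub_cancel]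
  split_ifs <;> omega

theorem ncard_sum_eq_of_pos (M d : ℕ) (hd : 1 ≤ d) :
    {f : Fin (M + 1) → ℕ | 0 < f 0 ∧ ∑ i, f i = d}.ncard = (M + (d - 1)).choose (d - 1) := by
  obtain ⟨e, rfl⟩ := Nat.exists_eq_add_of_le' hd
  have himage : {f : Fin (M + 1) → ℕ | 0 < f 0 ∧ ∑ i, f i = e + 1} =
      (fun g => g + Pi.single 0 1) '' {g : Fin (M + 1) → ℕ | ∑ i, g i = e} := by
    ext f
    constructor
    · rintro ⟨h0, hf⟩
      have hle : Pi.single 0 1 ≤ f := by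
        intro i
        by_cases hi : i = 0
        · subst hi; simpa using Nat.succ_le_of_lt h0
        · simp [hi]
      have hsub : f - Pi.single 0 1 + Pi.single 0 1 = f := tsub_add_cancel_of_le hle
      refine ⟨f - Pi.single 0 1, ?_, hsub⟩
      rw [← hsub] at hf
      simpa [-Pi.sub_apply, Finset.sum_add_distrib] using hf
    · rintro ⟨g, hg, rfl⟩
      simp_all [Finset.sum_add_distrib]
  rw [himage, Set.ncard_image_of_injective _ (add_left_injective _), ← Nat.card_coe_set_eq]
  change Nat.card {g : Fin (M + 1) → ℕ // ∑ i, g i = e} = _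
  rw [← Nat.card_congr (Sym.equivNatSumOfFintype (Fin (M + 1)) e), Nat.card_eq_fintype_card,
    Sym.card_sym_eq_choose, Fintype.card_fin]
  congr 1
  omega

/-- For `m ≥ 1` and `n, d ≥ 1`, the number of pairs `(λ, A)`, where
`λ = (λ_1, …, λ_m)` is a sequence of nonnegative integers with `λ_1 > 0` and
`λ_1 + … + λ_m = d`, and `A` is a Fishburn diagram with exactly `m - 1` columns
(each `A_i` a nonempty subset of `{0, …, i-1}`, 0-based `A i ⊆ {0, …, i}`) and
`n - d` dots, equals `(-1)^{n-d+m-1}` times the coefficient of `z^d t^n` in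
`zt · (Σ_{j=0}^{n} C(m-1+j, j)(zt)^j) · ∏_{i=1}^{m-1} (1 - (1-t)^i)`. -/
theorem tilde_Ynd_count (m n d : ℕ) (hm : 1 ≤ m) (hn : 1 ≤ n) (hd : 1 ≤ d) :
    ({p : (Fin m → ℕ) × (Fin (m - 1) → Finset ℕ) |
        0 < p.1 ⟨0, hm⟩ ∧ (∑ i, p.1 i) = d ∧
        (∀ i : Fin (m - 1), p.2 i ≠ ∅ ∧ p.2 i ⊆ Finset.range (i.1 + 1)) ∧
        ((∑ i, ((p.2 i).card : ℤ)) = (n : ℤ) - d)}.ncard : ℤ) =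
      (-1 : ℤ) ^ (n - d + (m - 1)) *
        (zVar * tVar *
            (∑ j ∈ Finset.range (n + 1),
              (((m - 1 + j).choose j : ℤ) : MvPolynomial (Fin 2) ℤ) * (zVar * tVar) ^ j) *
            ∏ i ∈ Finset.Icc 1 (m - 1), (1 - (1 - tVar) ^ i)).coeff
          (Finsupp.single 0 d + Finsupp.single 1 n) := by
  obtain ⟨M, rfl⟩ := Nat.exists_eq_add_of_le' hm
  change ({p : (Fin (M + 1) → ℕ) × (Fin M → Finset ℕ) |
      0 < p.1 0 ∧ (∑ i, p.1 i) = d ∧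
      (∀ i : Fin M, p.2 i ≠ ∅ ∧ p.2 i ⊆ Finset.range (i.1 + 1)) ∧
      ((∑ i, ((p.2 i).card : ℤ)) = (n : ℤ) - d)}.ncard : ℤ) = _
  have hprod : ∏ i ∈ Finset.Icc 1 M, (1 - (1 - tVar) ^ i) = Polynomial.aeval tVar
      (∏ i ∈ Finset.Icc 1 M, (1 - (1 - Polynomial.X (R := ℤ)) ^ i)) := by simp
  rw [Nat.add_sub_cancel, hprod,
    coeff_zVar_mul_tVar_mul_sum_mul_aeval (fun j => ((M + j).choose j : ℤ)) _ _ hd n.le_succ]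
  split_ifs with hdn
  · have hset : {p : (Fin (M + 1) → ℕ) × (Fin M → Finset ℕ) |
        0 < p.1 0 ∧ (∑ i, p.1 i) = d ∧
        (∀ i : Fin M, p.2 i ≠ ∅ ∧ p.2 i ⊆ Finset.range (i.1 + 1)) ∧
        ((∑ i, ((p.2 i).card : ℤ)) = (n : ℤ) - d)} =
        {f : Fin (M + 1) → ℕ | 0 < f 0 ∧ ∑ i, f i = d} ×ˢ
          (({A ∈ fishburnDiagrams M | ∑ i, (A i).card = n - d} : Finset _) : Set _) := by
      ext p
      simp only [Set.mem_ofPred_eq, Set.mem_prod, Finset.mem_coe, Finset.mem_filter,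
        mem_fishburnDiagrams, and_assoc, ← Nat.cast_sub hdn, ← Nat.cast_sum, Nat.cast_inj]
    rw [hset, Set.ncard_prod, ncard_sum_eq_of_pos M d hd, Set.ncard_coe_finset,
      coeff_prod_one_sub_pow, mul_left_comm, ← mul_assoc ((-1 : ℤ) ^ _) ((-1) ^ _), ← mul_pow]
    simp
  · rw [mul_zero, Nat.cast_eq_zero]
    refine (congrArg Set.ncard (Set.eq_empty_of_forall_notMem fun p hp => ?_)).trans
      (Set.ncard_empty _)
    have : 0 ≤ ∑ i, ((p.2 i).card : ℤ) := by positivity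
    have := hp.2.2.2
    omega
end

section
/- For all n ≥ 1 and 1 ≤ d ≤ n, the number of pairs (λ, b), where λ = (λ_1, ..., λ_{n-d+1}) is a sequence of nonnegative integers with λ_1 > 0 and λ_1 + ... + λ_{n-d+1} = d, and b = b_1 b_2 ... b_{n-d} is a sequence of integers with 0 ≤ b_i ≤ i-1 for each i, such that for every choice of indices p < q and integer j with b_p = j+1 and b_q = j one has λ_{j+2} ≠ 0, equals the cardinality of T_{n,d}. -/
namespace InversionTable

variable {m : ℕ}

/-- The sum `l 0 + ⋯ + l k` of the entries of `l` with index at most `k`. -/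
def partialSum (l : Fin (m + 1) → ℕ) (k : ℕ) : ℕ :=
  ∑ i with i.1 ≤ k, l i

/-- The position of the `k`-th unsaturated entry, when `l i` saturated entries
stand between the unsaturated entries with indices `i - 1` and `i`. -/
def pos (l : Fin (m + 1) → ℕ) (k : ℕ) : ℕ :=
  partialSum l k + k

lemma partialSum_zero (l : Fin (m + 1) → ℕ) : partialSum l 0 = l 0 := by
  have : (Finset.univ.filter fun i : Fin (m + 1) => i.1 ≤ 0) = {0} := by
    ext i
    rw [Finset.mem_filter_univ, Finset.mem_singleton, Fin.ext_iff, Fin.val_zero, Nat.le_zero]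
  rw [partialSum, this, Finset.sum_singleton]

lemma partialSum_succ (l : Fin (m + 1) → ℕ) {k : ℕ} (h : k + 1 < m + 1) :
    partialSum l (k + 1) = partialSum l k + l ⟨k + 1, h⟩ := by
  have : (Finset.univ.filter fun i : Fin (m + 1) => i.1 ≤ k + 1) =
      insert ⟨k + 1, h⟩ (Finset.univ.filter fun i : Fin (m + 1) => i.1 ≤ k) := by
    ext i
    simp [Fin.ext_iff]
    omega
  rw [partialSum, this, Finset.sum_insert (by simp), add_comm, partialSum]

lemma partialSum_eq_sum (l : Fin (m + 1) → ℕ) : partialSum l m = ∑ i, l i := by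
  rw [partialSum, Finset.filter_true_of_mem]
  intro i _
  omega

lemma partialSum_mono (l : Fin (m + 1) → ℕ) : Monotone (partialSum l) := by
  intro a b hab
  refine Finset.sum_le_sum_of_subset ?_
  intro i
  simp only [Finset.mem_filter, Finset.mem_univ, true_and]
  omega

lemma pos_strictMono (l : Fin (m + 1) → ℕ) : StrictMono (pos l) :=
  (partialSum_mono l).add_strictMono strictMono_id

lemma pos_zero (l : Fin (m + 1) → ℕ) : pos l 0 = l 0 := by
  rw [pos, partialSum_zero, add_zero]

lemma pos_succ (l : Fin (m + 1) → ℕ) {k : ℕ} (h : k + 1 < m + 1) :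
    pos l (k + 1) = pos l k + l ⟨k + 1, h⟩ + 1 := by
  rw [pos, pos, partialSum_succ l h]
  omega

lemma pos_lt (l : Fin (m + 1) → ℕ) {k : ℕ} (hk : k < m) : pos l k < m + ∑ i, l i := by
  have := partialSum_mono l hk.le
  rw [partialSum_eq_sum] at this
  rw [pos]
  omega

lemma partialSum_injective :
    Function.Injective fun (l : Fin (m + 1) → ℕ) (k : Fin (m + 1)) => partialSum l k := by
  intro l l' h
  have h' : ∀ k, k < m + 1 → partialSum l k = partialSum l' k := fun k hk => congrFun h ⟨k, hk⟩
  funext ⟨i, hi⟩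
  cases i with
  | zero => simpa [partialSum_zero] using h' 0 hi
  | succ k =>
    have h1 := h' (k + 1) hi
    rw [partialSum_succ l hi, partialSum_succ l' hi, h' k (by omega)] at h1
    exact Nat.add_left_cancel h1

lemma exists_partialSum_eq {g : ℕ → ℕ} (hg : Monotone g) :
    ∃ l : Fin (m + 1) → ℕ, ∀ k ≤ m, partialSum l k = g k := by
  refine ⟨fun i => if i.1 = 0 then g 0 else g i - g (i - 1), fun k hk => ?_⟩
  induction k with
  | zero => simp [partialSum_zero]
  | succ k ih =>
    rw [partialSum_succ _ (by omega), ih (by omega)]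
    have := hg (Nat.le_succ k)
    simp only [Nat.succ_eq_add_one] at this
    simp
    omega

lemma exists_pos_eq {d : ℕ} {u : Fin m → ℕ} (hu : StrictMono u) (hlt : ∀ k, u k < m + d) :
    ∃ l : Fin (m + 1) → ℕ, ∑ i, l i = d ∧ ∀ k : Fin m, pos l k = u k := by
  have hle : ∀ k (hk : k < m), k ≤ u ⟨k, hk⟩ := by
    intro k
    induction k with
    | zero => simp
    | succ k ih =>
      intro hk
      have h1 := ih (by omega)
      have h2 : u ⟨k, by omega⟩ < u ⟨k + 1, hk⟩ := hu (by simp)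
      omega
  have hd : ∀ j k (hk : k < m), m = k + 1 + j → u ⟨k, hk⟩ ≤ k + d := by
    intro j
    induction j with
    | zero =>
      intro k hk h
      have := hlt ⟨k, hk⟩
      omega
    | succ j ih =>
      intro k hk h
      have h1 := ih (k + 1) (by omega) (by omega)
      have h2 : u ⟨k, hk⟩ < u ⟨k + 1, by omega⟩ := hu (by simp)
      omega
  let g : ℕ → ℕ := fun k => if h : k < m then u ⟨k, h⟩ - k else d
  have hg : Monotone g := by
    refine monotone_nat_of_le_succ fun k => ?_
    by_cases h1 : k + 1 < m
    · have h2 : u ⟨k, by omega⟩ < u ⟨k + 1, h1⟩ := hu (by simp)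
      have h3 : k < m := by omega
      simp only [g, h1, h3, dif_pos]
      omega
    · by_cases h2 : k < m
      · have := hd 0 k h2 (by omega)
        simp only [g, h1, h2, dif_pos, dif_neg, not_false_eq_true]
        omega
      · simp [g, h1, h2]
  obtain ⟨l, hl⟩ := exists_partialSum_eq (m := m) hg
  refine ⟨l, ?_, fun k => ?_⟩
  · rw [← partialSum_eq_sum, hl m le_rfl]
    simp [g]
  · rw [pos, hl k k.2.le]
    have := hle k k.2
    simp only [g, k.2, dif_pos]
    simp at this ⊢
    omega

open Classical in
/-- The table whose unsaturated positions are the `pos l k`, the entry at `pos l k`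
being one less than the position `pos l (b k)`. -/
noncomputable def table (n : ℕ) (l : Fin (m + 1) → ℕ) (b : Fin m → ℕ) (i : Fin n) : ℕ :=
  if h : ∃ k : Fin m, pos l k = i.1 then pos l (b h.choose) - 1 else i.1

variable {n : ℕ} {l : Fin (m + 1) → ℕ} {b : Fin m → ℕ}

lemma table_of_pos_eq {i : Fin n} {k : Fin m} (h : pos l k = i.1) :
    table n l b i = pos l (b k) - 1 := by
  have hex : ∃ k : Fin m, pos l k = i.1 := ⟨k, h⟩
  have hk : hex.choose = k :=
    Fin.ext ((pos_strictMono l).injective (hex.choose_spec.trans h.symm))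
  rw [table, dif_pos hex, hk]

lemma table_of_forall_ne {i : Fin n} (h : ∀ k : Fin m, pos l k ≠ i.1) :
    table n l b i = i.1 := by
  rw [table, dif_neg (by simpa using h)]

lemma pos_pos (hl : 0 < l 0) (k : ℕ) : 0 < pos l k :=
  ((pos_zero l).symm ▸ hl).trans_le ((pos_strictMono l).monotone k.zero_le)

lemma table_eq_iff (hl : 0 < l 0) (hb : ∀ k : Fin m, b k ≤ k.1) {i : Fin n} :
    table n l b i = i.1 ↔ ∀ k : Fin m, pos l k ≠ i.1 := by
  refine ⟨fun h k hk => ?_, table_of_forall_ne⟩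
  rw [table_of_pos_eq hk] at h
  have h1 := (pos_strictMono l).monotone (hb k)
  have h2 := pos_pos hl (b k)
  omega

lemma table_le (hb : ∀ k : Fin m, b k ≤ k.1) (i : Fin n) : table n l b i ≤ i.1 := by
  by_cases h : ∃ k : Fin m, pos l k = i.1
  · obtain ⟨k, hk⟩ := h
    rw [table_of_pos_eq hk]
    have := (pos_strictMono l).monotone (hb k)
    omega
  · exact (table_of_forall_ne (by simpa using h)).le

lemma table_ne_succ (hl : 0 < l 0) (hb : ∀ k : Fin m, b k ≤ k.1)
    (hlb : ∀ p q : Fin m, ∀ j : ℕ, p < q → b p = j + 1 → b q = j →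
      ∀ h : j + 1 < m + 1, l ⟨j + 1, h⟩ ≠ 0) {p q : Fin n} (hpq : p < q) :
    table n l b p ≠ table n l b q + 1 := by
  intro h
  have hp := table_le (l := l) hb p
  by_cases hq : ∃ k : Fin m, pos l k = q.1
  · obtain ⟨k, hk⟩ := hq
    have hbk := pos_pos hl (b k)
    rw [table_of_pos_eq hk, Nat.sub_add_cancel hbk] at h
    by_cases hp' : ∃ k : Fin m, pos l k = p.1
    · obtain ⟨k', hk'⟩ := hp'
      rw [table_of_pos_eq hk'] at h
      have hkk : k' < k := by
        have : pos l k' < pos l k := by rw [hk, hk']; exact hpq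
        exact (pos_strictMono l).lt_iff_lt.1 this
      have h1 : pos l (b k') = pos l (b k) + 1 := by omega
      have h2 : b k < b k' := (pos_strictMono l).lt_iff_lt.1 (by omega)
      have h3 := (pos_strictMono l).monotone (Nat.succ_le_of_lt h2)
      have h4 : b k + 1 < m + 1 := by
        have := hb k
        omega
      simp only [Nat.succ_eq_add_one] at h3
      have h5 := pos_succ l h4
      have h6 : b k' = b k + 1 := (pos_strictMono l).injective (by omega)
      exact hlb k' k (b k) hkk h6 rfl h4 (by omega)
    · have hp'' : ∀ k : Fin m, pos l k ≠ p.1 := by simpa using hp'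
      rw [table_of_forall_ne hp''] at h
      have h1 : b k < m := (hb k).trans_lt k.2
      exact hp'' ⟨b k, h1⟩ h.symm
  · rw [table_of_forall_ne (i := q) (by simpa using hq)] at h
    have : p.1 < q.1 := hpq
    omega

lemma card_filter_table_eq (hl : 0 < l 0) (hb : ∀ k : Fin m, b k ≤ k.1)
    (hn : n = m + ∑ i, l i) :
    (Finset.univ.filter fun i : Fin n => table n l b i = i.1).card = ∑ i, l i := by
  have hcompl : (Finset.univ.filter fun i : Fin n => ¬ table n l b i = i.1) =
      Finset.univ.image fun k : Fin m => (⟨pos l k, hn ▸ pos_lt l k.2⟩ : Fin n) := by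
    ext i
    simp [table_eq_iff hl hb, Fin.ext_iff]
  have hcard := Finset.card_filter_add_card_filter_not (s := Finset.univ)
    (fun i : Fin n => table n l b i = i.1)
  rw [hcompl, Finset.card_image_of_injective, Finset.card_univ, Finset.card_univ,
    Fintype.card_fin, Fintype.card_fin] at hcard
  · omega
  · intro k k' h
    exact Fin.ext ((pos_strictMono l).injective (Fin.ext_iff.1 h))

lemma table_injective {l' : Fin (m + 1) → ℕ} {b' : Fin m → ℕ} (hl : 0 < l 0) (hl' : 0 < l' 0)
    (hb : ∀ k : Fin m, b k ≤ k.1) (hb' : ∀ k : Fin m, b' k ≤ k.1)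
    (hn : n = m + ∑ i, l i) (hn' : n = m + ∑ i, l' i)
    (h : table n l b = table n l' b') : l = l' ∧ b = b' := by
  have hmono : ∀ l : Fin (m + 1) → ℕ, StrictMono fun k : Fin m => pos l k :=
    fun l _ _ hkk => pos_strictMono l hkk
  have hpos : (fun k : Fin m => pos l k) = fun k : Fin m => pos l' k := by
    refine ((hmono l).range_inj (hmono l')).1 (Set.ext fun i => ?_)
    by_cases hi : i < n
    · have h1 := table_eq_iff (i := (⟨i, hi⟩ : Fin n)) hl hb
      have h2 := table_eq_iff (i := (⟨i, hi⟩ : Fin n)) hl' hb'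
      rw [h, h2] at h1
      simpa using (not_congr h1).symm
    · simp only [Set.mem_range]
      constructor <;> rintro ⟨k, rfl⟩ <;> exfalso <;> apply hi
      · exact hn ▸ pos_lt l k.2
      · exact hn' ▸ pos_lt l' k.2
  have hll : l = l' := by
    refine partialSum_injective (funext fun k => ?_)
    by_cases hk : k.1 < m
    · have := congrFun hpos ⟨k, hk⟩
      simpa [pos] using this
    · have : k.1 = m := by omega
      simp only [this, partialSum_eq_sum]
      omega
  subst hll
  refine ⟨rfl, funext fun k => ?_⟩
  have h1 := congrFun h ⟨pos l k, hn ▸ pos_lt l k.2⟩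
  rw [table_of_pos_eq (k := k) rfl, table_of_pos_eq (k := k) rfl] at h1
  have h2 := pos_pos hl (b k)
  have h3 := pos_pos hl (b' k)
  exact (pos_strictMono l).injective (by omega)

lemma exists_table_eq {d : ℕ} (hd : 1 ≤ d) (hn : n = m + d) {a : Fin n → ℕ}
    (ha : ∀ i, a i ≤ i.1) (hav : ¬ ∃ p q : Fin n, p < q ∧ a p = a q + 1)
    (hcard : (Finset.univ.filter fun i : Fin n => a i = i.1).card = d) :
    ∃ (l : Fin (m + 1) → ℕ) (b : Fin m → ℕ), 0 < l 0 ∧ ∑ i, l i = d ∧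
      (∀ k : Fin m, b k ≤ k.1) ∧
      (∀ p q : Fin m, ∀ j : ℕ, p < q → b p = j + 1 → b q = j →
        ∀ h : j + 1 < m + 1, l ⟨j + 1, h⟩ ≠ 0) ∧ table n l b = a := by
  have hcard' : (Finset.univ.filter fun i : Fin n => ¬ a i = i.1).card = m := by
    have := Finset.card_filter_add_card_filter_not (s := Finset.univ)
      (fun i : Fin n => a i = i.1)
    rw [hcard, Finset.card_univ, Fintype.card_fin] at this
    omega
  let u := Finset.orderEmbOfFin _ hcard'
  have hu : ∀ i : Fin n, a i ≠ i.1 ↔ ∃ k, u k = i := by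
    intro i
    have := Set.ext_iff.1 (Finset.range_orderEmbOfFin _ hcard') i
    rw [Finset.mem_coe, Finset.mem_filter_univ] at this
    exact this.symm
  obtain ⟨l, hsum, hl⟩ := exists_pos_eq (d := d) (u := fun k => (u k).1)
    (fun _ _ hkk => u.strictMono hkk) (fun k => hn ▸ (u k).2)
  have hb : ∀ k : Fin m, ∃ k' : Fin m, (u k').1 = a (u k) + 1 := by
    intro k
    have hne := (hu (u k)).2 ⟨k, rfl⟩
    have hlt := lt_of_le_of_ne (ha (u k)) hne
    have hi : a (u k) + 1 < n := by omega
    obtain ⟨k', hk'⟩ := (hu ⟨a (u k) + 1, hi⟩).1 (by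
      intro heq
      rcases Nat.lt_or_ge (a (u k) + 1) (u k) with h | h
      · exact hav ⟨⟨a (u k) + 1, hi⟩, u k, h, heq⟩
      · have hi' : (⟨a (u k) + 1, hi⟩ : Fin n) = u k := Fin.ext (by simp; omega)
        rw [hi'] at heq
        exact (hu (u k)).2 ⟨k, rfl⟩ heq)
    exact ⟨k', by rw [hk']⟩
  choose b hb using hb
  have hval : ∀ k, pos l (b k) = a (u k) + 1 := fun k => (hl (b k)).trans (hb k)
  refine ⟨l, fun k => b k, ?_, hsum, fun k => ?_, ?_, ?_⟩
  · rcases Nat.eq_zero_or_pos m with rfl | hm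
    · simp at hsum
      omega
    · have h0 : l 0 = (u ⟨0, hm⟩).1 := (pos_zero l).symm.trans (hl ⟨0, hm⟩)
      have hne := (hu (u ⟨0, hm⟩)).2 ⟨_, rfl⟩
      have := ha (u ⟨0, hm⟩)
      omega
  · have hne := (hu (u k)).2 ⟨k, rfl⟩
    have hle := ha (u k)
    have h1 := hval k
    have h2 := hl k
    have h3 : pos l (b k) ≤ pos l k := by omega
    exact (pos_strictMono l).le_iff_le.1 h3
  · intro p q j hpq hp hq h h0
    refine hav ⟨u p, u q, u.strictMono hpq, ?_⟩
    have h1 := hval p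
    have h2 := hval q
    have h3 := pos_succ l h
    simp only at hp hq
    rw [hp] at h1
    rw [hq] at h2
    omega
  · funext i
    by_cases hi : a i = i.1
    · rw [hi]
      refine table_of_forall_ne fun k hk => (hu i).2 ⟨k, Fin.ext ?_⟩ hi
      rw [← hk, hl]
    · obtain ⟨k, rfl⟩ := (hu i).1 hi
      rw [table_of_pos_eq (hl k), hval]
      rfl

end InversionTable

/-- For `n ≥ 1` and `1 ≤ d ≤ n`, the number of pairs `(λ, b)`, where
`λ = (λ_1, …, λ_{n-d+1})` is a sequence of nonnegative integers with `λ_1 > 0` and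
`λ_1 + … + λ_{n-d+1} = d`, and `b = b_1 … b_{n-d}` is a sequence with
`0 ≤ b_i ≤ i - 1` (0-based: `b i ≤ i`) such that whenever `p < q`, `b_p = j + 1` and
`b_q = j`, one has `λ_{j+2} ≠ 0` (0-based index `j + 1`), equals `|T_{n,d}|`,
the number of inversion tables of length `n` with no decreasing subsequence of
consecutive integers and with `a_i = i - 1` (0-based: `a i = i`) for exactly `d`
values of `i`. -/
theorem fixed_points_count_eq_Tnd (n d : ℕ) (hn : 1 ≤ n) (hd : 1 ≤ d) (hdn : d ≤ n) :
    {p : (Fin (n - d + 1) → ℕ) × (Fin (n - d) → ℕ) |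
        0 < p.1 ⟨0, Nat.succ_pos _⟩ ∧ (∑ i, p.1 i) = d ∧
        (∀ i : Fin (n - d), p.2 i ≤ i.1) ∧
        (∀ p' q' : Fin (n - d), ∀ j : ℕ, p' < q' → p.2 p' = j + 1 → p.2 q' = j →
          ∀ h : j + 1 < n - d + 1, p.1 ⟨j + 1, h⟩ ≠ 0)}.ncard =
      {a : Fin n → ℕ | (∀ i, a i ≤ i.1) ∧
        (¬ ∃ p q : Fin n, p < q ∧ a p = a q + 1) ∧
        (Finset.univ.filter (fun i : Fin n => a i = i.1)).card = d}.ncard := by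
  generalize hm : n - d = m
  have hnm : n = m + d := by omega
  refine Set.ncard_congr (fun p _ => InversionTable.table n p.1 p.2) ?_ ?_ ?_
  · rintro ⟨l, b⟩ ⟨hl, rfl, hb, hlb⟩
    exact ⟨InversionTable.table_le hb,
      fun ⟨_, _, hpq, h⟩ => InversionTable.table_ne_succ hl hb hlb hpq h,
      InversionTable.card_filter_table_eq hl hb hnm⟩
  · rintro ⟨l, b⟩ ⟨l', b'⟩ ⟨hl, hs, hb, _⟩ ⟨hl', hs', hb', _⟩ h
    exact Prod.ext_iff.2 (InversionTable.table_injective hl hl' hb hb'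
      (hnm.trans (congrArg (m + ·) hs.symm)) (hnm.trans (congrArg (m + ·) hs'.symm)) h)
  · rintro a ⟨ha, hav, hcard⟩
    obtain ⟨l, b, hl, hs, hb, hlb, h⟩ := InversionTable.exists_table_eq hd hnm ha hav hcard
    exact ⟨(l, b), ⟨hl, hs, hb, hlb⟩, h⟩
end

section
/- Let X be a matching on [2n-2] with exactly j left-nestings, where n ≥ 2. Among the 2n-1 matchings on [2n] obtained from X by inserting a new arc whose right endpoint is 2n (i.e., for each position 1 ≤ a ≤ 2n-1, adding the pair (a, 2n) after shifting all endpoints of X that are ≥ a up by one), exactly n+j have exactly j left-nestings, exactly n-1-j have exactly j+1 left-nestings, and none have any other number of left-nestings. -/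
/-- A matching on `[2n] = {1, …, 2n}`: a finite set of pairs `(a, b)` with `a < b`,
whose endpoints are exactly `{1, …, 2n}`, with all endpoints pairwise distinct. -/
def IsMatching (n : ℕ) (X : Finset (ℕ × ℕ)) : Prop :=
  (∀ p ∈ X, p.1 < p.2) ∧
  (∀ i : ℕ, (1 ≤ i ∧ i ≤ 2 * n) ↔ ∃ p ∈ X, i = p.1 ∨ i = p.2) ∧
  (∀ p ∈ X, ∀ q ∈ X, p ≠ q → p.1 ≠ q.1 ∧ p.1 ≠ q.2 ∧ p.2 ≠ q.1 ∧ p.2 ≠ q.2)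

/-- The number of left-nestings of `X`: pairs of pairs `(a,b), (c,d) ∈ X` with
`a < c < d < b` and `c = a + 1`. -/
def numLeftNestings (X : Finset (ℕ × ℕ)) : ℕ :=
  ((X ×ˢ X).filter fun pq => pq.2.1 = pq.1.1 + 1 ∧ pq.2.1 < pq.2.2 ∧ pq.2.2 < pq.1.2).card

/-- Insert a new arc `(a, M)`: shift all endpoints of `X` that are `≥ a` up by one and
add the pair `(a, M)`. -/
def insertArc (X : Finset (ℕ × ℕ)) (a M : ℕ) : Finset (ℕ × ℕ) :=
  (X.image fun p => (if a ≤ p.1 then p.1 + 1 else p.1, if a ≤ p.2 then p.2 + 1 else p.2))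
    ∪ {(a, M)}

open Finset

/-- The left-nestings of `X`, as pairs (outer arc, inner arc). -/
def leftNestings (X : Finset (ℕ × ℕ)) : Finset ((ℕ × ℕ) × (ℕ × ℕ)) :=
  (X ×ˢ X).filter fun pq => pq.2.1 = pq.1.1 + 1 ∧ pq.2.1 < pq.2.2 ∧ pq.2.2 < pq.1.2

/-- The shift of endpoints performed by `insertArc`. -/
def shiftArc (a : ℕ) (p : ℕ × ℕ) : ℕ × ℕ :=
  (if a ≤ p.1 then p.1 + 1 else p.1, if a ≤ p.2 then p.2 + 1 else p.2)

theorem mem_leftNestings {X : Finset (ℕ × ℕ)} {p q : ℕ × ℕ} :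
    (p, q) ∈ leftNestings X ↔ (p ∈ X ∧ q ∈ X) ∧ q.1 = p.1 + 1 ∧ q.1 < q.2 ∧ q.2 < p.2 := by
  simp [leftNestings]

theorem mem_insertArc {X : Finset (ℕ × ℕ)} {a M : ℕ} {p : ℕ × ℕ} :
    p ∈ insertArc X a M ↔ (∃ q ∈ X, shiftArc a q = p) ∨ p = (a, M) := by
  simp [insertArc, shiftArc, or_comm]

theorem shiftArc_injective (a : ℕ) : Function.Injective (shiftArc a) := by
  rintro ⟨p, p'⟩ ⟨q, q'⟩ h
  simp only [shiftArc, Prod.mk.injEq] at h ⊢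
  grind

theorem shiftArc_leftNesting_iff (a : ℕ) (p q : ℕ × ℕ) :
    ((shiftArc a q).1 = (shiftArc a p).1 + 1 ∧ (shiftArc a q).1 < (shiftArc a q).2 ∧
      (shiftArc a q).2 < (shiftArc a p).2) ↔
    (q.1 = p.1 + 1 ∧ q.1 < q.2 ∧ q.2 < p.2) ∧ q.1 ≠ a := by
  simp only [shiftArc]
  grind

theorem leftNestings_insertArc {X : Finset (ℕ × ℕ)} {a M : ℕ}
    (hX : ∀ p ∈ X, p.1 < p.2 ∧ p.2 + 1 < M) :
    leftNestings (insertArc X a M) =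
      ((leftNestings X).filter fun pq => pq.2.1 ≠ a).image
          (Prod.map (shiftArc a) (shiftArc a)) ∪
        (X.filter fun p => p.1 = a).image fun p => ((a, M), shiftArc a p) := by
  have h_lt : ∀ p ∈ X, (shiftArc a p).2 < M := by
    intro p hp
    have := hX p hp
    simp only [shiftArc]
    grind
  have h_adj : ∀ p ∈ X, ((shiftArc a p).1 = a + 1 ∧ (shiftArc a p).1 < (shiftArc a p).2 ∧
      (shiftArc a p).2 < M) ↔ p.1 = a := by
    intro p hp
    have := hX p hp
    simp only [shiftArc]
    grind
  ext ⟨p, q⟩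
  simp only [mem_leftNestings, mem_insertArc, mem_union, mem_image, mem_filter, Prod.exists,
    Prod.map_apply, Prod.mk.injEq]
  constructor
  · rintro ⟨⟨⟨p₁, p₂, hp, rfl⟩ | rfl, ⟨q₁, q₂, hq, rfl⟩ | rfl⟩, h⟩
    · rw [shiftArc_leftNesting_iff] at h
      exact .inl ⟨p₁, p₂, q₁, q₂, ⟨⟨⟨hp, hq⟩, h.1⟩, h.2⟩, rfl, rfl⟩
    · have := h_lt _ hp
      grind
    · exact .inr ⟨q₁, q₂, ⟨hq, (h_adj _ hq).1 h⟩, rfl, rfl⟩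
    · grind
  · rintro (⟨p₁, p₂, q₁, q₂, ⟨⟨⟨hp, hq⟩, h⟩, h'⟩, rfl, rfl⟩ | ⟨q₁, q₂, ⟨hq, h⟩, rfl, rfl⟩)
    · exact ⟨⟨.inl ⟨_, _, hp, rfl⟩, .inl ⟨_, _, hq, rfl⟩⟩,
        (shiftArc_leftNesting_iff _ _ _).2 ⟨h, h'⟩⟩
    · exact ⟨⟨.inr rfl, .inl ⟨_, _, hq, rfl⟩⟩, (h_adj _ hq).2 h⟩

theorem numLeftNestings_insertArc {X : Finset (ℕ × ℕ)} {a M : ℕ}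
    (hX : ∀ p ∈ X, p.1 < p.2 ∧ p.2 + 1 < M) :
    numLeftNestings (insertArc X a M) + #{pq ∈ leftNestings X | pq.2.1 = a} =
      numLeftNestings X + #{p ∈ X | p.1 = a} := by
  change #(leftNestings _) + _ = #(leftNestings _) + _
  rw [leftNestings_insertArc hX, card_union_of_disjoint, card_image_of_injective,
    card_image_of_injective, ← card_filter_add_card_filter_not (s := leftNestings X)
      (fun pq => pq.2.1 = a)]
  · simp only [ne_eq]
    ring
  · intro p q h
    exact shiftArc_injective a (Prod.mk.inj h).2
  · exact (shiftArc_injective a).prodMap (shiftArc_injective a)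
  · rw [disjoint_left]
    rintro ⟨p, q⟩ h h'
    simp only [mem_image, Prod.exists, Prod.map_apply, Prod.mk.injEq] at h h'
    obtain ⟨p₁, p₂, -, -, -, hp, -⟩ := h
    obtain ⟨-, -, -, hp', -⟩ := h'
    have := congrArg Prod.fst (hp.trans hp'.symm)
    simp only [shiftArc] at this
    grind

theorem IsMatching.eq_of_fst_eq {n : ℕ} {X : Finset (ℕ × ℕ)} (hX : IsMatching n X)
    {p q : ℕ × ℕ} (hp : p ∈ X) (hq : q ∈ X) (h : p.1 = q.1) : p = q := by
  by_contra hne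
  exact (hX.2.2 p hp q hq hne).1 h

theorem IsMatching.card_eq {n : ℕ} {X : Finset (ℕ × ℕ)} (hX : IsMatching n X) : #X = n := by
  have h_union : Icc 1 (2 * n) = X.biUnion fun p => {p.1, p.2} := by
    ext i
    simpa using hX.2.1 i
  have h_card := congrArg card h_union
  rw [card_biUnion, sum_congr rfl fun p hp => card_pair (hX.1 p hp).ne] at h_card
  · simp at h_card
    omega
  · intro p hp q hq hne
    have := hX.2.2 p hp q hq hne
    simp [disjoint_left]
    grind

theorem IsMatching.card_filter_fst_le_one {n : ℕ} {X : Finset (ℕ × ℕ)} (hX : IsMatching n X)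
    (a : ℕ) : #{p ∈ X | p.1 = a} ≤ 1 := by
  rw [card_le_one]
  intro p hp q hq
  rw [mem_filter] at hp hq
  exact hX.eq_of_fst_eq hp.1 hq.1 (hp.2.trans hq.2.symm)

theorem IsMatching.card_leftNestings_filter_le {n : ℕ} {X : Finset (ℕ × ℕ)}
    (hX : IsMatching n X) (a : ℕ) :
    #{pq ∈ leftNestings X | pq.2.1 = a} ≤ #{p ∈ X | p.1 = a} := by
  apply card_le_card_of_injOn Prod.snd
  · rintro ⟨p, q⟩ h
    simp only [coe_filter, Set.mem_ofPred_eq, mem_leftNestings] at h ⊢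
    exact ⟨h.1.1.2, h.2⟩
  · rintro ⟨p, q⟩ h ⟨p', q'⟩ h' rfl
    simp only [coe_filter, Set.mem_ofPred_eq, mem_leftNestings] at h h'
    rw [hX.eq_of_fst_eq h.1.1.1 h'.1.1.1 (by omega)]

/-- Let `X` be a matching on `[2n-2]`, `n ≥ 2`, with exactly `j` left-nestings.  Among
the `2n - 1` matchings on `[2n]` obtained by inserting a new arc `(a, 2n)` for
`1 ≤ a ≤ 2n - 1`, exactly `n + j` have exactly `j` left-nestings, exactly `n - 1 - j`
have exactly `j + 1` left-nestings, and none have any other number of left-nestings. -/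
theorem insertArc_left_nesting_distribution (n j : ℕ) (hn : 2 ≤ n)
    (X : Finset (ℕ × ℕ)) (hX : IsMatching (n - 1) X) (hj : numLeftNestings X = j) :
    ((((Finset.Icc 1 (2 * n - 1)).filter fun a =>
        numLeftNestings (insertArc X a (2 * n)) = j).card : ℤ) = (n : ℤ) + j) ∧
    ((((Finset.Icc 1 (2 * n - 1)).filter fun a =>
        numLeftNestings (insertArc X a (2 * n)) = j + 1).card : ℤ) = (n : ℤ) - 1 - j) ∧
    (∀ c : ℕ, c ≠ j → c ≠ j + 1 →
      ((Finset.Icc 1 (2 * n - 1)).filter fun a =>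
        numLeftNestings (insertArc X a (2 * n)) = c).card = 0) := by
  have h_endpoints : ∀ p ∈ X, 1 ≤ p.1 ∧ p.1 < p.2 ∧ p.2 + 1 < 2 * n := by
    intro p hp
    have h₁ := (hX.2.1 p.1).2 ⟨p, hp, .inl rfl⟩
    have h₂ := (hX.2.1 p.2).2 ⟨p, hp, .inr rfl⟩
    have := hX.1 p hp
    omega
  have h_num (a : ℕ) := numLeftNestings_insertArc (a := a) fun p hp => (h_endpoints p hp).2
  have h_left := hX.card_filter_fst_le_one
  have h_inner := hX.card_leftNestings_filter_le
  have h_card : #X = ∑ a ∈ Icc 1 (2 * n - 1), #{p ∈ X | p.1 = a} :=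
    card_eq_sum_card_fiberwise fun p hp => by
      have := h_endpoints p hp
      simp only [coe_Icc, Set.mem_Icc]
      omega
  have h_nest : j = ∑ a ∈ Icc 1 (2 * n - 1), #{pq ∈ leftNestings X | pq.2.1 = a} :=
    hj.symm.trans <| card_eq_sum_card_fiberwise fun ⟨p, q⟩ h => by
      have := h_endpoints q (mem_leftNestings.1 h).1.2
      simp only [coe_Icc, Set.mem_Icc]
      omega
  have h_values (a : ℕ) : numLeftNestings (insertArc X a (2 * n)) = j ∨
      numLeftNestings (insertArc X a (2 * n)) = j + 1 := by
    have := h_num a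
    have := h_left a
    have := h_inner a
    omega
  have h_succ : #{a ∈ Icc 1 (2 * n - 1) | numLeftNestings (insertArc X a (2 * n)) = j + 1} + j =
      n - 1 := by
    rw [← hX.card_eq, h_card, card_filter]
    refine (congrArg (_ + ·) h_nest).trans ?_
    rw [← sum_add_distrib]
    refine sum_congr rfl fun a _ => ?_
    have := h_num a
    have := h_left a
    have := h_inner a
    split_ifs <;> omega
  have h_total := card_filter_add_card_filter_not (s := Icc 1 (2 * n - 1))
    (fun a => numLeftNestings (insertArc X a (2 * n)) = j + 1)
  have h_not : {a ∈ Icc 1 (2 * n - 1) | ¬ numLeftNestings (insertArc X a (2 * n)) = j + 1} =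
      {a ∈ Icc 1 (2 * n - 1) | numLeftNestings (insertArc X a (2 * n)) = j} :=
    filter_congr fun a _ => by
      have := h_values a
      omega
  rw [h_not, Nat.card_Icc] at h_total
  refine ⟨by omega, by omega, fun c hc hc' => ?_⟩
  rw [card_eq_zero, filter_eq_empty_iff]
  intro a _
  have := h_values a
  omega
end
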